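/- arXiv:2601.12163 — 3 statements merged into one kernel-verified Lean document; each statement's English description precedes it below -/
import Mathlib

section
/- (Theorem C) Let d ≥ 2 be an integer with λ(d) > 0, and let Q = f/g be a rational map over K of degree d that is not a polynomial (deg g ≥ 1) and satisfies Q(∞) = ∞ (deg f > deg g, so deg f = d). Let z0 ∈ K with g(z0) ≠ 0, and let r := min{|π − z0| : π ∈ K, g(π) = 0} be the shortest distance from z0 to a pole of Q. Then Q has a finite critical value v, i.e. there exists c ∈ K with g(c) ≠ 0, (f′g − fg′)(c) = 0, and v = Q(c), such that |v − Q(z0)| ≤ λ(d)^{−1}·|Q'(z0)|·r. -/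
/-!
STATEMENT 4 (Theorem C): Let `d ≥ 2` with `lam K d > 0` and let `Q = f/g` be a rational
map over `K` of degree `d` (with `f, g` coprime, `deg f = d > deg g ≥ 1`, so `Q` is not
a polynomial and fixes `∞`).  Let `z0 ∈ K` with `g(z0) ≠ 0` and let `r` be the shortest
distance from `z0` to a pole of `Q`.  Then `Q` has a finite critical value `v = Q(c)`
with `‖v − Q(z0)‖ ≤ lam K d ⁻¹ · ‖Q'(z0)‖ · r`, where
`Q'(z0) = (f'g − fg')(z0)/g(z0)²`.
-/

open Polynomial Filter

/-- `lam K d = min {‖(m : K)‖ : m ∈ {1, …, d}}`. -/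
noncomputable def lam (K : Type*) [NormedField K] (d : ℕ) : ℝ :=
  ⨅ m : Finset.Icc 1 d, ‖((m : ℕ) : K)‖

namespace CVL

theorem exists_norm_between {K : Type*} [NontriviallyNormedField K] [IsAlgClosed K]
    (ρ : K) (hρ : ρ ≠ 0) (T : Finset ℝ) :
    ∃ x : K, ‖ρ‖ < ‖x‖ ∧ ∀ v ∈ T, ‖ρ‖ < v → ‖x‖ < v := by
  have hρ' : 0 < ‖ρ‖ := norm_pos_iff.2 hρ
  obtain ⟨B, hB, hBT⟩ : ∃ B : ℝ, ‖ρ‖ < B ∧ ∀ v ∈ T, ‖ρ‖ < v → B ≤ v := by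
    induction T using Finset.induction_on with
    | empty => exact ⟨‖ρ‖ + 1, by linarith, by simp⟩
    | insert a s _ ih =>
      obtain ⟨B, hB, h⟩ := ih
      by_cases ha : ‖ρ‖ < a
      · refine ⟨min B a, lt_min hB ha, fun v hv hv' => ?_⟩
        rcases Finset.mem_insert.1 hv with rfl | hv
        · exact min_le_right _ _
        · exact (min_le_left _ _).trans (h v hv hv')
      · refine ⟨B, hB, fun v hv hv' => ?_⟩
        rcases Finset.mem_insert.1 hv with rfl | hv
        · exact absurd hv' ha
        · exact h v hv hv'
  obtain ⟨y, hy⟩ := NormedField.exists_one_lt_norm K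
  have h1 : 1 < B / ‖ρ‖ := (one_lt_div hρ').2 hB
  obtain ⟨n, hn⟩ := pow_unbounded_of_one_lt ‖y‖ h1
  have hn0 : n ≠ 0 := by
    rintro rfl
    simp at hn
    linarith
  obtain ⟨s, hs⟩ := IsAlgClosed.exists_pow_nat_eq y (Nat.pos_of_ne_zero hn0)
  have hs1 : 1 < ‖s‖ := by
    by_contra h
    push Not at h
    have := pow_le_one₀ (n := n) (norm_nonneg s) h
    rw [← norm_pow, hs] at this
    linarith
  have hs2 : ‖s‖ < B / ‖ρ‖ := by
    rw [← hs, norm_pow] at hn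
    exact lt_of_pow_lt_pow_left₀ n (by positivity) hn
  refine ⟨ρ * s, ?_, fun v hv hv' => ?_⟩
  · rw [norm_mul]; nlinarith
  · rw [norm_mul]
    rw [lt_div_iff₀ hρ'] at hs2
    have := hBT v hv hv'
    nlinarith

theorem exists_unit_nat (K : Type*) [NontriviallyNormedField K] [IsUltrametricDist K] (N : ℕ) :
    ∃ n : ℕ, N < n ∧ ‖(n : K)‖ = 1 := by
  by_cases h : ‖((N + 1 : ℕ) : K)‖ = 1
  · exact ⟨N + 1, by omega, h⟩
  · refine ⟨N + 2, by omega, ?_⟩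
    have h1 := IsUltrametricDist.norm_natCast_le_one K (N + 1)
    have : ((N + 2 : ℕ) : K) = ((N + 1 : ℕ) : K) + 1 := by push_cast; ring
    rw [this, IsUltrametricDist.norm_add_eq_max_of_norm_ne_norm (by simpa using h)]
    simpa using h1

theorem max_zero {K : Type*} [NontriviallyNormedField K] [IsAlgClosed K] [IsUltrametricDist K]
    (F : K[X]) (x : K) (A : ℝ) (h : ∀ w : K, ‖w‖ = ‖x‖ → ‖F.eval w‖ < A) :
    ‖F.eval 0‖ < A := by
  obtain ⟨n, hnN, hn⟩ := exists_unit_nat K F.natDegree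
  have hn0 : (n : K) ≠ 0 := by
    intro h0; rw [h0] at hn; simp at hn
  have : NeZero (n : K) := ⟨hn0⟩
  have hnpos : 0 < n := by omega
  have : NeZero n := ⟨by omega⟩
  obtain ⟨ζ, hζ⟩ := HasEnoughRootsOfUnity.exists_primitiveRoot K n
  have hnz : ‖ζ‖ = 1 := (pow_eq_one_iff_of_nonneg (norm_nonneg _) hnpos.ne').1
    (by rw [← norm_pow, hζ.pow_eq_one, norm_one])
  have key : ∑ i ∈ Finset.range n, F.eval (x * ζ ^ i) = n * F.eval 0 := by
    simp_rw [eval_eq_sum_range]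
    rw [Finset.sum_comm, Finset.mul_sum]
    refine Finset.sum_congr rfl fun k hk => ?_
    rcases Nat.eq_zero_or_pos k with rfl | hkpos
    · simp
    · have hk' : k < n := by have := Finset.mem_range.1 hk; omega
      have h1 : ζ ^ k ≠ 1 := hζ.pow_ne_one_of_pos_of_lt (by omega) hk'
      have h2 : ∑ i ∈ Finset.range n, (ζ ^ k) ^ i = 0 := by
        have := mul_neg_geom_sum (ζ ^ k) n
        rw [← pow_mul, mul_comm k n, pow_mul, hζ.pow_eq_one, one_pow, sub_self] at this
        exact (mul_eq_zero.1 this).resolve_left (sub_ne_zero.2 h1.symm)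
      have h3 : ∀ i, F.coeff k * (x * ζ ^ i) ^ k = (F.coeff k * x ^ k) * (ζ ^ k) ^ i := by
        intro i; rw [mul_pow, ← pow_mul, ← pow_mul, mul_comm i k]; ring
      simp_rw [h3]
      rw [← Finset.mul_sum, h2]
      simp [hkpos.ne']
  have h4 : ‖F.eval 0‖ = ‖∑ i ∈ Finset.range n, F.eval (x * ζ ^ i)‖ := by
    rw [key, norm_mul, hn, one_mul]
  rw [h4]
  have hne : (Finset.range n).Nonempty := ⟨0, by simpa using hnpos⟩
  obtain ⟨i, _, hi⟩ := IsUltrametricDist.exists_norm_finsetSum_le_of_nonempty hne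
    (fun i => F.eval (x * ζ ^ i))
  refine hi.trans_lt (h _ ?_)
  rw [norm_mul, norm_pow, hnz]; simp

theorem norm_circle {K : Type*} [NontriviallyNormedField K] [IsUltrametricDist K]
    {a b y : K} (h : ‖b - a‖ ≠ ‖y - a‖) : ‖y - b‖ = max ‖y - a‖ ‖b - a‖ := by
  have : y - b = (y - a) + (a - b) := by ring
  rw [this, IsUltrametricDist.norm_add_eq_max_of_norm_ne_norm, norm_sub_rev a b]
  rw [norm_sub_rev a b]; exact h.symm

theorem norm_near {K : Type*} [NontriviallyNormedField K] [IsUltrametricDist K]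
    {a b y : K} (h : ‖y - a‖ ≤ ‖y - b‖) : ‖y - b‖ = max ‖y - a‖ ‖b - a‖ := by
  by_cases h' : ‖b - a‖ = ‖y - a‖
  · rw [h', max_self]
    refine le_antisymm ?_ h
    have : y - b = (y - a) + (a - b) := by ring
    rw [this]
    refine (IsUltrametricDist.norm_add_le_max _ _).trans ?_
    rw [norm_sub_rev a b, h', max_self]
  · exact norm_circle h'

theorem norm_eval {K : Type*} [NontriviallyNormedField K] [IsAlgClosed K]
    (p : K[X]) (y : K) :
    ‖p.eval y‖ = ‖p.leadingCoeff‖ * (p.roots.map fun b => ‖y - b‖).prod := by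
  rw [(IsAlgClosed.splits p).eval_eq_prod_roots y, norm_mul]
  congr 1
  generalize p.roots = s
  induction s using Multiset.induction_on with
  | empty => simp
  | cons a s ih => simp [ih]

theorem prod_sub_one {K : Type*} [NontriviallyNormedField K] [IsUltrametricDist K]
    (s : Multiset K) (u v : K → K) (h : ∀ z ∈ s, ‖u z - v z‖ < ‖v z‖) :
    s = 0 ∨ ‖(s.map u).prod - (s.map v).prod‖ < ‖(s.map v).prod‖ := by
  induction s using Multiset.induction_on with
  | empty => simp
  | cons a s ih =>
    right
    have ha := h a (by simp)
    have hu : ‖u a‖ ≤ ‖v a‖ := by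
      have : u a = (u a - v a) + v a := by ring
      rw [this]
      exact (IsUltrametricDist.norm_add_le_max _ _).trans (max_le ha.le le_rfl)
    have hva : 0 < ‖v a‖ := (norm_nonneg _).trans_lt ha
    rcases ih (fun z hz => h z (by simp [hz])) with rfl | ih
    · simpa using ha
    · have hvs : 0 < ‖(s.map v).prod‖ := (norm_nonneg _).trans_lt ih
      have e : ((a ::ₘ s).map u).prod - ((a ::ₘ s).map v).prod =
        u a * ((s.map u).prod - (s.map v).prod) + (u a - v a) * (s.map v).prod := by
        simp; ring
      rw [e]
      refine (IsUltrametricDist.norm_add_le_max _ _).trans_lt (max_lt ?_ ?_)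
      · simp only [Multiset.map_cons, Multiset.prod_cons, norm_mul]
        calc _ ≤ ‖v a‖ * ‖(s.map u).prod - (s.map v).prod‖ := by gcongr
          _ < _ := by gcongr
      · simp only [Multiset.map_cons, Multiset.prod_cons, norm_mul]
        gcongr

theorem sum_roots {K : Type*} [NontriviallyNormedField K] [IsAlgClosed K]
    (n : ℕ) (hn : n ≠ 0) (τ β : K) (h : τ ^ n ≠ β ^ n) :
    (((X ^ n - C (τ ^ n) : K[X]).roots).map fun ξ => ξ * (1 / (ξ - β))).sum =
      n * (τ ^ n / (τ ^ n - β ^ n)) := by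
  set P : K[X] := X ^ n - C (τ ^ n) with hP
  have hev : P.eval β ≠ 0 := by simp [hP, sub_ne_zero, h.symm]
  have h1 := (IsAlgClosed.splits P).eval_derivative_div_eval_of_ne_zero hev
  have hroot : ∀ ξ ∈ P.roots, ξ * (1 / (ξ - β)) = 1 - β * (1 / (β - ξ)) := by
    intro ξ hξ
    have : ξ ≠ β := by
      rintro rfl
      exact hev ((mem_roots'.1 hξ).2)
    have h1 : ξ - β ≠ 0 := sub_ne_zero.2 this
    have h2 : β - ξ ≠ 0 := sub_ne_zero.2 this.symm
    field_simp
    ring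
  rw [Multiset.map_congr rfl hroot, Multiset.sum_map_sub, Multiset.sum_map_mul_left, ← h1]
  have hcard : P.roots.card = n := by
    rw [← (IsAlgClosed.splits P).natDegree_eq_card_roots, hP, natDegree_X_pow_sub_C]
  have hne : τ ^ n - β ^ n ≠ 0 := sub_ne_zero.2 h
  have hne' : β ^ n - τ ^ n ≠ 0 := sub_ne_zero.2 h.symm
  have hd : P.derivative.eval β = n * β ^ (n - 1) := by
    simp [hP, derivative_X_pow, -map_pow]
  have he : P.eval β = β ^ n - τ ^ n := by simp [hP, -map_pow]
  have hb : β * β ^ (n - 1) = β ^ n := mul_pow_sub_one hn β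
  have h3 : β * (n * β ^ (n - 1) / (β ^ n - τ ^ n)) = n * β ^ n / (β ^ n - τ ^ n) := by
    rw [← hb]; ring
  rw [hd, he, h3, Multiset.map_const', Multiset.sum_replicate, hcard, nsmul_one]
  rw [← neg_sub (β ^ n) (τ ^ n), sub_eq_iff_eq_add, div_neg]
  field_simp
  ring

theorem annulus {K : Type*} [NontriviallyNormedField K] [IsAlgClosed K] [IsUltrametricDist K]
    (S T : Multiset K) (a τ : K) (hτ : τ ≠ 0) (hS : ∀ b ∈ S, ‖b - a‖ ≠ ‖τ‖)
    (hT : ∀ b ∈ T, ‖b - a‖ ≠ ‖τ‖) (E : ℝ)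
    (hE : ∀ y, ‖y - a‖ = ‖τ‖ →
      ‖(y - a) * ((S.map fun b => 1 / (y - b)).sum - (T.map fun b => 1 / (y - b)).sum)‖ ≤ E) :
    ‖(((S.filter fun b => ‖b - a‖ < ‖τ‖).card : ℕ) : K) -
      (((T.filter fun b => ‖b - a‖ < ‖τ‖).card : ℕ) : K)‖ ≤ E := by
  have tend : ∀ U : Multiset K, (∀ b ∈ U, ‖b - a‖ ≠ ‖τ‖) →
      Tendsto (fun n : ℕ => (U.map fun b => τ ^ n / (τ ^ n - (b - a) ^ n)).sum) atTop
        (nhds (((U.filter fun b => ‖b - a‖ < ‖τ‖).card : ℕ) : K)) := by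
    intro U hU
    induction U using Multiset.induction_on with
    | empty => simp
    | cons b U ih =>
      have ih := ih (fun b hb => hU b (by simp [hb]))
      have hb := hU b (by simp)
      simp only [Multiset.map_cons, Multiset.sum_cons]
      rcases lt_or_gt_of_ne hb with hlt | hgt
      · rw [Multiset.filter_cons_of_pos (p := fun b => ‖b - a‖ < ‖τ‖) _ hlt, Multiset.card_cons, Nat.cast_add, add_comm]
        refine Tendsto.add ?_ ih
        have h0 : Tendsto (fun n : ℕ => ((b - a) / τ) ^ n) atTop (nhds 0) :=
          tendsto_pow_atTop_nhds_zero_of_norm_lt_one (by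
            rw [norm_div, div_lt_one (norm_pos_iff.2 hτ)]; exact hlt)
        have h1 : Tendsto (fun n : ℕ => (1 - ((b - a) / τ) ^ n)⁻¹) atTop (nhds ((1 - 0 : K))⁻¹) :=
          (tendsto_const_nhds.sub h0).inv₀ (by simp)
        simp only [sub_zero, inv_one] at h1
        rw [Nat.cast_one]
        refine h1.congr fun n => ?_
        rw [div_pow, one_sub_div (pow_ne_zero _ hτ), inv_div]
      · rw [Multiset.filter_cons_of_neg (p := fun b => ‖b - a‖ < ‖τ‖) _ (by exact not_lt.2 hgt.le)]
        rw [← zero_add (((U.filter fun b => ‖b - a‖ < ‖τ‖).card : ℕ) : K)]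
        refine Tendsto.add ?_ ih
        have hba : b - a ≠ 0 := norm_pos_iff.1 ((norm_nonneg _).trans_lt hgt)
        have h0 : Tendsto (fun n : ℕ => (τ / (b - a)) ^ n) atTop (nhds 0) :=
          tendsto_pow_atTop_nhds_zero_of_norm_lt_one (by
            rw [norm_div, div_lt_one (norm_pos_iff.2 hba)]; exact hgt)
        have h1 : Tendsto (fun n : ℕ => (τ / (b - a)) ^ n / ((τ / (b - a)) ^ n - 1)) atTop
            (nhds ((0 : K) / (0 - 1))) :=
          h0.div (h0.sub tendsto_const_nhds) (by simp)
        simp only [zero_div] at h1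
        refine h1.congr fun n => ?_
        rw [div_pow, div_sub_one (pow_ne_zero _ hba),
          div_div_div_cancel_right₀ (pow_ne_zero _ hba)]
  have hlim := ((tend S hS).sub (tend T hT)).norm
  refine le_of_tendsto_of_frequently hlim ?_
  rw [frequently_atTop]
  intro N
  obtain ⟨n, hn, hn1⟩ := exists_unit_nat K N
  refine ⟨n, hn.le, ?_⟩
  have hn0 : n ≠ 0 := by omega
  have hpow : ∀ U : Multiset K, (∀ b ∈ U, ‖b - a‖ ≠ ‖τ‖) → ∀ b ∈ U, τ ^ n ≠ (b - a) ^ n := by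
    intro U hU b hb h
    apply hU b hb
    have := congrArg norm h
    rw [norm_pow, norm_pow] at this
    exact ((pow_left_inj₀ (norm_nonneg _) (norm_nonneg _) hn0).1 this).symm
  set Ξ := (X ^ n - C (τ ^ n) : K[X]).roots with hΞ
  have hsum : ∀ U : Multiset K, (∀ b ∈ U, ‖b - a‖ ≠ ‖τ‖) →
      (Ξ.map fun ξ => ξ * (U.map fun b => 1 / (a + ξ - b)).sum).sum =
        n * (U.map fun b => τ ^ n / (τ ^ n - (b - a) ^ n)).sum := by
    intro U hU
    rw [← Multiset.sum_map_mul_left]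
    have : ∀ b ∈ U, (n : K) * (τ ^ n / (τ ^ n - (b - a) ^ n)) =
        (Ξ.map fun ξ => ξ * (1 / (a + ξ - b))).sum := by
      intro b hb
      rw [← sum_roots n hn0 τ (b - a) (hpow U hU b hb)]
      congr 1
      refine Multiset.map_congr rfl fun ξ _ => ?_
      congr 2
      ring
    rw [Multiset.map_congr rfl this, Multiset.sum_map_sum_map]
    congr 1
    refine Multiset.map_congr rfl fun ξ _ => ?_
    rw [Multiset.sum_map_mul_left]
  have hmain : (n : K) * ((S.map fun b => τ ^ n / (τ ^ n - (b - a) ^ n)).sum -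
      (T.map fun b => τ ^ n / (τ ^ n - (b - a) ^ n)).sum) =
      (Ξ.map fun ξ => ξ * ((S.map fun b => 1 / (a + ξ - b)).sum -
        (T.map fun b => 1 / (a + ξ - b)).sum)).sum := by
    rw [mul_sub, ← hsum S hS, ← hsum T hT, ← Multiset.sum_map_sub]
    simp only [mul_sub]
  have hE0 : 0 ≤ E := (norm_nonneg _).trans (hE (a + τ) (by simp))
  rw [← one_mul ‖_ - _‖, ← hn1, ← norm_mul, hmain]
  obtain ⟨ξ, hξ, hle⟩ := IsUltrametricDist.exists_norm_multiset_sum_le Ξ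
    (f := fun ξ => ξ * ((S.map fun b => 1 / (a + ξ - b)).sum -
        (T.map fun b => 1 / (a + ξ - b)).sum))
  by_cases h0 : Ξ = 0
  · rw [h0]; simpa using hE0
  · refine hle.trans ?_
    have hr := (mem_roots'.1 (hξ h0)).2
    have hr' : ξ ^ n = τ ^ n := by simpa [sub_eq_zero] using hr
    have hnorm : ‖ξ‖ = ‖τ‖ := by
      have := congrArg norm hr'
      rw [norm_pow, norm_pow] at this
      exact (pow_left_inj₀ (norm_nonneg _) (norm_nonneg _) hn0).1 this
    have := hE (a + ξ) (by simpa using hnorm)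
    simpa using this

end CVL
namespace CVL

theorem lam_le (K : Type*) [NormedField K] (d m : ℕ) (h1 : 1 ≤ m) (h2 : m ≤ d) :
    lam K d ≤ ‖(m : K)‖ := by
  have hb : BddBelow (Set.range fun m : Finset.Icc 1 d => ‖((m : ℕ) : K)‖) :=
    ⟨0, by rintro _ ⟨m, rfl⟩; exact norm_nonneg _⟩
  exact ciInf_le hb ⟨m, Finset.mem_Icc.2 ⟨h1, h2⟩⟩

theorem lam_attained (K : Type*) [NormedField K] (d : ℕ) (hd : 1 ≤ d) :
    ∃ m : ℕ, ‖(m : K)‖ = lam K d := by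
  have : Nonempty (Finset.Icc 1 d) := ⟨⟨1, Finset.mem_Icc.2 ⟨le_rfl, hd⟩⟩⟩
  obtain ⟨m, hm⟩ := exists_eq_ciInf_of_finite (f := fun m : Finset.Icc 1 d => ‖((m : ℕ) : K)‖)
  exact ⟨m, hm⟩

theorem lam_le_sub (K : Type*) [NormedField K] (d a b : ℕ) (ha : a ≤ d) (hb : b ≤ d)
    (hab : a ≠ b) : lam K d ≤ ‖(a : K) - (b : K)‖ := by
  rcases lt_or_gt_of_ne hab with h | h
  · rw [norm_sub_rev, ← Nat.cast_sub h.le]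
    exact lam_le K d _ (by omega) (by omega)
  · rw [← Nat.cast_sub h.le]
    exact lam_le K d _ (by omega) (by omega)

theorem prod_max {K : Type*} [NormedField K] (U : Multiset K) (a : K) (t : ℝ) (q : K → Prop)
    [DecidablePred q]
    (hq : ∀ b ∈ U, (q b ↔ ¬ ‖b - a‖ < t)) :
    (U.map fun b => max t ‖b - a‖).prod =
      t ^ (U.filter fun b => ‖b - a‖ < t).card * ((U.filter q).map fun b => ‖b - a‖).prod := by
  induction U using Multiset.induction_on with
  | empty => simp
  | cons b U ih =>
    have ih := ih (fun b hb => hq b (by simp [hb]))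
    have hb := hq b (by simp)
    rw [Multiset.map_cons, Multiset.prod_cons, ih]
    by_cases h : ‖b - a‖ < t
    · rw [Multiset.filter_cons_of_pos (p := fun b => ‖b - a‖ < t) _ h,
        Multiset.filter_cons_of_neg (p := q) _ (by rw [hb]; simpa using h), max_eq_left h.le,
        Multiset.card_cons]
      ring
    · rw [Multiset.filter_cons_of_neg (p := fun b => ‖b - a‖ < t) _ h,
        Multiset.filter_cons_of_pos (p := q) _ (by rw [hb]; exact h),
        max_eq_right (not_lt.1 h)]
      simp
      ring

theorem boundary {K : Type*} [NontriviallyNormedField K] [IsAlgClosed K] [IsUltrametricDist K]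
    (d : ℕ) (f g : K[X]) (hf0 : f ≠ 0) (hg0 : g ≠ 0)
    (hh0 : f.derivative * g - f * g.derivative ≠ 0)
    (hf : f.natDegree ≤ d) (hg : g.natDegree ≤ d) :
    ∃ T : Finset ℝ, ∀ ρ : ℝ, 0 < ρ → ρ ∉ T → ∀ π : K, g.eval π = 0 → ∀ z : K, g.eval z ≠ 0 →
      ‖f.eval z‖ = ρ * ‖g.eval z‖ →
      lam K d * ρ * ‖g.eval z‖ ^ 2 ≤
        ‖(z - π) * (f.derivative * g - f * g.derivative).eval z‖ := by
  classical
  set h := f.derivative * g - f * g.derivative with hh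
  set sp : Finset K := f.roots.toFinset ∪ g.roots.toFinset with hsp
  have hspf : ∀ b ∈ f.roots, b ∈ sp := fun b hb => by simp [hsp, Multiset.mem_toFinset.2 hb, -mem_roots']
  have hspg : ∀ b ∈ g.roots, b ∈ sp := fun b hb => by simp [hsp, Multiset.mem_toFinset.2 hb, -mem_roots']
  have hsp' : ∀ b ∈ sp, b ∈ f.roots ∨ b ∈ g.roots := by
    intro b hb
    rcases Finset.mem_union.1 hb with hb | hb
    · exact Or.inl (Multiset.mem_toFinset.1 hb)
    · exact Or.inr (Multiset.mem_toFinset.1 hb)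
  set c0 : ℝ := ‖f.leadingCoeff‖ / ‖g.leadingCoeff‖ with hc0
  let M : K → ℝ → ℝ := fun a t => c0 * ((f.roots.map fun b => max t ‖b - a‖).prod /
    (g.roots.map fun b => max t ‖b - a‖).prod)
  let M2 : K → Finset K → ℝ := fun a S =>
    c0 * (((f.roots.filter fun b => b ∉ S).map fun b => ‖b - a‖).prod /
      ((g.roots.filter fun b => b ∉ S).map fun b => ‖b - a‖).prod)
  refine ⟨((sp ×ˢ sp).image fun ab => M ab.1 ‖ab.2 - ab.1‖) ∪
    ((sp ×ˢ sp.powerset).image fun aS => M2 aS.1 aS.2) ∪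
    (h.roots.toFinset.image fun c => ‖f.eval c‖ / ‖g.eval c‖), ?_⟩
  intro ρ hρ hρT π hπ z hgz hz
  simp only [Finset.mem_union, not_or] at hρT
  obtain ⟨⟨hT1, hT2⟩, hT3⟩ := hρT
  have hπsp : π ∈ sp := hspg π ((mem_roots hg0).2 hπ)
  obtain ⟨a, hasp, ha⟩ := Finset.exists_min_image sp (fun b => ‖z - b‖) ⟨π, hπsp⟩
  have hgz' : 0 < ‖g.eval z‖ := norm_pos_iff.2 hgz
  have hfz : f.eval z ≠ 0 := norm_pos_iff.1 (by rw [hz]; positivity)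
  have hza : z - a ≠ 0 := by
    intro h0
    have : z = a := sub_eq_zero.1 h0
    subst this
    rcases hsp' z hasp with h1 | h1
    · exact hfz (mem_roots'.1 h1).2
    · exact hgz (mem_roots'.1 h1).2
  set t := ‖z - a‖ with ht
  have htpos : 0 < t := norm_pos_iff.2 hza
  have hquot : ∀ y : K, (∀ b ∈ sp, ‖y - b‖ = max t ‖b - a‖) →
      ‖f.eval y‖ / ‖g.eval y‖ = M a t := by
    intro y hy
    rw [norm_eval f, norm_eval g, mul_div_mul_comm,
      Multiset.map_congr rfl (fun b hb => hy b (hspf b hb)),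
      Multiset.map_congr rfl (fun b hb => hy b (hspg b hb))]
  have hzM : M a t = ρ := by
    rw [← hquot z (fun b hb => norm_near (ha b hb)), hz]
    field_simp
  have hne : ∀ b ∈ sp, ‖b - a‖ ≠ t := by
    intro b hb hbt
    apply hT1
    refine Finset.mem_image.2 ⟨(a, b), Finset.mem_product.2 ⟨hasp, hb⟩, ?_⟩
    simp only [hbt]
    exact hzM
  have hcirc : ∀ y : K, ‖y - a‖ = t → ∀ b ∈ sp, ‖y - b‖ = max t ‖b - a‖ := by
    intro y hy b hb
    rw [norm_circle (a := a) (by rw [hy]; exact hne b hb), hy]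
  have hceq : ∀ p : K[X], (∀ b ∈ p.roots, ‖b - a‖ ≠ t) → ∀ y : K, ‖y - a‖ = t →
      ‖p.eval y‖ = ‖p.eval z‖ := by
    intro p hp y hy
    rw [norm_eval p y, norm_eval p z]
    congr 2
    refine Multiset.map_congr rfl fun b hb => ?_
    rw [norm_circle (a := a) (by rw [hy]; exact hp b hb), hy,
      norm_circle (a := a) (y := z) (hp b hb)]
  have hfy := hceq f (fun b hb => hne b (hspf b hb))
  have hgy := hceq g (fun b hb => hne b (hspg b hb))
  have hhr : ∀ c ∈ h.roots, ‖c - a‖ ≠ t := by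
    intro c hc hct
    apply hT3
    refine Finset.mem_image.2 ⟨c, Multiset.mem_toFinset.2 hc, ?_⟩
    rw [hquot c (hcirc c hct), hzM]
  have hhy := hceq h hhr
  set mf := (f.roots.filter fun b => ‖b - a‖ < t).card with hmf
  set mg := (g.roots.filter fun b => ‖b - a‖ < t).card with hmg
  have hmfg : mf ≠ mg := by
    intro heq
    apply hT2
    refine Finset.mem_image.2 ⟨(a, sp.filter fun b => ‖b - a‖ < t),
      Finset.mem_product.2 ⟨hasp, Finset.mem_powerset.2 (Finset.filter_subset _ _)⟩, ?_⟩
    rw [← hzM]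
    simp only [M, M2]
    rw [prod_max f.roots a t (fun b => b ∉ sp.filter fun b => ‖b - a‖ < t)
        (fun b hb => by simp [hspf b hb, -mem_roots']),
      prod_max g.roots a t (fun b => b ∉ sp.filter fun b => ‖b - a‖ < t)
        (fun b hb => by simp [hspg b hb, -mem_roots']), ← hmf, ← hmg, heq,
      mul_div_mul_left _ _ (pow_ne_zero _ htpos.ne')]
  have hE := annulus f.roots g.roots a (z - a) hza (fun b hb => hne b (hspf b hb))
    (fun b hb => hne b (hspg b hb)) (t * (‖h.eval z‖ / (‖f.eval z‖ * ‖g.eval z‖))) (by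
      intro y hy
      have hy' : ‖y - a‖ = t := hy
      have hfy0 : f.eval y ≠ 0 := norm_pos_iff.1 (by rw [hfy y hy']; exact norm_pos_iff.2 hfz)
      have hgy0 : g.eval y ≠ 0 := norm_pos_iff.1 (by rw [hgy y hy']; exact hgz')
      rw [← (IsAlgClosed.splits f).eval_derivative_div_eval_of_ne_zero hfy0,
        ← (IsAlgClosed.splits g).eval_derivative_div_eval_of_ne_zero hgy0,
        div_sub_div _ _ hfy0 hgy0, norm_mul, norm_div, norm_mul, hy', hfy y hy', hgy y hy',
        ← hhy y hy', hh]
      simp)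
  have hl : lam K d ≤ ‖(mf : K) - (mg : K)‖ := by
    refine lam_le_sub K d mf mg ?_ ?_ hmfg
    · exact (Multiset.card_le_card (Multiset.filter_le _ _)).trans ((card_roots' f).trans hf)
    · exact (Multiset.card_le_card (Multiset.filter_le _ _)).trans ((card_roots' g).trans hg)
  have h1 : lam K d ≤ t * (‖h.eval z‖ / (‖f.eval z‖ * ‖g.eval z‖)) := hl.trans hE
  have hfz' : 0 < ‖f.eval z‖ := norm_pos_iff.2 hfz
  rw [← mul_div_assoc, le_div_iff₀ (by positivity)] at h1
  rw [norm_mul]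
  calc lam K d * ρ * ‖g.eval z‖ ^ 2 = lam K d * (‖f.eval z‖ * ‖g.eval z‖) := by rw [hz]; ring
    _ ≤ t * ‖h.eval z‖ := h1
    _ ≤ ‖z - π‖ * ‖h.eval z‖ := by
      gcongr
      exact ha π hπsp

theorem res_formula {K : Type*} [NontriviallyNormedField K] [IsAlgClosed K]
    (F k : K[X]) (hF : F ≠ 0) :
    (F.roots.map fun z => k.eval z).prod = k.leadingCoeff ^ F.natDegree *
      (k.roots.map fun e => (-1) ^ F.natDegree / F.leadingCoeff * F.eval e).prod := by
  have hl : F.leadingCoeff ≠ 0 := leadingCoeff_ne_zero.2 hF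
  have hc : F.roots.card = F.natDegree := ((IsAlgClosed.splits F).natDegree_eq_card_roots).symm
  have h1 : ∀ z ∈ F.roots, k.eval z = k.leadingCoeff * (k.roots.map fun e => z - e).prod :=
    fun z _ => (IsAlgClosed.splits k).eval_eq_prod_roots z
  rw [Multiset.map_congr rfl h1, Multiset.prod_map_mul, Multiset.map_const',
    Multiset.prod_replicate, hc, Multiset.prod_map_prod_map]
  congr 2
  refine Multiset.map_congr rfl fun e _ => ?_
  rw [(IsAlgClosed.splits F).eval_eq_prod_roots e, ← mul_assoc, div_mul_cancel₀ _ hl, ← hc]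
  generalize F.roots = s
  induction s using Multiset.induction_on with
  | empty => simp
  | cons a s ih =>
    simp only [Multiset.map_cons, Multiset.prod_cons, Multiset.card_cons, ih]
    ring

theorem main0 {K : Type*} [NontriviallyNormedField K] [IsAlgClosed K] [IsUltrametricDist K]
    (d : ℕ) (hd : 2 ≤ d) (hlam : 0 < lam K d)
    (f g : Polynomial K) (hcop : IsCoprime f g)
    (hdegf : f.natDegree = d) (hdegfg : g.natDegree < f.natDegree)
    (z0 : K) (hz0 : g.eval z0 ≠ 0) (hfz0 : f.eval z0 = 0)
    (π : K) (hπ : g.eval π = 0) :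
    ∃ c : K, g.eval c ≠ 0 ∧ (f.derivative * g - f * g.derivative).eval c = 0 ∧
      ‖f.eval c‖ / ‖g.eval c‖ ≤
        (lam K d)⁻¹ *
          (‖(f.derivative * g - f * g.derivative).eval z0‖ / ‖g.eval z0‖ ^ 2) * ‖π - z0‖ := by
  set h := f.derivative * g - f * g.derivative with hh
  by_cases hhz : h.eval z0 = 0
  · exact ⟨z0, hz0, hhz, by simp [hfz0, hhz]⟩
  by_contra hcon
  push Not at hcon
  have hh0 : h ≠ 0 := by rintro h0; simp [h0] at hhz
  have hf0 : f ≠ 0 := by rintro rfl; simp at hdegf; omega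
  have hg0 : g ≠ 0 := by rintro rfl; simp at hz0
  obtain ⟨m, hm⟩ := lam_attained K d (by omega)
  have hm0 : (m : K) ≠ 0 := norm_pos_iff.1 (by rw [hm]; exact hlam)
  have hπz : π - z0 ≠ 0 := by
    intro h0
    rw [sub_eq_zero] at h0
    exact hz0 (h0 ▸ hπ)
  set κ : K := (z0 - π) * h.eval z0 / g.eval z0 ^ 2 with hκ
  have hκ0 : κ ≠ 0 := by
    rw [hκ, ← neg_sub π z0]
    exact div_ne_zero (mul_ne_zero (neg_ne_zero.2 hπz) hhz) (pow_ne_zero _ hz0)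
  have hR : (lam K d)⁻¹ * (‖h.eval z0‖ / ‖g.eval z0‖ ^ 2) * ‖π - z0‖ = ‖(m : K)⁻¹ * κ‖ := by
    rw [hκ, norm_mul, norm_inv, hm, norm_div, norm_mul, norm_pow, norm_sub_rev z0 π]
    ring
  rw [hR] at hcon
  obtain ⟨T, hT⟩ := boundary d f g hf0 hg0 hh0 hdegf.le (by omega)
  classical
  obtain ⟨x, hx, hxT⟩ := exists_norm_between ((m : K)⁻¹ * κ) (mul_ne_zero (inv_ne_zero hm0) hκ0)
    (T ∪ h.roots.toFinset.image fun c => ‖f.eval c‖ / ‖g.eval c‖)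
  have hx0 : 0 < ‖x‖ := (norm_nonneg _).trans_lt hx
  have hxnT : ‖x‖ ∉ T := fun hmem =>
    lt_irrefl _ (hxT ‖x‖ (Finset.mem_union_left _ hmem) hx)
  have hκx : ‖κ‖ < lam K d * ‖x‖ := by
    rw [norm_mul, norm_inv, hm, inv_mul_lt_iff₀ hlam] at hx
    exact hx
  have hcrit : ∀ c, g.eval c ≠ 0 → h.eval c = 0 → ‖x‖ * ‖g.eval c‖ < ‖f.eval c‖ := by
    intro c hc1 hc2
    rw [← lt_div_iff₀ (norm_pos_iff.2 hc1)]
    refine hxT _ (Finset.mem_union_right _ (Finset.mem_image.2 ⟨c, ?_, rfl⟩)) (hcon c hc1 hc2)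
    exact Multiset.mem_toFinset.2 ((mem_roots hh0).2 hc2)
  have hdeg : ∀ w : K, (C w * g).degree < f.degree := by
    intro w
    exact degree_lt_degree ((natDegree_C_mul_le w g).trans_lt hdegfg)
  have hFd : ∀ w : K, (f - C w * g).natDegree = d := by
    intro w
    rw [natDegree_eq_of_degree_eq (degree_sub_eq_left_of_degree_lt (hdeg w)), hdegf]
  have hFl : ∀ w : K, (f - C w * g).leadingCoeff = f.leadingCoeff :=
    fun w => leadingCoeff_sub_of_degree_lt (hdeg w)
  have hF0 : ∀ w : K, f - C w * g ≠ 0 := by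
    intro w h0
    have := hFd w
    rw [h0] at this
    simp at this
    omega
  let N : K[X] → K[X] := fun k => C (k.leadingCoeff ^ d) *
    (k.roots.map fun e => C ((-1) ^ d / f.leadingCoeff) * (C (f.eval e) - X * C (g.eval e))).prod
  have hN : ∀ k w, (N k).eval w = ((f - C w * g).roots.map fun z => k.eval z).prod := by
    intro k w
    rw [res_formula _ k (hF0 w), hFd, hFl]
    simp only [N, eval_mul, eval_C, eval_multiset_prod, Multiset.map_map]
    congr 2
    refine Multiset.map_congr rfl fun e _ => ?_
    simp
    exact Or.inl (mul_comm _ _)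
  set k0 : K[X] := (X - C π) * h with hk0
  set k : K[X] := k0 - C κ * g ^ 2 with hk
  have hPconst : ∀ w, ‖w‖ ≤ ‖x‖ → ‖(N k0).eval w‖ = ‖(N k0).eval 0‖ := by
    intro w hw
    simp only [N, eval_mul, eval_C, eval_multiset_prod, Multiset.map_map, norm_mul]
    congr 1
    have gen : ∀ s : Multiset K, (∀ e ∈ s, ‖f.eval e - w * g.eval e‖ = ‖f.eval e‖) →
        ‖(s.map ((eval w) ∘ fun e =>
          C ((-1) ^ d / f.leadingCoeff) * (C (f.eval e) - X * C (g.eval e)))).prod‖ =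
        ‖(s.map ((eval 0) ∘ fun e =>
          C ((-1) ^ d / f.leadingCoeff) * (C (f.eval e) - X * C (g.eval e)))).prod‖ := by
      intro s hs
      induction s using Multiset.induction_on with
      | empty => simp
      | cons a s ih =>
        have ih := ih (fun e he => hs e (by simp [he]))
        have ha := hs a (by simp)
        simp only [Multiset.map_cons, Multiset.prod_cons, norm_mul, ih]
        rw [mul_comm w] at ha
        simp [ha]
    refine gen _ fun e he => ?_
    by_cases hge : g.eval e = 0
    · simp [hge]
    · have hr : k0.eval e = 0 := (mem_roots'.1 he).2
      have hhe : h.eval e = 0 := by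
        rw [hk0, eval_mul, mul_eq_zero] at hr
        rcases hr with hr | hr
        · simp [sub_eq_zero] at hr
          exact absurd (hr ▸ hπ) hge
        · exact hr
      have h1 := hcrit e hge hhe
      have h2 : ‖w * g.eval e‖ < ‖f.eval e‖ := by
        rw [norm_mul]
        exact lt_of_le_of_lt (by gcongr) h1
      rw [sub_eq_add_neg, IsUltrametricDist.norm_add_eq_max_of_norm_ne_norm
        (by rw [norm_neg]; exact h2.ne'), norm_neg, max_eq_left h2.le]
  have hfin : ‖(N k - N k0).eval 0‖ < ‖(N k0).eval 0‖ := by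
    refine max_zero (N k - N k0) x _ fun w hw => ?_
    rw [← hPconst w hw.le, eval_sub, hN, hN]
    refine (prod_sub_one (f - C w * g).roots (fun z => k.eval z) (fun z => k0.eval z) ?_).resolve_left ?_
    · intro z hzr
      have hz : f.eval z = w * g.eval z := by
        have := (mem_roots'.1 hzr).2
        simpa [sub_eq_zero] using this
      have hgz : g.eval z ≠ 0 := by
        intro h0
        obtain ⟨u, v, huv⟩ := hcop
        have := congrArg (eval z) huv
        simp [h0, hz] at this
      have hb := hT ‖x‖ hx0 hxnT π hπ z hgz (by rw [hz, norm_mul, hw])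
      have e1 : k.eval z - k0.eval z = - (κ * g.eval z ^ 2) := by simp [hk]
      have e2 : k0.eval z = (z - π) * h.eval z := by simp [hk0]
      rw [e1, e2, norm_neg, norm_mul, norm_pow]
      refine lt_of_lt_of_le ?_ hb
      have : 0 < ‖g.eval z‖ := norm_pos_iff.2 hgz
      gcongr
    · intro h0
      have h1 := (IsAlgClosed.splits (f - C w * g)).natDegree_eq_card_roots
      rw [h0, hFd] at h1
      simp at h1
      omega
  have hNk : (N k).eval 0 = 0 := by
    rw [hN]
    refine Multiset.prod_eq_zero (Multiset.mem_map.2 ⟨z0, ?_, ?_⟩)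
    · rw [mem_roots (hF0 0)]
      simp [hfz0]
    · simp [hk, hk0, hκ]
      field_simp
      ring
  rw [eval_sub, hNk, zero_sub, norm_neg] at hfin
  exact lt_irrefl _ hfin

end CVL

theorem critical_value_location
    {K : Type*} [NontriviallyNormedField K] [IsAlgClosed K]
    [CompleteSpace K] [IsUltrametricDist K]
    (d : ℕ) (hd : 2 ≤ d) (hlam : 0 < lam K d)
    (f g : Polynomial K) (hcop : IsCoprime f g)
    (hdegf : f.natDegree = d) (hdegfg : g.natDegree < f.natDegree)
    (hdegg : 1 ≤ g.natDegree)
    (z0 : K) (hz0 : g.eval z0 ≠ 0)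
    (r : ℝ) (hr : IsLeast {t : ℝ | ∃ π : K, g.eval π = 0 ∧ t = ‖π - z0‖} r) :
    ∃ c : K, g.eval c ≠ 0 ∧ (f.derivative * g - f * g.derivative).eval c = 0 ∧
      ‖f.eval c / g.eval c - f.eval z0 / g.eval z0‖ ≤
        (lam K d)⁻¹ *
          (‖(f.derivative * g - f * g.derivative).eval z0‖ / ‖g.eval z0‖ ^ 2) * r := by
  obtain ⟨⟨π, hπ, rfl⟩, _⟩ := hr
  set q : K := f.eval z0 / g.eval z0 with hq
  have hdeg : (C q * g).degree < f.degree :=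
    degree_lt_degree ((natDegree_C_mul_le q g).trans_lt hdegfg)
  have hFd : (f - C q * g).natDegree = d := by
    rw [natDegree_eq_of_degree_eq (degree_sub_eq_left_of_degree_lt hdeg), hdegf]
  have hcop' : IsCoprime (f - C q * g) g := by
    have := hcop.add_mul_right_left (-C q)
    have e : f - C q * g = f + -C q * g := by ring
    rw [e]
    first | exact this | (rw [mul_comm]; exact this)
  obtain ⟨c, hc1, hc2, hc3⟩ := CVL.main0 d hd hlam (f - C q * g) g hcop' hFd
    (by rw [hFd, ← hdegf]; exact hdegfg) z0 hz0 (by simp [hq, hz0]) π hπ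
  have hh : (f - C q * g).derivative * g - (f - C q * g) * g.derivative =
      f.derivative * g - f * g.derivative := by
    simp
    ring
  rw [hh] at hc2 hc3
  refine ⟨c, hc1, hc2, ?_⟩
  have e : f.eval c / g.eval c - q = (f - C q * g).eval c / g.eval c := by
    simp
    field_simp
  rw [e, norm_div]
  exact hc3
end

section
/- (Corollary 1.5) Let d ≥ 2 be an integer with λ(d) > 0, and let Q = f/g be a rational map over K of degree d satisfying Q(∞) = ∞ (deg f > deg g). Let z0 ∈ K with g(z0) ≠ 0, and suppose the set S := {w ∈ K : g(w) = 0, or (g(w) ≠ 0, Q(w) = Q(z0) and w ≠ z0)} of poles of Q and preimages of Q(z0) by Q distinct from z0 is nonempty (this holds automatically when Q'(z0) ≠ 0, since then z0 is a simple root of f − Q(z0)·g, which has d ≥ 2 roots with multiplicity). Let r_• := min{|w − z0| : w ∈ S}. Then Q has a finite critical value v, i.e. v = Q(c) for some c ∈ K with g(c) ≠ 0 and (f′g − fg′)(c) = 0, satisfying |v − Q(z0)| ≤ γ(d)·λ(d)^{−1}·|Q'(z0)|·r_•. -/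
/-!
STATEMENT 5 (Corollary 1.5): Let `d ≥ 2` with `lam K d > 0` and let `Q = f/g` be a
rational map over `K` of degree `d` with `Q(∞) = ∞` (`deg f = d > deg g`).  Let
`z0 ∈ K` with `g(z0) ≠ 0`, and let `r_•` be the shortest distance from `z0` to a point
of the (nonempty) set `S` of poles of `Q` and preimages of `Q(z0)` distinct from `z0`.
Then `Q` has a finite critical value `v = Q(c)` with
`‖v − Q(z0)‖ ≤ gam K d · lam K d ⁻¹ · ‖Q'(z0)‖ · r_•`.
-/

open Polynomial Filter

/-- The residue characteristic of `K`: the smallest integer `m ≥ 2` with `‖(m : K)‖ < 1`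
(equal to `0 = sInf ∅` if no such integer exists). -/
noncomputable def resChar (K : Type*) [NormedField K] : ℕ :=
  sInf {m : ℕ | 2 ≤ m ∧ ‖(m : K)‖ < 1}

/-- `gam K d = 1` if `lam K d = 1`, and `‖p‖ ^ (−1/(p−1))` with `p` the residue
characteristic of `K` otherwise. -/
noncomputable def gam (K : Type*) [NormedField K] (d : ℕ) : ℝ :=
  if lam K d = 1 then 1
  else ‖((resChar K : ℕ) : K)‖ ^ (-(1 : ℝ) / ((resChar K : ℝ) - 1))


lemma cv_sum_lt {K : Type*} [NormedField K] [IsUltrametricDist K] {ι : Type*} (s : Finset ι)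
    (f : ι → K) (C : ℝ) (hC : 0 < C) (h : ∀ i ∈ s, ‖f i‖ < C) : ‖∑ i ∈ s, f i‖ < C := by
  classical
  induction s using Finset.induction_on with
  | empty => simpa using hC
  | insert a s ha ih =>
    rw [Finset.sum_insert ha]
    refine lt_of_le_of_lt (IsUltrametricDist.norm_add_le_max _ _) (max_lt ?_ ?_)
    · exact h a (by simp)
    · exact ih (fun i hi => h i (by simp [hi]))

lemma cv_sum_le {K : Type*} [NormedField K] [IsUltrametricDist K] {ι : Type*} (s : Finset ι)
    (f : ι → K) (C : ℝ) (hC : 0 ≤ C) (h : ∀ i ∈ s, ‖f i‖ ≤ C) : ‖∑ i ∈ s, f i‖ ≤ C :=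
  IsUltrametricDist.norm_sum_le_of_forall_le_of_nonneg hC h

lemma cv_add_dom {K : Type*} [NormedField K] [IsUltrametricDist K] (a b : K) (C : ℝ)
    (ha : C ≤ ‖a‖) (hb : ‖b‖ < C) : C ≤ ‖a + b‖ := by
  by_contra hlt
  push Not at hlt
  have h1 : ‖a‖ ≤ max ‖a + b‖ ‖-b‖ := by
    have := IsUltrametricDist.norm_add_le_max (a + b) (-b)
    simpa using this
  rw [norm_neg] at h1
  have := max_lt hlt hb
  linarith

lemma cv_dom {K : Type*} [NormedField K] [IsUltrametricDist K] {ι : Type*} [DecidableEq ι]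
    (s : Finset ι)
    (f : ι → K) (C : ℝ) (hC : 0 < C) (i0 : ι) (hi0 : i0 ∈ s) (h0 : C ≤ ‖f i0‖)
    (h : ∀ i ∈ s, i ≠ i0 → ‖f i‖ < C) : C ≤ ‖∑ i ∈ s, f i‖ := by
  rw [← Finset.add_sum_erase s f hi0]
  apply cv_add_dom _ _ _ h0
  apply cv_sum_lt _ _ _ hC
  intro i hi
  exact h i (Finset.mem_of_mem_erase hi) (Finset.ne_of_mem_erase hi)

/-- Weierstrass-type independence. -/
lemma cv_weier {K : Type*} [NormedField K] [IsUltrametricDist K]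
    (P R w1 w2 : K[X]) (p : ℕ) (t M : ℝ) (ht : 0 < t)
    (hP : ∀ j, ‖P.coeff j‖ * t ^ j ≤ ‖P.coeff p‖ * t ^ p)
    (hPd : ∀ j, p < j → P.coeff j = 0)
    (hPp : P.coeff p ≠ 0)
    (hR : ∀ l, 1 ≤ l → ‖R.coeff l‖ * t ^ l < ‖R.coeff 0‖)
    (hw1 : ∀ i, p ≤ i → w1.coeff i = 0)
    (hM : ∀ k, ‖(w1 * R + P * w2).coeff k‖ * t ^ k ≤ M) (i : ℕ) :
    ‖w1.coeff i‖ * t ^ i * ‖R.coeff 0‖ ≤ M := by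
  by_contra hcon
  push Not at hcon
  have hM0 : 0 ≤ M := le_trans (by positivity) (hM 0)
  have hR0 : 0 < ‖R.coeff 0‖ := lt_of_le_of_lt (by positivity) (hR 1 le_rfl)
  have hR' : ∀ l, ‖R.coeff l‖ * t ^ l ≤ ‖R.coeff 0‖ := by
    intro l
    rcases Nat.eq_zero_or_pos l with h | h
    · simp [h]
    · exact (hR l h).le
  have hip : i < p := by
    by_contra hh
    rw [hw1 i (by omega)] at hcon
    simp at hcon; linarith
  obtain ⟨k, hkp, hk⟩ := Finset.exists_max_image (Finset.range p)
    (fun i => ‖w1.coeff i‖ * t ^ i) ⟨i, by simpa using hip⟩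
  set μ := ‖w1.coeff k‖ * t ^ k with hμ
  have hμ1 : ∀ j, ‖w1.coeff j‖ * t ^ j ≤ μ := by
    intro j
    rcases lt_or_ge j p with h | h
    · exact hk j (by simpa using h)
    · rw [hw1 j h]; simp; positivity
  have hμM : M < μ * ‖R.coeff 0‖ :=
    lt_of_lt_of_le hcon (by gcongr; exact hμ1 i)
  have hμ0 : 0 < μ := by
    by_contra h
    push Not at h
    nlinarith
  obtain ⟨m, hmp, hm⟩ := Finset.exists_max_image (Finset.range (w2.natDegree + 1))
    (fun i => toLex (‖w2.coeff i‖ * t ^ i, i)) ⟨0, by simp⟩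
  set ω := ‖w2.coeff m‖ * t ^ m with hω
  have hω1 : ∀ j, ‖w2.coeff j‖ * t ^ j ≤ ω := by
    intro j
    rcases lt_or_ge j (w2.natDegree + 1) with h | h
    · have := hm j (by simpa using h)
      rw [Prod.Lex.toLex_le_toLex] at this
      rcases this with h | h
      · exact h.le
      · exact h.1.le
    · rw [coeff_eq_zero_of_natDegree_lt (by omega)]; simp; positivity
  have hω0 : 0 ≤ ω := by positivity
  have hπ0 : 0 < ‖P.coeff p‖ * t ^ p := by
    have := norm_pos_iff.mpr hPp
    positivity
  have hω2 : 0 < ω → ∀ j, m < j → ‖w2.coeff j‖ * t ^ j < ω := by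
    intro hpos j hj
    rcases lt_or_ge j (w2.natDegree + 1) with h | h
    · have := hm j (by simpa using h)
      rw [Prod.Lex.toLex_le_toLex] at this
      rcases this with h | h
      · exact h
      · have := h.2; simp at this; omega
    · rw [coeff_eq_zero_of_natDegree_lt (by omega)]; simpa using hpos
  have htk : ∀ k, (0:ℝ) < t ^ k := fun k => by positivity
  rcases le_or_gt (μ * ‖R.coeff 0‖) (‖P.coeff p‖ * t ^ p * ω) with hc | hc
  · have hωp : 0 < ω := by
      by_contra h
      have h0 : ω = 0 := le_antisymm (not_lt.mp h) hω0
      rw [h0] at hc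
      have : 0 < μ * ‖R.coeff 0‖ := by positivity
      linarith
    set C := ‖P.coeff p‖ * t ^ p * ω with hC
    have hCpos : 0 < C := by positivity
    have key := hM (p + m)
    have h1 : C / t ^ (p + m) ≤ ‖(P * w2).coeff (p + m)‖ := by
      rw [coeff_mul]
      apply cv_dom _ _ _ (by positivity) (p, m) (by simp)
      · rw [div_le_iff₀ (htk _), norm_mul, hC, hω, pow_add]
        apply le_of_eq; ring
      · rintro ⟨a, b⟩ hab hne
        have hab' : a + b = p + m := by simpa using hab
        rw [lt_div_iff₀ (htk _), norm_mul]
        rcases lt_trichotomy a p with h | h | h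
        · have h2 := hω2 hωp b (by omega)
          calc ‖P.coeff a‖ * ‖w2.coeff b‖ * t ^ (p + m)
              = (‖P.coeff a‖ * t ^ a) * (‖w2.coeff b‖ * t ^ b) := by
                rw [← hab', pow_add]; ring
            _ ≤ (‖P.coeff p‖ * t ^ p) * (‖w2.coeff b‖ * t ^ b) :=
                mul_le_mul_of_nonneg_right (hP a) (by positivity)
            _ < _ := by rw [hC]; gcongr
        · exfalso; apply hne; ext <;> simp <;> omega
        · rw [hPd a h]; simpa using hCpos
    have h2 : ‖(w1 * R).coeff (p + m)‖ < C / t ^ (p + m) := by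
      rw [coeff_mul]
      apply cv_sum_lt _ _ _ (by positivity)
      rintro ⟨a, b⟩ hab
      have hab' : a + b = p + m := by simpa using hab
      rw [lt_div_iff₀ (htk _), norm_mul]
      rcases lt_or_ge a p with h | h
      · have h2 := hR b (by omega)
        calc ‖w1.coeff a‖ * ‖R.coeff b‖ * t ^ (p + m)
              = (‖w1.coeff a‖ * t ^ a) * (‖R.coeff b‖ * t ^ b) := by
                rw [← hab', pow_add]; ring
            _ ≤ μ * (‖R.coeff b‖ * t ^ b) := by gcongr; exact hμ1 a
            _ < μ * ‖R.coeff 0‖ := by gcongr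
            _ ≤ _ := hc
      · rw [hw1 a h]; simpa using hCpos
    have h3 := cv_add_dom _ _ _ h1 h2
    rw [← coeff_add, add_comm (P * w2), div_le_iff₀ (htk _)] at h3
    linarith
  · set C := μ * ‖R.coeff 0‖ with hC
    have hCpos : 0 < C := by positivity
    have key := hM k
    have h1 : C / t ^ k ≤ ‖(w1 * R).coeff k‖ := by
      rw [coeff_mul]
      apply cv_dom _ _ _ (by positivity) (k, 0) (by simp)
      · rw [div_le_iff₀ (htk _), norm_mul, hC, hμ]
        apply le_of_eq; ring
      · rintro ⟨a, b⟩ hab hne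
        have hab' : a + b = k := by simpa using hab
        rw [lt_div_iff₀ (htk _), norm_mul]
        have hb : 1 ≤ b := by
          by_contra h
          apply hne; ext <;> simp <;> omega
        have h2 := hR b hb
        calc ‖w1.coeff a‖ * ‖R.coeff b‖ * t ^ k
              = (‖w1.coeff a‖ * t ^ a) * (‖R.coeff b‖ * t ^ b) := by
                rw [← hab', pow_add]; ring
            _ ≤ μ * (‖R.coeff b‖ * t ^ b) := by gcongr; exact hμ1 a
            _ < _ := mul_lt_mul_of_pos_left h2 hμ0
    have h2 : ‖(P * w2).coeff k‖ < C / t ^ k := by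
      rw [coeff_mul]
      apply cv_sum_lt _ _ _ (by positivity)
      rintro ⟨a, b⟩ hab
      have hab' : a + b = k := by simpa using hab
      rw [lt_div_iff₀ (htk _), norm_mul]
      calc ‖P.coeff a‖ * ‖w2.coeff b‖ * t ^ k
              = (‖P.coeff a‖ * t ^ a) * (‖w2.coeff b‖ * t ^ b) := by
                rw [← hab', pow_add]; ring
            _ ≤ (‖P.coeff p‖ * t ^ p) * ω := mul_le_mul (hP a) (hω1 b) (by positivity) hπ0.le
            _ < _ := hc
    have h3 := cv_add_dom _ _ _ h1 h2
    rw [← coeff_add, div_le_iff₀ (htk _)] at h3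
    linarith


lemma cv_sub_le_max {K : Type*} [NormedField K] [IsUltrametricDist K] (a b : K) :
    ‖a - b‖ ≤ max ‖a‖ ‖b‖ := by
  have := IsUltrametricDist.norm_add_le_max a (-b)
  rwa [norm_neg, ← sub_eq_add_neg] at this

noncomputable def cvN {K : Type*} [NormedField K] (s : Multiset K) (t : ℝ) : ℝ :=
  (s.map (fun x => max t ‖x‖)).prod

noncomputable def cvP {K : Type*} [Field K] (s : Multiset K) : K[X] :=
  (s.map (fun x => X - C x)).prod

lemma cvP_monic {K : Type*} [Field K] (s : Multiset K) : (cvP s).Monic :=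
  monic_multiset_prod_of_monic _ _ (fun x _ => monic_X_sub_C x)

lemma cvP_natDegree {K : Type*} [Field K] (s : Multiset K) :
    (cvP s).natDegree = Multiset.card s := natDegree_multiset_prod_X_sub_C_eq_card s

lemma cvP_add {K : Type*} [Field K] (s u : Multiset K) :
    cvP (s + u) = cvP s * cvP u := by simp [cvP]

lemma cvP_cons {K : Type*} [Field K] (a : K) (u : Multiset K) :
    cvP (a ::ₘ u) = (X - C a) * cvP u := by simp [cvP]

lemma cvN_add {K : Type*} [NormedField K] (s u : Multiset K) (t : ℝ) :
    cvN (s + u) t = cvN s t * cvN u t := by simp [cvN]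

lemma cvN_cons {K : Type*} [NormedField K] (a : K) (u : Multiset K) (t : ℝ) :
    cvN (a ::ₘ u) t = max t ‖a‖ * cvN u t := by simp [cvN]

lemma cvN_pos {K : Type*} [NormedField K] (s : Multiset K) (t : ℝ) (ht : 0 < t) :
    0 < cvN s t := by
  induction s using Multiset.induction_on with
  | empty => simp [cvN]
  | cons a s ih =>
    rw [cvN_cons]
    have : 0 < max t ‖a‖ := lt_max_of_lt_left ht
    positivity

lemma cvN_le {K : Type*} [NormedField K] (s : Multiset K) (t : ℝ)
    (h : ∀ x ∈ s, ‖x‖ ≤ t) : cvN s t = t ^ (Multiset.card s) := by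
  induction s using Multiset.induction_on with
  | empty => simp [cvN]
  | cons a s ih =>
    rw [cvN_cons, ih (fun x hx => h x (by simp [hx])), max_eq_left (h a (by simp))]
    simp [pow_succ, mul_comm]

lemma cvN_ge {K : Type*} [NormedField K] (s : Multiset K) (t : ℝ)
    (h : ∀ x ∈ s, t ≤ ‖x‖) : cvN s t = ‖(cvP s).coeff 0‖ := by
  induction s using Multiset.induction_on with
  | empty => simp [cvN, cvP]
  | cons a s ih =>
    rw [cvN_cons, ih (fun x hx => h x (by simp [hx])), max_eq_right (h a (by simp)), cvP_cons]
    simp [mul_coeff_zero]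

lemma cvN_step {K : Type*} [NormedField K] (s : Multiset K) (t t' : ℝ) (htt : t ≤ t')
    (h : ∀ x ∈ s, ‖x‖ ≤ t ∨ t' ≤ ‖x‖) :
    cvN s t' * t ^ (s.countP (fun x => ‖x‖ ≤ t)) = cvN s t * t' ^ (s.countP (fun x => ‖x‖ ≤ t)) := by
  induction s using Multiset.induction_on with
  | empty => simp [cvN]
  | cons a s ih =>
    have ih' := ih (fun x hx => h x (by simp [hx]))
    rw [cvN_cons, cvN_cons, Multiset.countP_cons]
    rcases h a (by simp) with h1 | h1
    · rw [if_pos h1, max_eq_left h1, max_eq_left (h1.trans htt), pow_succ, pow_succ]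
      linear_combination t * t' * ih'
    · rcases le_or_gt ‖a‖ t with h2 | h2
      · have : t = t' := le_antisymm htt (h1.trans h2)
        subst this; rfl
      · rw [if_neg (not_le.mpr h2), max_eq_right h1, max_eq_right h2.le]
        simp only [add_zero]
        linear_combination ‖a‖ * ih'

lemma cvP_coeff_le {K : Type*} [NormedField K] [IsUltrametricDist K] (s : Multiset K) (t : ℝ)
    (ht : 0 < t) (k : ℕ) : ‖(cvP s).coeff k‖ * t ^ k ≤ cvN s t := by
  induction s using Multiset.induction_on generalizing k with
  | empty =>
    simp only [cvP, cvN, Multiset.map_zero, Multiset.prod_zero, coeff_one]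
    split_ifs with h
    · simp [h]
    · simp
  | cons a s ih =>
    rw [cvP_cons, cvN_cons, sub_mul, coeff_sub, coeff_C_mul]
    have hN := cvN_pos s t ht
    have h2 : ‖a * (cvP s).coeff k‖ * t ^ k ≤ max t ‖a‖ * cvN s t := by
      rw [norm_mul, mul_assoc]
      exact mul_le_mul (le_max_right _ _) (ih k) (by positivity) (by positivity)
    have h1 : ‖(X * cvP s).coeff k‖ * t ^ k ≤ max t ‖a‖ * cvN s t := by
      cases k with
      | zero => simp; positivity
      | succ k =>
        rw [coeff_X_mul, pow_succ]
        calc _ = t * (‖(cvP s).coeff k‖ * t ^ k) := by ring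
          _ ≤ _ := mul_le_mul (le_max_left _ _) (ih k) (by positivity) (by positivity)
    have h3 := cv_sub_le_max ((X * cvP s).coeff k) (a * (cvP s).coeff k)
    have htk : 0 < t ^ k := by positivity
    rcases le_max_iff.mp h3 with h | h
    · exact (mul_le_mul_of_nonneg_right h htk.le).trans h1
    · exact (mul_le_mul_of_nonneg_right h htk.le).trans h2

lemma cvP_coeff_lt {K : Type*} [NormedField K] [IsUltrametricDist K] (s : Multiset K) (t : ℝ)
    (ht : 0 < t) (hs : ∀ x ∈ s, t < ‖x‖) (k : ℕ) (hk : 1 ≤ k) :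
    ‖(cvP s).coeff k‖ * t ^ k < ‖(cvP s).coeff 0‖ := by
  induction s using Multiset.induction_on generalizing k with
  | empty =>
    simp only [cvP, Multiset.map_zero, Multiset.prod_zero, coeff_one]
    rw [if_neg (by omega)]; simp
  | cons a s ih =>
    have ih' := ih (fun x hx => hs x (by simp [hx]))
    have ha := hs a (by simp)
    have ha0 : 0 < ‖a‖ := ht.trans ha
    have h0 : 0 < ‖(cvP s).coeff 0‖ := lt_of_le_of_lt (by positivity) (ih' 1 le_rfl)
    have hall : ∀ k, ‖(cvP s).coeff k‖ * t ^ k ≤ ‖(cvP s).coeff 0‖ := by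
      intro k
      rcases Nat.eq_zero_or_pos k with h | h
      · simp [h]
      · exact (ih' k h).le
    rw [cvP_cons, sub_mul, coeff_sub, coeff_C_mul]
    have e0 : ‖(X * cvP s - C a * cvP s).coeff 0‖ = ‖a‖ * ‖(cvP s).coeff 0‖ := by
      simp [mul_coeff_zero]
    rw [e0]
    have h2 : ‖a * (cvP s).coeff k‖ * t ^ k < ‖a‖ * ‖(cvP s).coeff 0‖ := by
      rw [norm_mul, mul_assoc]
      exact mul_lt_mul_of_pos_left (ih' k hk) ha0
    have h1 : ‖(X * cvP s).coeff k‖ * t ^ k < ‖a‖ * ‖(cvP s).coeff 0‖ := by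
      obtain ⟨k, rfl⟩ : ∃ j, k = j + 1 := ⟨k - 1, by omega⟩
      rw [coeff_X_mul, pow_succ]
      calc _ = t * (‖(cvP s).coeff k‖ * t ^ k) := by ring
          _ ≤ t * ‖(cvP s).coeff 0‖ := mul_le_mul_of_nonneg_left (hall k) ht.le
          _ < _ := mul_lt_mul_of_pos_right ha h0
    have h3 := cv_sub_le_max ((X * cvP s).coeff k) (a * (cvP s).coeff k)
    have htk : 0 < t ^ k := by positivity
    rcases le_max_iff.mp h3 with h | h
    · exact (mul_le_mul_of_nonneg_right h htk.le).trans_lt h1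
    · exact (mul_le_mul_of_nonneg_right h htk.le).trans_lt h2

lemma cv_derivmul {K : Type*} [Field K] (F G : K[X]) (a b : ℕ) (hF : F.natDegree ≤ a)
    (hG : G.natDegree ≤ b) (hab : 1 ≤ a + b) :
    (derivative F * G).natDegree ≤ a + b - 1 ∧
    (derivative F * G).coeff (a + b - 1) = a * F.coeff a * G.coeff b := by
  rcases Nat.eq_zero_or_pos a with h | h
  · subst h
    have : derivative F = 0 := by
      rw [eq_C_of_natDegree_le_zero hF]; simp
    simp [this]
  · have hF' : (derivative F).natDegree ≤ a - 1 :=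
      (natDegree_derivative_le F).trans (by omega)
    have e : a + b - 1 = (a - 1) + b := by omega
    rw [e]
    refine ⟨(natDegree_mul_le).trans (by omega), ?_⟩
    rw [coeff_mul_add_eq_of_natDegree_le hF' hG, coeff_derivative]
    have e2 : a - 1 + 1 = a := by omega
    rw [e2]
    have : ((a - 1 : ℕ) : K) + 1 = a := by
      exact_mod_cast congrArg (Nat.cast : ℕ → K) e2
    rw [this]; ring

lemma cv_wron {K : Type*} [Field K] (F G : K[X]) (a b : ℕ) (hF : F.natDegree ≤ a)
    (hG : G.natDegree ≤ b) (hab : 1 ≤ a + b) :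
    (derivative F * G - F * derivative G).natDegree ≤ a + b - 1 ∧
    (derivative F * G - F * derivative G).coeff (a + b - 1) =
      ((a : K) - b) * (F.coeff a * G.coeff b) := by
  obtain ⟨h1, h2⟩ := cv_derivmul F G a b hF hG hab
  obtain ⟨h3, h4⟩ := cv_derivmul G F b a hG hF (by omega)
  rw [add_comm b a, mul_comm (derivative G) F] at h3 h4
  constructor
  · exact (natDegree_sub_le _ _).trans (max_le h1 h3)
  · rw [coeff_sub, h2, h4]; ring

lemma cv_logderiv {K : Type*} [NormedField K] [IsUltrametricDist K] (a b : Multiset K) (t M : ℝ)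
    (ht : 0 < t)
    (hM : ∀ k, ‖(derivative (cvP a) * cvP b - cvP a * derivative (cvP b)).coeff k‖ * t ^ k ≤ M) :
    ‖((a.countP (fun x => ‖x‖ ≤ t) : ℕ) : K) - ((b.countP (fun x => ‖x‖ ≤ t) : ℕ) : K)‖ *
      (cvN a t * cvN b t) ≤ t * M := by
  classical
  have hM0 : 0 ≤ M := le_trans (by positivity) (hM 0)
  set a1 := a.filter (fun x => ‖x‖ ≤ t) with ha1
  set a2 := a.filter (fun x => ¬ ‖x‖ ≤ t) with ha2
  set b1 := b.filter (fun x => ‖x‖ ≤ t) with hb1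
  set b2 := b.filter (fun x => ¬ ‖x‖ ≤ t) with hb2
  have ea : a = a1 + a2 := (Multiset.filter_add_not _ a).symm
  have eb : b = b1 + b2 := (Multiset.filter_add_not _ b).symm
  rw [Multiset.countP_eq_card_filter, Multiset.countP_eq_card_filter, ← ha1, ← hb1]
  set p := Multiset.card a1 + Multiset.card b1 with hp
  rcases Nat.eq_zero_or_pos p with h0 | hpos
  · have h1 : Multiset.card a1 = 0 := by omega
    have h2 : Multiset.card b1 = 0 := by omega
    rw [h1, h2]; simp; positivity
  obtain ⟨hw1, hw2⟩ := cv_wron (cvP a1) (cvP b1) (Multiset.card a1) (Multiset.card b1)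
    (cvP_natDegree _).le (cvP_natDegree _).le hpos
  have hl1 : (cvP a1).coeff (Multiset.card a1) = 1 := by
    rw [← cvP_natDegree]; exact cvP_monic a1
  have hl2 : (cvP b1).coeff (Multiset.card b1) = 1 := by
    rw [← cvP_natDegree]; exact cvP_monic b1
  have hl3 : (cvP (a1 + b1)).coeff p = 1 := by
    have : p = Multiset.card (a1 + b1) := by simp [hp]
    rw [this, ← cvP_natDegree]; exact cvP_monic _
  have hsm : ∀ x ∈ a1 + b1, ‖x‖ ≤ t := by
    intro x hx
    rcases Multiset.mem_add.mp hx with h | h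
    · exact (Multiset.mem_filter.mp h).2
    · exact (Multiset.mem_filter.mp h).2
  have hbg : ∀ x ∈ a2 + b2, t < ‖x‖ := by
    intro x hx
    rcases Multiset.mem_add.mp hx with h | h
    · exact not_le.mp (Multiset.mem_filter.mp h).2
    · exact not_le.mp (Multiset.mem_filter.mp h).2
  have hN1 := cvN_le (a1 + b1) t hsm
  have hN2 := cvN_ge (a2 + b2) t (fun x hx => (hbg x hx).le)
  have hcard : Multiset.card (a1 + b1) = p := by simp [hp]
  have eW : derivative (cvP a) * cvP b - cvP a * derivative (cvP b) =
      (derivative (cvP a1) * cvP b1 - cvP a1 * derivative (cvP b1)) * cvP (a2 + b2) +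
      cvP (a1 + b1) * (derivative (cvP a2) * cvP b2 - cvP a2 * derivative (cvP b2)) := by
    rw [ea, eb]
    simp only [cvP_add, derivative_mul]
    ring
  have key := cv_weier (cvP (a1 + b1)) (cvP (a2 + b2)) _ _ p t M ht
    (by
      intro j
      rw [hl3, norm_one, one_mul, ← hcard, ← hN1]
      exact cvP_coeff_le _ _ ht j)
    (by
      intro j hj
      apply coeff_eq_zero_of_natDegree_lt
      rw [cvP_natDegree, hcard]; exact hj)
    (by rw [hl3]; exact one_ne_zero)
    (fun l hl => cvP_coeff_lt _ t ht hbg l hl)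
    (by
      intro i hi
      apply coeff_eq_zero_of_natDegree_lt
      exact lt_of_le_of_lt hw1 (by omega))
    (by
      intro k
      rw [← eW]; exact hM k) (p - 1)
  rw [hw2, hl1, hl2] at key
  have e1 : cvN a t * cvN b t = cvN (a1 + b1) t * cvN (a2 + b2) t := by
    rw [← cvN_add, ← cvN_add]; congr 1
    conv_lhs => rw [ea, eb]
    rw [add_add_add_comm]
  rw [e1, hN1, hN2, hcard]
  have e2 : t ^ p = t * t ^ (p - 1) := by
    rw [← pow_succ']; congr 1; omega
  rw [e2]
  have := mul_le_mul_of_nonneg_left key ht.le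
  simp only [mul_one] at this
  calc _ = _ := by ring
    _ ≤ _ := this


lemma cv_step_induct (T : Finset ℝ) (ρ : ℝ) (P : ℝ → Prop) (hρ : P ρ)
    (step : ∀ t t', 0 < t → t < t' → t' ≤ ρ → (∀ x ∈ T, x ≤ t ∨ t' ≤ x) → P t' → P t) :
    ∀ t, 0 < t → t ≤ ρ → P t := by
  have main : ∀ n : ℕ, ∀ t, 0 < t → t ≤ ρ → (T.filter (fun x => t < x)).card = n → P t := by
    intro n
    induction n using Nat.strong_induction_on with
    | _ n ih =>
      intro t ht htρ hn
      rcases eq_or_lt_of_le htρ with h | hlt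
      · rw [h]; exact hρ
      by_cases hne : (T.filter (fun x => t < x ∧ x < ρ)).Nonempty
      · obtain ⟨y, hy, hmin⟩ := Finset.exists_min_image _ id hne
        simp only [Finset.mem_filter, id] at hy hmin
        apply step t y ht hy.2.1 hy.2.2.le
        · intro x hx
          by_contra hcon
          push Not at hcon
          have := hmin x ⟨hx, hcon.1, hcon.2.trans hy.2.2⟩
          linarith [hcon.2]
        · refine ih _ ?_ y (ht.trans hy.2.1) hy.2.2.le rfl
          rw [← hn]
          apply Finset.card_lt_card
          rw [Finset.ssubset_iff_of_subset]
          · exact ⟨y, by simp [hy.1, hy.2.1], by simp⟩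
          · intro x hx
            simp only [Finset.mem_filter] at hx ⊢
            exact ⟨hx.1, hy.2.1.trans hx.2⟩
      · apply step t ρ ht hlt le_rfl _ hρ
        intro x hx
        by_contra hcon
        push Not at hcon
        exact hne ⟨x, by simp [hx, hcon.1, hcon.2]⟩
  intro t ht htρ
  exact main _ t ht htρ rfl

lemma cv_path {K : Type*} [NormedField K] [IsUltrametricDist K] (a b w : Multiset K) (d : ℕ)
    (κ : K) (hκ : ‖κ‖ = 1)
    (ha : Multiset.card a + 1 = d) (hb : Multiset.card b = d) (hw : Multiset.card w + 2 = 2 * d)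
    (hW : derivative (cvP a) * cvP b - cvP a * derivative (cvP b) = C κ * cvP w)
    (ρ : ℝ) (hρ : 0 < ρ) (hbρ : ∀ x ∈ b, ‖x‖ ≤ ρ) (hwρ : ∀ x ∈ w, ‖x‖ ≤ ρ)
    (hν : ∀ t, 0 < t → t < ρ →
      2 * b.countP (fun x => ‖x‖ ≤ t) ≤ w.countP (fun x => ‖x‖ ≤ t) + 1)
    (l : ℝ) (hl : ∀ m : ℕ, 1 ≤ m → m ≤ d → l ≤ ‖(m : K)‖) :
    ∀ t, 0 < t → t ≤ ρ → l * cvN a t * ρ ≤ cvN b t := by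
  classical
  -- logarithmic derivative estimate
  have hlog : ∀ t, 0 < t → ‖((a.countP (fun x => ‖x‖ ≤ t) : ℕ) : K) -
      ((b.countP (fun x => ‖x‖ ≤ t) : ℕ) : K)‖ * (cvN a t * cvN b t) ≤ t * cvN w t := by
    intro t ht
    apply cv_logderiv a b t _ ht
    intro k
    rw [hW, coeff_C_mul, norm_mul, hκ, one_mul]
    exact cvP_coeff_le w t ht k
  have hlog2 : ∀ t, 0 < t → a.countP (fun x => ‖x‖ ≤ t) ≠ b.countP (fun x => ‖x‖ ≤ t) →
      t * cvN w t * ρ ≤ cvN b t ^ 2 → l * cvN a t * ρ ≤ cvN b t := by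
    intro t ht hne hΦ
    have hA := cvN_pos a t ht
    have hB := cvN_pos b t ht
    have h1 := hlog t ht
    have hca : a.countP (fun x => ‖x‖ ≤ t) ≤ d := (Multiset.countP_le_card _ _).trans (by omega)
    have hcb : b.countP (fun x => ‖x‖ ≤ t) ≤ d := (Multiset.countP_le_card _ _).trans (by omega)
    have h2 : l ≤ ‖((a.countP (fun x => ‖x‖ ≤ t) : ℕ) : K) -
      ((b.countP (fun x => ‖x‖ ≤ t) : ℕ) : K)‖ := by
      rcases lt_or_gt_of_ne hne with h | h
      · rw [norm_sub_rev, ← Nat.cast_sub h.le]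
        exact hl _ (by omega) (by omega)
      · rw [← Nat.cast_sub h.le]
        exact hl _ (by omega) (by omega)
    have h3 : l * (cvN a t * cvN b t) ≤ t * cvN w t :=
      (mul_le_mul_of_nonneg_right h2 (by positivity)).trans h1
    have h4 : (l * cvN a t * ρ) * cvN b t ≤ cvN b t * cvN b t := by nlinarith
    exact le_of_mul_le_mul_right h4 hB
  have hbcount : b.countP (fun x => ‖x‖ ≤ ρ) = d := by
    rw [← hb]; exact Multiset.countP_eq_card.mpr hbρ
  have hacount : a.countP (fun x => ‖x‖ ≤ ρ) < d :=
    lt_of_le_of_lt (Multiset.countP_le_card _ _) (by omega)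
  have hΦρ : ρ * cvN w ρ * ρ ≤ cvN b ρ ^ 2 := by
    rw [cvN_le w ρ hwρ, cvN_le b ρ hbρ, hb, ← pow_mul, mul_comm d 2, ← hw, pow_add]
    apply le_of_eq; ring
  have main := cv_step_induct ((a + b + w).map (fun x => ‖x‖)).toFinset ρ
    (fun t => t * cvN w t * ρ ≤ cvN b t ^ 2 ∧ l * cvN a t * ρ ≤ cvN b t)
    ⟨hΦρ, hlog2 ρ hρ (by omega) hΦρ⟩
    (by
      rintro t t' ht htt ht' hT ⟨h1, h2⟩
      have ht0 : 0 < t' := ht.trans htt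
      have hT' : ∀ x, x ∈ a + b + w → ‖x‖ ≤ t ∨ t' ≤ ‖x‖ := by
        intro x hx
        apply hT
        rw [Multiset.mem_toFinset]
        exact Multiset.mem_map_of_mem _ hx
      have sa := cvN_step a t t' htt.le (fun x hx => hT' x (by simp [hx]))
      have sb := cvN_step b t t' htt.le (fun x hx => hT' x (by simp [hx]))
      have sw := cvN_step w t t' htt.le (fun x hx => hT' x (by simp [hx]))
      have hA := cvN_pos a t ht
      have hB := cvN_pos b t ht
      have hN := hν t ht (lt_of_lt_of_le htt ht')
      have hτ : 1 ≤ t' / t := by rw [one_le_div ht]; exact htt.le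
      have conv : ∀ s : Multiset K, ∀ n : ℕ, cvN s t' * t ^ n = cvN s t * t' ^ n →
          cvN s t' = cvN s t * (t' / t) ^ n := by
        intro s n h
        rw [div_pow]; field_simp; exact h
      have sa' := conv a _ sa
      have sb' := conv b _ sb
      have sw' := conv w _ sw
      have et : t' = t * (t' / t) := by field_simp
      set τ := t' / t with hτd
      have hΦ : t * cvN w t * ρ ≤ cvN b t ^ 2 := by
        rw [sw', sb', et] at h1
        set p := w.countP (fun x => ‖x‖ ≤ t)
        set q := b.countP (fun x => ‖x‖ ≤ t)
        have h3 : (t * cvN w t * ρ) * τ ^ (p + 1) ≤ cvN b t ^ 2 * τ ^ (2 * q) := by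
          calc _ = t * τ * (cvN w t * τ ^ p) * ρ := by ring
            _ ≤ _ := h1
            _ = _ := by ring
        have h4 : τ ^ (2 * q) ≤ τ ^ (p + 1) := pow_le_pow_right₀ hτ hN
        have h5 : 0 < τ ^ (p + 1) := by positivity
        exact le_of_mul_le_mul_right
          (h3.trans (mul_le_mul_of_nonneg_left h4 (by positivity))) h5
      refine ⟨hΦ, ?_⟩
      by_cases hne : a.countP (fun x => ‖x‖ ≤ t) = b.countP (fun x => ‖x‖ ≤ t)
      · rw [sa', sb', hne] at h2
        have h5 : 0 < τ ^ (b.countP (fun x => ‖x‖ ≤ t)) := by positivity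
        refine le_of_mul_le_mul_right ?_ h5
        calc _ = _ := by ring
          _ ≤ _ := h2
      · exact hlog2 t ht hne hΦ)
  intro t ht htρ
  exact (main t ht htρ).2

lemma cv_path0 {K : Type*} [NormedField K] [IsUltrametricDist K] (a b w : Multiset K) (d : ℕ)
    (κ : K) (hκ : ‖κ‖ = 1)
    (ha : Multiset.card a + 1 = d) (hb : Multiset.card b = d) (hw : Multiset.card w + 2 = 2 * d)
    (hW : derivative (cvP a) * cvP b - cvP a * derivative (cvP b) = C κ * cvP w)
    (ρ : ℝ) (hρ : 0 < ρ) (hbρ : ∀ x ∈ b, ‖x‖ ≤ ρ) (hwρ : ∀ x ∈ w, ‖x‖ ≤ ρ)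
    (hν : ∀ t, 0 < t → t < ρ →
      2 * b.countP (fun x => ‖x‖ ≤ t) ≤ w.countP (fun x => ‖x‖ ≤ t) + 1)
    (l : ℝ) (hl0 : 0 < l) (hl : ∀ m : ℕ, 1 ≤ m → m ≤ d → l ≤ ‖(m : K)‖)
    (h0 : ∀ x ∈ b, x ≠ 0) :
    l * ‖(cvP a).eval 0‖ * ρ ≤ ‖(cvP b).eval 0‖ := by
  classical
  obtain ⟨t, ht0, htρ, htb⟩ : ∃ t, 0 < t ∧ t ≤ ρ ∧ ∀ x ∈ b, t ≤ ‖x‖ := by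
    obtain ⟨t, ht, hmin⟩ := Finset.exists_min_image (insert ρ (b.map (fun x => ‖x‖)).toFinset) id
      ⟨ρ, by simp⟩
    refine ⟨t, ?_, hmin ρ (by simp), fun x hx => hmin _ ?_⟩
    · simp only [Finset.mem_insert, Multiset.mem_toFinset, Multiset.mem_map] at ht
      rcases ht with h | ⟨x, hx, h⟩
      · rw [h]; exact hρ
      · rw [← h]; exact norm_pos_iff.mpr (h0 x hx)
    · simp only [Finset.mem_insert, Multiset.mem_toFinset, Multiset.mem_map]
      exact Or.inr ⟨x, hx, rfl⟩
  have h1 := cv_path a b w d κ hκ ha hb hw hW ρ hρ hbρ hwρ hν l hl t ht0 htρ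
  rw [cvN_ge b t htb] at h1
  rw [← coeff_zero_eq_eval_zero, ← coeff_zero_eq_eval_zero]
  refine le_trans ?_ h1
  have := cvP_coeff_le a t ht0 0
  simp only [pow_zero, mul_one] at this
  gcongr

lemma cvP_taylor {K : Type*} [Field K] (s : Multiset K) (c : K) :
    taylor c (cvP s) = cvP (s.map (fun x => x - c)) := by
  induction s using Multiset.induction_on with
  | empty => simp [cvP]
  | cons a s ih =>
    rw [cvP_cons, taylor_mul, ih, Multiset.map_cons, cvP_cons]
    congr 1
    simp; ring

lemma cv_deriv_taylor {K : Type*} [Field K] (p : K[X]) (c : K) :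
    derivative (taylor c p) = taylor c (derivative p) := by
  simp [taylor_apply, derivative_comp]

lemma cv_pathc {K : Type*} [NormedField K] [IsUltrametricDist K] (a b w : Multiset K) (d : ℕ)
    (κ : K) (hκ : ‖κ‖ = 1)
    (ha : Multiset.card a + 1 = d) (hb : Multiset.card b = d) (hw : Multiset.card w + 2 = 2 * d)
    (hW : derivative (cvP a) * cvP b - cvP a * derivative (cvP b) = C κ * cvP w)
    (c : K)
    (ρ : ℝ) (hρ : 0 < ρ) (hbρ : ∀ x ∈ b, ‖x - c‖ ≤ ρ) (hwρ : ∀ x ∈ w, ‖x - c‖ ≤ ρ)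
    (hν : ∀ t, 0 < t → t < ρ →
      2 * b.countP (fun x => ‖x - c‖ ≤ t) ≤ w.countP (fun x => ‖x - c‖ ≤ t) + 1)
    (l : ℝ) (hl0 : 0 < l) (hl : ∀ m : ℕ, 1 ≤ m → m ≤ d → l ≤ ‖(m : K)‖)
    (h0 : ∀ x ∈ b, x ≠ c) :
    l * ‖(cvP a).eval c‖ * ρ ≤ ‖(cvP b).eval c‖ := by
  have e : ∀ s : Multiset K, (cvP (s.map (fun x => x - c))).eval 0 = (cvP s).eval c := by
    intro s
    rw [← cvP_taylor, taylor_eval, zero_add]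
  rw [← e a, ← e b]
  apply cv_path0 _ _ (w.map (fun x => x - c)) d κ hκ (by simpa using ha) (by simpa using hb)
    (by simpa using hw) ?_ ρ hρ ?_ ?_ ?_ l hl0 hl ?_
  · rw [← cvP_taylor, ← cvP_taylor, ← cvP_taylor, cv_deriv_taylor, cv_deriv_taylor,
      ← taylor_mul, ← taylor_mul, ← map_sub, hW, taylor_mul, taylor_C]
  · simpa using hbρ
  · simpa using hwρ
  · intro t h1 h2
    have := hν t h1 h2
    rw [Multiset.countP_map, Multiset.countP_map, ← Multiset.countP_eq_card_filter,
      ← Multiset.countP_eq_card_filter]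
    exact this
  · simpa [sub_eq_zero] using h0


lemma cv_balls_step {K : Type*} [NormedField K] [IsUltrametricDist K] (T : Finset K) (μ : K → ℤ)
    (τ : K → ℝ) (h : ∀ c ∈ T, ∑ x ∈ T with ‖x - c‖ ≤ τ c, μ x ≤ -2)
    (hT : T.Nonempty) (hτ : ∀ c ∈ T, 0 < τ c) :
    ∃ c ∈ T, ∑ x ∈ T, μ x ≤ -2 + ∑ x ∈ T with ¬ ‖x - c‖ ≤ τ c, μ x ∧
      (∀ c' ∈ T.filter (fun x => ¬ ‖x - c‖ ≤ τ c),
        ∑ x ∈ T.filter (fun x => ¬ ‖x - c‖ ≤ τ c) with ‖x - c'‖ ≤ τ c', μ x ≤ -2) ∧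
      T.filter (fun x => ¬ ‖x - c‖ ≤ τ c) ⊂ T := by
  classical
  obtain ⟨c, hc, hmax⟩ := Finset.exists_max_image T τ hT
  refine ⟨c, hc, ?_, ?_, ?_⟩
  · rw [← Finset.sum_filter_add_sum_filter_not T (fun x => ‖x - c‖ ≤ τ c)]
    have := h c hc
    linarith
  · intro c' hc'
    rw [Finset.mem_filter] at hc'
    have h1 := h c' hc'.1
    have : (T.filter (fun x => ¬ ‖x - c‖ ≤ τ c)).filter (fun x => ‖x - c'‖ ≤ τ c') =
        T.filter (fun x => ‖x - c'‖ ≤ τ c') := by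
      ext x
      simp only [Finset.mem_filter]
      constructor
      · rintro ⟨⟨h1, _⟩, h3⟩; exact ⟨h1, h3⟩
      · rintro ⟨h1, h3⟩
        refine ⟨⟨h1, fun hx => hc'.2 ?_⟩, h3⟩
        have e : c' - c = (x - c) - (x - c') := by ring
        rw [e]
        exact (cv_sub_le_max _ _).trans (max_le hx (h3.trans (hmax c' hc'.1)))
    rw [this]; exact h1
  · rw [Finset.filter_ssubset]
    exact ⟨c, hc, by simpa using (hτ c hc).le⟩

lemma cv_balls {K : Type*} [NormedField K] [IsUltrametricDist K] (μ : K → ℤ)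
    (τ : K → ℝ) (T : Finset K) : (∀ c ∈ T, ∑ x ∈ T with ‖x - c‖ ≤ τ c, μ x ≤ -2) →
    T.Nonempty → (∀ c ∈ T, 0 < τ c) → ∑ x ∈ T, μ x ≤ -2 := by
  induction T using Finset.strongInduction with
  | H T ih =>
    intro h hT hτ
    obtain ⟨c, hc, h1, h2, h3⟩ := cv_balls_step T μ τ h hT hτ
    rcases (T.filter (fun x => ¬ ‖x - c‖ ≤ τ c)).eq_empty_or_nonempty with he | hne
    · rw [he] at h1; simpa using h1
    · have := ih _ h3 h2 hne (fun c' hc' => hτ c' (Finset.mem_of_mem_filter c' hc'))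
      linarith

lemma cv_count_sum {K : Type*} [DecidableEq K] (s : Multiset K) (T : Finset K)
    (hs : ∀ x ∈ s, x ∈ T) (p : K → Prop) [DecidablePred p] :
    s.countP p = ∑ x ∈ T with p x, s.count x := by
  rw [Multiset.countP_eq_card_filter, ← Multiset.sum_count_eq_card (s := T.filter p)]
  · apply Finset.sum_congr rfl
    intro x hx
    rw [Multiset.count_filter, if_pos (Finset.mem_filter.mp hx).2]
  · intro x hx
    rw [Multiset.mem_filter] at hx
    exact Finset.mem_filter.mpr ⟨hs x hx.1, hx.2⟩

lemma cv_select {K : Type*} [NormedField K] [IsUltrametricDist K] (b w : Multiset K) (d : ℕ)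
    (hb : Multiset.card b = d) (hw : Multiset.card w + 2 = 2 * d)
    (ρ : ℝ) (h0 : (0 : K) ∈ b) (u0 : K) (hu0 : u0 ∈ b + w) (hu : ‖u0‖ = ρ) :
    ∃ c ∈ b + w, ∀ t, 0 < t → t < ρ →
      2 * b.countP (fun x => ‖x - c‖ ≤ t) ≤ w.countP (fun x => ‖x - c‖ ≤ t) + 1 := by
  classical
  by_contra hcon
  push Not at hcon
  choose! τ hτ using hcon
  set T := (b + w).toFinset with hT
  have hTm : ∀ x, x ∈ T ↔ x ∈ b + w := fun x => Multiset.mem_toFinset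
  set μ : K → ℤ := fun x => (w.count x : ℤ) - 2 * b.count x with hμ
  have hbT : ∀ x ∈ b, x ∈ T := fun x hx => (hTm x).mpr (by simp [hx])
  have hwT : ∀ x ∈ w, x ∈ T := fun x hx => (hTm x).mpr (by simp [hx])
  have h : ∀ c ∈ T, ∑ x ∈ T with ‖x - c‖ ≤ τ c, μ x ≤ -2 := by
    intro c hc
    have h1 := (hτ c ((hTm c).mp hc)).2.2
    rw [cv_count_sum b T hbT, cv_count_sum w T hwT] at h1
    simp only [hμ, Finset.sum_sub_distrib, ← Finset.mul_sum]
    zify at h1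
    linarith
  have hpos : ∀ c ∈ T, 0 < τ c := fun c hc => (hτ c ((hTm c).mp hc)).1
  have h0T : (0 : K) ∈ T := hbT 0 h0
  obtain ⟨c, hc, h1, h2, h3⟩ := cv_balls_step T μ τ h ⟨0, h0T⟩ hpos
  have htot : ∑ x ∈ T, μ x = -2 := by
    simp only [hμ, Finset.sum_sub_distrib, ← Finset.mul_sum]
    rw [← Nat.cast_sum, ← Nat.cast_sum, Multiset.sum_count_eq_card hwT,
      Multiset.sum_count_eq_card hbT]
    omega
  have hcρ := (hτ c ((hTm c).mp hc)).2.1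
  have hne : (T.filter (fun x => ¬ ‖x - c‖ ≤ τ c)).Nonempty := by
    by_contra hemp
    rw [Finset.not_nonempty_iff_eq_empty, Finset.filter_eq_empty_iff] at hemp
    have e1 := not_not.mp (hemp h0T)
    have e2 := not_not.mp (hemp ((hTm u0).mpr hu0))
    have e : u0 = (u0 - c) - (0 - c) := by ring
    have := cv_sub_le_max (u0 - c) (0 - c)
    rw [← e, hu] at this
    have := this.trans (max_le e2 e1)
    linarith
  have := cv_balls μ τ _ h2 hne (fun c' hc' => hpos c' (Finset.mem_of_mem_filter c' hc'))
  linarith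

lemma cv_pole_mult {K : Type*} [Field K] [DecidableEq K] (a b w : Multiset K) (κ : K) (c : K)
    (hW : derivative (cvP a) * cvP b - cvP a * derivative (cvP b) = C κ * cvP w)
    (hcb : c ∈ b) (hca : (cvP a).eval c ≠ 0) (he : ((b.count c : ℕ) : K) ≠ 0) :
    w.count c < b.count c := by
  by_contra hcon
  push Not at hcon
  set e := b.count c with hed
  have hpos : 1 ≤ e := Multiset.one_le_count_iff_mem.mpr hcb
  obtain ⟨w', hw'⟩ := Multiset.le_iff_exists_add.mp (Multiset.le_count_iff_replicate_le.mp hcon)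
  obtain ⟨b', hb'⟩ := Multiset.le_iff_exists_add.mp
    (Multiset.le_count_iff_replicate_le.mp (le_refl (b.count c)))
  rw [← hed] at hb'
  have hcb' : c ∉ b' := by
    intro hm
    have : b.count c = e + b'.count c := by
      conv_lhs => rw [hb']
      rw [Multiset.count_add, Multiset.count_replicate_self]
    have h2 := Multiset.one_le_count_iff_mem.mpr hm
    omega
  have hrep : cvP (Multiset.replicate e c) = (X - C c) ^ e := by
    simp [cvP, Multiset.map_replicate]
  have hbe : (cvP b').eval c ≠ 0 := by
    intro h
    have this : (cvP b').roots = b' := roots_multiset_prod_X_sub_C b'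
    apply hcb'
    rw [← this, mem_roots (cvP_monic b').ne_zero]
    exact h
  obtain ⟨j, hj⟩ : ∃ j, e = j + 1 := ⟨e - 1, by omega⟩
  have eb : cvP b = (X - C c) ^ e * cvP b' := by
    conv_lhs => rw [hb', cvP_add, hrep]
  have ew : cvP w = (X - C c) ^ e * cvP w' := by
    rw [hw', cvP_add, hrep]
  have hX : (X - C c : K[X]) ≠ 0 := X_sub_C_ne_zero c
  rw [eb, ew, derivative_mul, derivative_pow, hj] at hW
  simp only [derivative_sub, derivative_X, derivative_C, sub_zero, mul_one,
    Nat.add_sub_cancel] at hW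
  have h2 : (X - C c) ^ j * (derivative (cvP a) * (X - C c) * cvP b' -
      cvP a * (C ((j + 1 : ℕ) : K) * cvP b' + (X - C c) * derivative (cvP b')) -
      C κ * (X - C c) * cvP w') = 0 := by
    linear_combination hW
  have h3 := (mul_eq_zero.mp h2).resolve_left (pow_ne_zero _ hX)
  have h4 := congrArg (eval c) h3
  simp only [eval_sub, eval_mul, eval_add, eval_X, eval_C, sub_self, mul_zero, zero_mul,
    add_zero, zero_sub, sub_zero, eval_zero, neg_eq_zero, mul_eq_zero] at h4
  rw [← hj] at h4
  rcases h4 with h | h | h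
  · exact hca h
  · exact he h
  · exact hbe h

lemma cv_small {K : Type*} [NormedField K] (s : Multiset K) (ρ : ℝ) (hρ : 0 < ρ) (c : K) :
    ∃ t, 0 < t ∧ t < ρ ∧ ∀ x ∈ s, ‖x - c‖ ≤ t → x = c := by
  induction s using Multiset.induction_on with
  | empty => exact ⟨ρ / 2, by linarith, by linarith, by simp⟩
  | cons a s ih =>
    obtain ⟨t, h1, h2, h3⟩ := ih
    by_cases hac : a = c
    · refine ⟨t, h1, h2, fun x hx hxt => ?_⟩
      rcases Multiset.mem_cons.mp hx with h | h
      · rw [h, hac]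
      · exact h3 x h hxt
    · have hpos : 0 < ‖a - c‖ := norm_pos_iff.mpr (sub_ne_zero.mpr hac)
      refine ⟨min t (‖a - c‖ / 2), lt_min h1 (by linarith), (min_le_left _ _).trans_lt h2,
        fun x hx hxt => ?_⟩
      rcases Multiset.mem_cons.mp hx with h | h
      · have := hxt.trans (min_le_right _ _)
        rw [h] at this; linarith
      · exact h3 x h (hxt.trans (min_le_left _ _))

/-- Main statement in the inverted coordinate. -/
lemma cv_inverted {K : Type*} [NormedField K] [IsUltrametricDist K] (a b w : Multiset K) (d : ℕ)
    (κ : K) (hκ : ‖κ‖ = 1)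
    (ha : Multiset.card a + 1 = d) (hb : Multiset.card b = d) (hw : Multiset.card w + 2 = 2 * d)
    (hW : derivative (cvP a) * cvP b - cvP a * derivative (cvP b) = C κ * cvP w)
    (hcop : ∀ x ∈ b, (cvP a).eval x ≠ 0)
    (ρ : ℝ) (hρ : 0 < ρ) (hbρ : ∀ x ∈ b, ‖x‖ ≤ ρ) (hwρ : ∀ x ∈ w, ‖x‖ ≤ ρ)
    (h0 : (0 : K) ∈ b) (u0 : K) (hu0 : u0 ∈ b + w) (hu : ‖u0‖ = ρ)
    (l : ℝ) (hl0 : 0 < l) (hl : ∀ m : ℕ, 1 ≤ m → m ≤ d → l ≤ ‖(m : K)‖) :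
    ∃ c ∈ w, c ∉ b ∧ l * ‖(cvP a).eval c‖ * ρ ≤ ‖(cvP b).eval c‖ := by
  classical
  obtain ⟨c, hc, hν⟩ := cv_select b w d hb hw ρ h0 u0 hu0 hu
  have hcb : c ∉ b := by
    intro hcb
    obtain ⟨t, ht0, htρ, hts⟩ := cv_small (b + w) ρ hρ c
    have h1 := hν t ht0 htρ
    have e : ∀ s : Multiset K, s ≤ b + w → s.countP (fun x => ‖x - c‖ ≤ t) = s.count c := by
      intro s hs
      rw [Multiset.count]
      apply Multiset.countP_congr rfl
      intro x hx
      have := hts x (Multiset.mem_of_le hs hx)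
      simp only [eq_iff_iff]
      constructor
      · intro h; exact (this h).symm
      · intro h; rw [← h]; simpa using ht0.le
    rw [e b (Multiset.le_add_right _ _), e w (Multiset.le_add_left _ _)] at h1
    have hpos : 1 ≤ b.count c := Multiset.one_le_count_iff_mem.mpr hcb
    have hle : b.count c ≤ d := hb ▸ Multiset.count_le_card c b
    have := cv_pole_mult a b w κ c hW hcb (hcop c hcb) (by
      rw [← norm_pos_iff]
      exact lt_of_lt_of_le hl0 (hl _ hpos hle))
    omega
  have hcw : c ∈ w := (Multiset.mem_add.mp hc).resolve_left hcb
  refine ⟨c, hcw, hcb, ?_⟩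
  have hcρ := hwρ c hcw
  exact cv_pathc a b w d κ hκ ha hb hw hW c ρ hρ
    (fun x hx => (cv_sub_le_max _ _).trans (max_le (hbρ x hx) hcρ))
    (fun x hx => (cv_sub_le_max _ _).trans (max_le (hwρ x hx) hcρ))
    hν l hl0 hl (fun x hx h => hcb (h ▸ hx))

lemma cv_lam_le {K : Type*} [NormedField K] (d m : ℕ) (h1 : 1 ≤ m) (h2 : m ≤ d) :
    lam K d ≤ ‖(m : K)‖ := by
  unfold lam
  exact ciInf_le (Set.Finite.bddBelow (Set.finite_range _))
    (⟨m, Finset.mem_Icc.2 ⟨h1, h2⟩⟩ : Finset.Icc 1 d)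

lemma cv_lam_ge {K : Type*} [NormedField K] (d : ℕ) (hd : 1 ≤ d) (c : ℝ)
    (h : ∀ m : ℕ, 1 ≤ m → m ≤ d → c ≤ ‖(m : K)‖) : c ≤ lam K d := by
  unfold lam
  have : Nonempty (Finset.Icc 1 d) := ⟨⟨1, Finset.mem_Icc.2 ⟨le_refl _, hd⟩⟩⟩
  exact le_ciInf fun m => h m.1 (Finset.mem_Icc.1 m.2).1 (Finset.mem_Icc.1 m.2).2

lemma cv_padic {K : Type*} [NormedField K] [IsUltrametricDist K] (p : ℕ) (hp : 2 ≤ p)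
    (hp1 : ‖(p : K)‖ < 1) (hp0 : 0 < ‖(p : K)‖)
    (hmin : ∀ m : ℕ, 1 ≤ m → m < p → ‖(m : K)‖ = 1) (n : ℕ) : 1 ≤ n →
    ‖(p : K)‖ ^ (((n : ℝ) - 1) / ((p : ℝ) - 1)) ≤ ‖(n : K)‖ := by
  have hpr : (2 : ℝ) ≤ p := by exact_mod_cast hp
  induction n using Nat.strong_induction_on with
  | _ n ih =>
    intro hn
    have hnr : (1 : ℝ) ≤ n := by exact_mod_cast hn
    by_cases hdv : p ∣ n
    · obtain ⟨m, rfl⟩ := hdv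
      have hm : 1 ≤ m := by
        rcases Nat.eq_zero_or_pos m with h | h
        · subst h; simp at hn
        · exact h
      have hlt : m < p * m := by nlinarith
      have h := ih m hlt hm
      have hmr : (1 : ℝ) ≤ m := by exact_mod_cast hm
      push_cast
      rw [norm_mul]
      calc ‖(p : K)‖ ^ (((p : ℝ) * m - 1) / ((p : ℝ) - 1))
          ≤ ‖(p : K)‖ ^ (1 + ((m : ℝ) - 1) / ((p : ℝ) - 1)) := by
            apply Real.rpow_le_rpow_of_exponent_ge hp0 hp1.le
            have : (0 : ℝ) < (p : ℝ) - 1 := by linarith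
            rw [← sub_nonneg]
            have e : ((p : ℝ) * m - 1) / ((p : ℝ) - 1) - (1 + ((m : ℝ) - 1) / ((p : ℝ) - 1))
              = m - 1 := by
              field_simp
              ring
            rw [e]; linarith
        _ = ‖(p : K)‖ * ‖(p : K)‖ ^ (((m : ℝ) - 1) / ((p : ℝ) - 1)) := by
            rw [Real.rpow_add hp0, Real.rpow_one]
        _ ≤ _ := by gcongr
    · have h1 : ‖(n : K)‖ = 1 := by
        have hs : 1 ≤ n % p := by
          rcases Nat.eq_zero_or_pos (n % p) with h | h
          · exact absurd (Nat.dvd_of_mod_eq_zero h) hdv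
          · exact h
        have hs' := hmin _ hs (Nat.mod_lt _ (by omega))
        have e : (n : K) = (p : K) * ((n / p : ℕ) : K) + ((n % p : ℕ) : K) := by
          rw [← Nat.cast_mul, ← Nat.cast_add, Nat.div_add_mod]
        have hq : ‖(p : K) * ((n / p : ℕ) : K)‖ < 1 := by
          rw [norm_mul]
          have := IsUltrametricDist.norm_natCast_le_one K (n / p)
          nlinarith [norm_nonneg ((n / p : ℕ) : K)]
        rw [e, IsUltrametricDist.norm_add_eq_max_of_norm_ne_norm (by rw [hs']; exact hq.ne), hs',
          max_eq_right hq.le]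
      rw [h1]
      apply Real.rpow_le_one hp0.le hp1.le
      apply div_nonneg <;> linarith

lemma cv_gam {K : Type*} [NormedField K] [IsUltrametricDist K] (d : ℕ) (hd : 2 ≤ d)
    (hlam : 0 < lam K d) : 1 ≤ gam K d ∧
    ∀ n : ℕ, 1 ≤ n → n ≤ d → 1 ≤ ‖(n : K)‖ * gam K d ^ (n - 1) := by
  by_cases h1 : lam K d = 1
  · have : gam K d = 1 := by simp [gam, h1]
    rw [this]
    refine ⟨le_refl _, fun n hn hnd => ?_⟩
    simp only [one_pow, mul_one]
    rw [← h1]; exact cv_lam_le d n hn hnd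
  · have hex : ∃ m : ℕ, 1 ≤ m ∧ m ≤ d ∧ ‖(m : K)‖ < 1 := by
      by_contra hcon
      push Not at hcon
      apply h1
      apply le_antisymm
      · have := cv_lam_le (K := K) d 1 (le_refl _) (by omega)
        simpa using this
      · exact cv_lam_ge d (by omega) 1 hcon
    obtain ⟨m, hm1, hmd, hm⟩ := hex
    have hm2 : 2 ≤ m := by
      rcases Nat.lt_or_ge m 2 with h | h
      · have : m = 1 := by omega
        subst this; simp at hm
      · exact h
    have hmem : m ∈ {m : ℕ | 2 ≤ m ∧ ‖(m : K)‖ < 1} := ⟨hm2, hm⟩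
    have hp := Nat.sInf_mem (⟨m, hmem⟩ : Set.Nonempty _)
    have hpm := Nat.sInf_le hmem
    change 2 ≤ resChar K ∧ ‖(resChar K : K)‖ < 1 at hp
    change resChar K ≤ m at hpm
    have hg : gam K d = ‖((resChar K : ℕ) : K)‖ ^ (-(1 : ℝ) / ((resChar K : ℝ) - 1)) := by
      simp [gam, h1]
    have hmin : ∀ k : ℕ, 1 ≤ k → k < resChar K → ‖(k : K)‖ = 1 := by
      intro k hk hkp
      apply le_antisymm (IsUltrametricDist.norm_natCast_le_one K k)
      by_contra hc
      push Not at hc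
      have hk2 : 2 ≤ k := by
        rcases Nat.lt_or_ge k 2 with h | h
        · have : k = 1 := by omega
          subst this; simp at hc
        · exact h
      have : resChar K ≤ k := Nat.sInf_le (show k ∈ {m : ℕ | 2 ≤ m ∧ ‖(m : K)‖ < 1} from ⟨hk2, hc⟩)
      omega
    have hp0 : 0 < ‖(resChar K : K)‖ := lt_of_lt_of_le hlam (cv_lam_le d _ (by omega) (by omega))
    have hpr : (2 : ℝ) ≤ resChar K := by exact_mod_cast hp.1
    rw [hg]
    refine ⟨?_, fun n hn hnd => ?_⟩
    · apply Real.one_le_rpow_of_pos_of_le_one_of_nonpos hp0 hp.2.le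
      apply div_nonpos_of_nonpos_of_nonneg <;> linarith
    · have h := cv_padic (resChar K) hp.1 hp.2 hp0 hmin n hn
      rw [← Real.rpow_natCast, ← Real.rpow_mul hp0.le]
      push_cast [Nat.cast_sub hn]
      have e : -(1 : ℝ) / ((resChar K : ℝ) - 1) * ((n : ℝ) - 1)
        = -(((n : ℝ) - 1) / ((resChar K : ℝ) - 1)) := by ring
      rw [e, Real.rpow_neg hp0.le, ← div_eq_mul_inv, one_le_div (Real.rpow_pos_of_pos hp0 _)]
      exact h

lemma cv_splitP {K : Type*} [Field K] [IsAlgClosed K] (f : K[X]) :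
    f = C f.leadingCoeff * cvP f.roots := (IsAlgClosed.splits f).eq_prod_roots

lemma cv_noroots {K : Type*} [NormedField K] [IsUltrametricDist K] [IsAlgClosed K] (g : K[X])
    (σ : ℝ) (hσ : 0 < σ) (h : ∀ z, g.eval z = 0 → σ ≤ ‖z‖) (k : ℕ) :
    ‖g.coeff k‖ * σ ^ k ≤ ‖g.coeff 0‖ := by
  have e := cv_splitP g
  have hN := cvN_ge g.roots σ (fun x hx => h x (isRoot_of_mem_roots hx))
  have hk := cvP_coeff_le g.roots σ hσ k
  rw [hN] at hk
  rw [e, coeff_C_mul, coeff_C_mul, norm_mul, norm_mul, mul_assoc]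
  gcongr

lemma cv_divbound {K : Type*} [NormedField K] [IsUltrametricDist K] (y g h : PowerSeries K)
    (σ M : ℝ) (hσ : 0 < σ) (hyg : y * g = h) (hg0 : PowerSeries.coeff 0 g ≠ 0)
    (hg : ∀ k, ‖PowerSeries.coeff k g‖ * σ ^ k ≤ ‖PowerSeries.coeff 0 g‖)
    (hh : ∀ k, ‖PowerSeries.coeff k h‖ * σ ^ k ≤ M) (k : ℕ) :
    ‖PowerSeries.coeff k y‖ * σ ^ k * ‖PowerSeries.coeff 0 g‖ ≤ M := by
  have hM : 0 ≤ M := le_trans (by positivity) (hh 0)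
  have hg0' : 0 < ‖PowerSeries.coeff 0 g‖ := norm_pos_iff.2 hg0
  induction k using Nat.strong_induction_on with
  | _ k ih =>
    have e : PowerSeries.coeff k h = ∑ i ∈ Finset.range k,
        PowerSeries.coeff i y * PowerSeries.coeff (k - i) g +
        PowerSeries.coeff k y * PowerSeries.coeff 0 g := by
      rw [← hyg, PowerSeries.coeff_mul, Finset.Nat.sum_antidiagonal_eq_sum_range_succ
        (fun i j => PowerSeries.coeff i y * PowerSeries.coeff j g), Finset.sum_range_succ]
      simp
    have hσk : 0 < σ ^ k := by positivity
    have hs : ‖∑ i ∈ Finset.range k,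
        PowerSeries.coeff i y * PowerSeries.coeff (k - i) g‖ ≤ M / σ ^ k := by
      apply cv_sum_le _ _ _ (by positivity)
      intro i hi
      have hi' := Finset.mem_range.1 hi
      rw [le_div_iff₀ hσk, norm_mul]
      have e2 : σ ^ k = σ ^ i * σ ^ (k - i) := by rw [← pow_add]; congr 1; omega
      calc ‖PowerSeries.coeff i y‖ * ‖PowerSeries.coeff (k - i) g‖ * σ ^ k
          = (‖PowerSeries.coeff i y‖ * σ ^ i) * (‖PowerSeries.coeff (k - i) g‖ * σ ^ (k - i)) := by
            rw [e2]; ring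
        _ ≤ (‖PowerSeries.coeff i y‖ * σ ^ i) * ‖PowerSeries.coeff 0 g‖ := by
            gcongr; exact hg _
        _ ≤ M := ih i hi'
    have hh' : ‖PowerSeries.coeff k h‖ ≤ M / σ ^ k := by
      rw [le_div_iff₀ hσk]; exact hh k
    have : PowerSeries.coeff k y * PowerSeries.coeff 0 g = PowerSeries.coeff k h -
      ∑ i ∈ Finset.range k, PowerSeries.coeff i y * PowerSeries.coeff (k - i) g := by
      rw [e]; ring
    have h3 : ‖PowerSeries.coeff k y * PowerSeries.coeff 0 g‖ ≤ M / σ ^ k := by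
      rw [this]
      exact (cv_sub_le_max _ _).trans (max_le hh' hs)
    rw [le_div_iff₀ hσk, norm_mul] at h3
    linarith

lemma cv_divlower {K : Type*} [NormedField K] [IsUltrametricDist K] (y g h : PowerSeries K)
    (r M : ℝ) (hr : 0 < r) (hM : 0 < M) (hyg : y * g = h) (hg0 : PowerSeries.coeff 0 g ≠ 0)
    (hg : ∀ k, ‖PowerSeries.coeff k g‖ * r ^ k ≤ ‖PowerSeries.coeff 0 g‖)
    (hgs : ∀ k, 1 ≤ k → ‖PowerSeries.coeff k g‖ * r ^ k < ‖PowerSeries.coeff 0 g‖)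
    (hh : ∀ k, ‖PowerSeries.coeff k h‖ * r ^ k ≤ M) (n : ℕ)
    (hn : ‖PowerSeries.coeff n h‖ * r ^ n = M) :
    M ≤ ‖PowerSeries.coeff n y‖ * r ^ n * ‖PowerSeries.coeff 0 g‖ := by
  by_contra hc
  push Not at hc
  have hb := cv_divbound y g h r M hr hyg hg0 hg hh
  have hg0' : 0 < ‖PowerSeries.coeff 0 g‖ := norm_pos_iff.2 hg0
  have e : PowerSeries.coeff n h = ∑ i ∈ Finset.range (n + 1),
      PowerSeries.coeff i y * PowerSeries.coeff (n - i) g := by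
    rw [← hyg, PowerSeries.coeff_mul, Finset.Nat.sum_antidiagonal_eq_sum_range_succ
      (fun i j => PowerSeries.coeff i y * PowerSeries.coeff j g)]
  have hrn : 0 < r ^ n := by positivity
  have : ‖PowerSeries.coeff n h‖ < M / r ^ n := by
    rw [e]
    apply cv_sum_lt _ _ _ (by positivity)
    intro i hi
    have hi' := Finset.mem_range.1 hi
    rw [lt_div_iff₀ hrn, norm_mul]
    rcases Nat.lt_or_ge i n with hin | hin
    · have e2 : r ^ n = r ^ i * r ^ (n - i) := by rw [← pow_add]; congr 1; omega
      rcases eq_or_ne (PowerSeries.coeff i y) 0 with h0 | h0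
      · simp [h0, hM]
      have h0' := norm_pos_iff.2 h0
      calc ‖PowerSeries.coeff i y‖ * ‖PowerSeries.coeff (n - i) g‖ * r ^ n
          = (‖PowerSeries.coeff i y‖ * r ^ i) * (‖PowerSeries.coeff (n - i) g‖ * r ^ (n - i)) := by
            rw [e2]; ring
        _ < (‖PowerSeries.coeff i y‖ * r ^ i) * ‖PowerSeries.coeff 0 g‖ := by
            have := hgs (n - i) (by omega)
            gcongr
        _ ≤ M := hb i
    · have : i = n := by omega
      subst this
      simp only [Nat.sub_self]
      linarith
  rw [lt_div_iff₀ hrn, hn] at this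
  exact lt_irrefl _ this

lemma cv_rolle {K : Type*} [NormedField K] [IsUltrametricDist K] [IsAlgClosed K] (f g : K[X])
    (σ r : ℝ) (hr : 0 < r) (hrσ : r < σ) (hf0 : f.coeff 0 = 0) (hf1 : f.coeff 1 ≠ 0)
    (hg : ∀ z, g.eval z = 0 → σ ≤ ‖z‖)
    (hW : ∀ z, (derivative f * g - f * derivative g).eval z = 0 → σ ≤ ‖z‖)
    (hfr : ∀ z, z ≠ 0 → f.eval z = 0 → r ≤ ‖z‖) (w : K) (hw : f.eval w = 0) (hwr : ‖w‖ = r) :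
    ∃ n, 2 ≤ n ∧ n ≤ f.natDegree ∧ ‖(n : K)‖ * σ ^ (n - 1) ≤ r ^ (n - 1) := by
  have hσ : 0 < σ := hr.trans hrσ
  have hg0 : g.coeff 0 ≠ 0 := by
    intro h
    rw [coeff_zero_eq_eval_zero] at h
    have := hg 0 h
    simp at this
    linarith
  have hg0' : 0 < ‖g.coeff 0‖ := norm_pos_iff.2 hg0
  have hf1' : 0 < ‖f.coeff 1‖ := norm_pos_iff.2 hf1
  have hgk := cv_noroots g σ hσ hg
  have hgr := cv_noroots g r hr (fun z hz => hrσ.le.trans (hg z hz))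
  have hgs : ∀ k, 1 ≤ k → ‖g.coeff k‖ * r ^ k < ‖g.coeff 0‖ := by
    intro k hk
    rcases eq_or_ne (g.coeff k) 0 with h | h
    · simp [h, hg0]
    · have := norm_pos_iff.2 h
      calc ‖g.coeff k‖ * r ^ k < ‖g.coeff k‖ * σ ^ k := by
            have : r ^ k < σ ^ k := pow_lt_pow_left₀ hrσ hr.le (by omega)
            gcongr
        _ ≤ _ := hgk k
  have hWk := cv_noroots _ σ hσ hW
  obtain ⟨h, rfl⟩ : ∃ h, f = X * h := by
    obtain ⟨h, hh⟩ := X_dvd_iff.2 hf0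
    exact ⟨h, hh⟩
  have hh0 : h.coeff 0 ≠ 0 := by simpa using hf1
  have hhk := cv_noroots h r hr (by
    intro z hz
    apply hfr z
    · rintro rfl
      rw [← coeff_zero_eq_eval_zero] at hz
      exact hh0 hz
    · simp [hz])
  have hw0 : w ≠ 0 := by
    rintro rfl
    simp at hwr
    linarith
  have hhw : h.eval w = 0 := by
    simpa [hw0] using hw
  obtain ⟨k, hk1, hk⟩ : ∃ k, 1 ≤ k ∧ ‖h.coeff k‖ * r ^ k = ‖h.coeff 0‖ := by
    by_contra hc
    push Not at hc
    have hlt : ∀ k, 1 ≤ k → ‖h.coeff k‖ * r ^ k < ‖h.coeff 0‖ := fun k hk =>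
      lt_of_le_of_ne (hhk k) (hc k hk)
    rw [eval_eq_sum_range, Finset.sum_range_succ'] at hhw
    have h2 := cv_sum_lt (Finset.range h.natDegree) (fun i => h.coeff (i + 1) * w ^ (i + 1))
      ‖h.coeff 0‖ (norm_pos_iff.2 hh0) (by
        intro i _
        rw [norm_mul, norm_pow, hwr]
        exact hlt _ (by omega))
    have h3 : ∑ i ∈ Finset.range h.natDegree, h.coeff (i + 1) * w ^ (i + 1) = - h.coeff 0 := by
      rw [eq_neg_iff_add_eq_zero]
      simpa using hhw
    rw [h3, norm_neg] at h2
    exact lt_irrefl _ h2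
  have hhne : h ≠ 0 := by rintro rfl; simp at hh0
  have hkc : h.coeff k ≠ 0 := by
    intro h0
    rw [h0] at hk
    simp at hk
    exact hh0 (norm_eq_zero.1 hk.symm)
  -- the power series
  set fs : PowerSeries K := ((X * h : K[X]) : PowerSeries K) with hfs
  set gs : PowerSeries K := (g : PowerSeries K) with hgs'
  set q : PowerSeries K := fs * gs⁻¹ with hq
  have hqg : q * gs = fs := by
    rw [hq, mul_assoc, PowerSeries.inv_mul_cancel, mul_one]
    rw [hgs', Polynomial.constantCoeff_coe]
    exact hg0
  have hder : PowerSeries.derivative K q * gs * gs =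
      ((derivative (X * h) * g - X * h * derivative g : K[X]) : PowerSeries K) := by
    have h1 : PowerSeries.derivative K (q * gs) = PowerSeries.derivative K fs := by rw [hqg]
    rw [Derivation.leibniz, hgs', hfs, PowerSeries.derivative_coe, PowerSeries.derivative_coe,
      smul_eq_mul, smul_eq_mul, ← hgs'] at h1
    rw [Polynomial.coe_sub, Polynomial.coe_mul, Polynomial.coe_mul, ← h1, ← hfs, ← hqg, ← hgs']
    ring
  have c0 : PowerSeries.coeff 0 gs = g.coeff 0 := by rw [hgs', Polynomial.coeff_coe]
  set A := ‖(X * h).coeff 1‖ with hA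
  have hA' : A = ‖h.coeff 0‖ := by rw [hA]; simp
  have hlow := cv_divlower q gs fs r (A * r) hr (by positivity) hqg (by rw [c0]; exact hg0)
    (by intro k; rw [hgs', Polynomial.coeff_coe, Polynomial.coeff_coe]; exact hgr k)
    (by intro k; rw [hgs', Polynomial.coeff_coe, Polynomial.coeff_coe]; exact hgs k)
    (by
      intro k
      rw [hfs, Polynomial.coeff_coe, hA']
      rcases k with _ | k
      · simp; positivity
      · rw [coeff_X_mul, pow_succ, ← mul_assoc]
        gcongr
        exact hhk k) (k + 1) (by
      rw [hfs, Polynomial.coeff_coe, coeff_X_mul, pow_succ, ← mul_assoc, hk, hA'])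
  have hW0 : ‖(derivative (X * h) * g - X * h * derivative g).coeff 0‖ = A * ‖g.coeff 0‖ := by
    rw [hA', ← norm_mul]
    congr 1
    simp [mul_coeff_zero]
  rw [hW0] at hWk
  have hb1 := cv_divbound (PowerSeries.derivative K q * gs) gs _ σ (A * ‖g.coeff 0‖) hσ hder
    (by rw [c0]; exact hg0)
    (by intro k; rw [hgs', Polynomial.coeff_coe, Polynomial.coeff_coe]; exact hgk k)
    (by intro k; rw [Polynomial.coeff_coe]; exact hWk k)
  have hb2 := cv_divbound (PowerSeries.derivative K q) gs _ σ A hσ rfl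
    (by rw [c0]; exact hg0)
    (by intro k; rw [hgs', Polynomial.coeff_coe, Polynomial.coeff_coe]; exact hgk k)
    (by
      intro k
      have := hb1 k
      rw [c0] at this
      exact le_of_mul_le_mul_right this hg0') k
  rw [c0] at hlow hb2
  rw [PowerSeries.coeff_derivative, norm_mul] at hb2
  refine ⟨k + 1, by omega, ?_, ?_⟩
  · rw [natDegree_X_mul hhne]
    have := le_natDegree_of_ne_zero hkc
    omega
  · simp only [Nat.add_sub_cancel]
    push_cast
    have hlow' : A ≤ ‖PowerSeries.coeff (k + 1) q‖ * r ^ k * ‖g.coeff 0‖ := by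
      rw [pow_succ] at hlow
      apply le_of_mul_le_mul_right _ hr
      linarith
    have hAp : 0 < A := hf1'
    have hqp : 0 < ‖PowerSeries.coeff (k + 1) q‖ := by
      rcases (norm_nonneg (PowerSeries.coeff (k + 1) q)).eq_or_lt with h0 | h0
      · rw [← h0] at hlow'; simp at hlow'; linarith
      · exact h0
    have hpos : 0 < ‖PowerSeries.coeff (k + 1) q‖ * ‖g.coeff 0‖ := by positivity
    apply le_of_mul_le_mul_right _ hpos
    linarith

lemma cv_reflect_eval {K : Type*} [Field K] (f : K[X]) (d : ℕ) (hf : f.natDegree ≤ d) (u : K)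
    (hu : u ≠ 0) : (reflect d f).eval u = u ^ d * f.eval u⁻¹ := by
  let _ := invertibleOfNonzero (inv_ne_zero hu)
  have h := eval₂_reflect_mul_pow (RingHom.id K) u⁻¹ d f hf
  rw [invOf_eq_inv, inv_inv] at h
  change (reflect d f).eval u * _ = f.eval u⁻¹ at h
  rw [← h, inv_pow]
  field_simp

lemma cv_reflect_deriv {K : Type*} [Field K] (f : K[X]) (d : ℕ) (hf : f.natDegree ≤ d) (u : K)
    (hu : u ≠ 0) : u * (derivative (reflect d f)).eval u =
      d * u ^ d * f.eval u⁻¹ - u ^ d * (u⁻¹ * (derivative f).eval u⁻¹) := by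
  have key : ∀ (n : ℕ) (x : K), x * ((n : K) * x ^ (n - 1)) = n * x ^ n := by
    intro n x
    rcases n with _ | n
    · simp
    · simp only [Nat.add_sub_cancel]; ring
  refine induction_with_natDegree_le (fun f => u * (derivative (reflect d f)).eval u =
      d * u ^ d * f.eval u⁻¹ - u ^ d * (u⁻¹ * (derivative f).eval u⁻¹)) d ?_ ?_ ?_ f hf
  · simp
  · intro k a ha hk
    rw [reflect_C_mul_X_pow, revAt_le hk, derivative_C_mul_X_pow, derivative_C_mul_X_pow]
    simp only [eval_mul, eval_C, eval_pow, eval_X]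
    have h1 := key (d - k) u
    have h2 := key k u⁻¹
    have e1 : u * (a * ((d - k : ℕ) : K) * u ^ (d - k - 1)) = a * (((d - k : ℕ) : K) * u ^ (d - k)) := by
      rw [← h1]; ring
    have e2 : u⁻¹ * (a * (k : K) * u⁻¹ ^ (k - 1)) = a * ((k : K) * u⁻¹ ^ k) := by
      rw [← h2]; ring
    have e3 : u ^ (d - k) = u ^ d * u⁻¹ ^ k := by
      rw [inv_pow, ← pow_sub₀ u hu hk]
    rw [e1, e2, e3, Nat.cast_sub hk]
    ring
  · intro p q _ _ hp hq
    simp only [reflect_add, derivative_add, eval_add, mul_add] at *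
    rw [hp, hq]; ring

lemma cv_reflect_wron {K : Type*} [Field K] (f g : K[X]) (d : ℕ) (hf : f.natDegree ≤ d)
    (hg : g.natDegree ≤ d) (u : K) (hu : u ≠ 0) :
    (derivative (reflect d f) * reflect d g - reflect d f * derivative (reflect d g)).eval u = 0 ↔
    (derivative f * g - f * derivative g).eval u⁻¹ = 0 := by
  have h1 := cv_reflect_deriv f d hf u hu
  have h2 := cv_reflect_deriv g d hg u hu
  have h3 := cv_reflect_eval f d hf u hu
  have h4 := cv_reflect_eval g d hg u hu
  simp only [eval_sub, eval_mul]
  have : u * ((derivative (reflect d f)).eval u * (reflect d g).eval u -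
      (reflect d f).eval u * (derivative (reflect d g)).eval u) =
      -(u ^ d * u ^ d * u⁻¹) * ((derivative f).eval u⁻¹ * g.eval u⁻¹ -
        f.eval u⁻¹ * (derivative g).eval u⁻¹) := by
    rw [h3, h4]
    linear_combination (u ^ d * g.eval u⁻¹) * h1 - (u ^ d * f.eval u⁻¹) * h2
  constructor
  · intro h
    rw [h, mul_zero] at this
    rcases mul_eq_zero.1 this.symm with h5 | h5
    · simp [hu] at h5
    · exact h5
  · intro h
    rw [h, mul_zero] at this
    rcases mul_eq_zero.1 this with h5 | h5
    · exact absurd h5 hu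
    · exact h5

lemma cv_main0 {K : Type*} [NormedField K] [IsUltrametricDist K] [IsAlgClosed K] (f g : K[X])
    (d : ℕ) (hd : 2 ≤ d) (hlam : 0 < lam K d) (hfd : f.natDegree = d) (hgd : g.natDegree < d)
    (hcop : ∀ x, g.eval x = 0 → f.eval x ≠ 0) (hf0 : f.coeff 0 = 0) (hf1 : f.coeff 1 ≠ 0)
    (hg0 : g.coeff 0 ≠ 0) (r : ℝ) (hr : 0 < r)
    (hmin : ∀ z, (g.eval z = 0 ∨ (z ≠ 0 ∧ f.eval z = 0)) → r ≤ ‖z‖)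
    (hat : ∃ z, (g.eval z = 0 ∨ (z ≠ 0 ∧ f.eval z = 0)) ∧ ‖z‖ = r) :
    ∃ c, g.eval c ≠ 0 ∧ (derivative f * g - f * derivative g).eval c = 0 ∧
      ‖f.eval c / g.eval c‖ ≤ gam K d * (lam K d)⁻¹ * (‖f.coeff 1‖ / ‖g.coeff 0‖) * r := by
  classical
  obtain ⟨hγ1, hγ⟩ := cv_gam (K := K) d hd hlam
  have hdf : f.natDegree ≤ d := hfd.le
  have hdg : g.natDegree ≤ d := hgd.le
  have hfne : f.coeff d ≠ 0 := by
    rw [← hfd]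
    have : f ≠ 0 := by rintro rfl; simp at hf1
    simpa using this
  set F := reflect d f with hF
  set G := reflect d g with hG
  set V := derivative F * G - F * derivative G with hV
  have cF : ∀ i, i ≤ d → F.coeff i = f.coeff (d - i) := by
    intro i hi; rw [hF, coeff_reflect, revAt_le hi]
  have cG : ∀ i, i ≤ d → G.coeff i = g.coeff (d - i) := by
    intro i hi; rw [hG, coeff_reflect, revAt_le hi]
  have cF' : ∀ i, d < i → F.coeff i = 0 := by
    intro i hi
    rw [hF, coeff_reflect, revAt_eq_self_of_lt hi]
    exact coeff_eq_zero_of_natDegree_lt (by omega)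
  have cG' : ∀ i, d < i → G.coeff i = 0 := by
    intro i hi
    rw [hG, coeff_reflect, revAt_eq_self_of_lt hi]
    exact coeff_eq_zero_of_natDegree_lt (by omega)
  have lF : F.coeff (d - 1) = f.coeff 1 := by
    rw [cF _ (by omega)]; congr 1; omega
  have lG : G.coeff d = g.coeff 0 := by
    rw [cG _ le_rfl]; congr 1; omega
  have nF : F.natDegree = d - 1 := by
    apply natDegree_eq_of_le_of_coeff_ne_zero
    · rw [natDegree_le_iff_coeff_eq_zero]
      intro i hi
      rcases Nat.lt_or_ge d i with h | h
      · exact cF' i h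
      · rw [cF i h]
        have : d - i = 0 := by omega
        rw [this, hf0]
    · rw [lF]; exact hf1
  have nG : G.natDegree = d := by
    apply natDegree_eq_of_le_of_coeff_ne_zero
    · rw [natDegree_le_iff_coeff_eq_zero]
      exact fun i hi => cG' i hi
    · rw [lG]; exact hg0
  have G0 : G.eval 0 = 0 := by
    rw [← coeff_zero_eq_eval_zero, cG 0 (by omega)]
    exact coeff_eq_zero_of_natDegree_lt (by omega)
  have F0 : F.eval 0 ≠ 0 := by
    rw [← coeff_zero_eq_eval_zero, cF 0 (by omega)]
    exact hfne
  obtain ⟨hV1, hV2⟩ := cv_wron F G (d - 1) d nF.le nG.le (by omega)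
  rw [← hV] at hV1 hV2
  have hVc : V.coeff (d - 1 + d - 1) = -(f.coeff 1 * g.coeff 0) := by
    rw [hV2, lF, lG, Nat.cast_sub (by omega)]
    push_cast; ring
  have hVne : V.coeff (d - 1 + d - 1) ≠ 0 := by
    rw [hVc]; exact neg_ne_zero.2 (mul_ne_zero hf1 hg0)
  have nV : V.natDegree = d - 1 + d - 1 := natDegree_eq_of_le_of_coeff_ne_zero hV1 hVne
  have V0 : V ≠ 0 := by intro h; rw [h] at hVne; simp at hVne
  have Gne : G ≠ 0 := by intro h; rw [h] at lG; simp at lG; exact hg0 lG.symm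
  have eF : F = C (f.coeff 1) * cvP F.roots := by
    have := cv_splitP F
    rwa [leadingCoeff, nF, lF] at this
  have eG : G = C (g.coeff 0) * cvP G.roots := by
    have := cv_splitP G
    rwa [leadingCoeff, nG, lG] at this
  have eV : V = C (-(f.coeff 1 * g.coeff 0)) * cvP V.roots := by
    have := cv_splitP V
    rwa [leadingCoeff, nV, hVc] at this
  have kF : F.roots.card = F.natDegree := (splits_iff_card_roots.1 (IsAlgClosed.splits F))
  have kG : G.roots.card = G.natDegree := (splits_iff_card_roots.1 (IsAlgClosed.splits G))
  have kV : V.roots.card = V.natDegree := (splits_iff_card_roots.1 (IsAlgClosed.splits V))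
  have hWr : derivative (cvP F.roots) * cvP G.roots - cvP F.roots * derivative (cvP G.roots) =
      C (-1) * cvP V.roots := by
    have hne : (C (f.coeff 1 * g.coeff 0) : K[X]) ≠ 0 := by
      rw [Ne, C_eq_zero]; exact mul_ne_zero hf1 hg0
    apply mul_left_cancel₀ hne
    calc C (f.coeff 1 * g.coeff 0) * (derivative (cvP F.roots) * cvP G.roots -
          cvP F.roots * derivative (cvP G.roots))
        = derivative (C (f.coeff 1) * cvP F.roots) * (C (g.coeff 0) * cvP G.roots) -
          (C (f.coeff 1) * cvP F.roots) * derivative (C (g.coeff 0) * cvP G.roots) := by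
          rw [derivative_C_mul, derivative_C_mul, C_mul]; ring
      _ = V := by rw [← eF, ← eG]
      _ = C (-(f.coeff 1 * g.coeff 0)) * cvP V.roots := eV
      _ = _ := by rw [C_neg, C_neg, C_1]; ring
  have h0G : (0 : K) ∈ G.roots := (mem_roots Gne).2 G0
  obtain ⟨u0, hu0, hu0max⟩ := Finset.exists_max_image (G.roots + V.roots).toFinset (fun x => ‖x‖)
    ⟨0, by simp [Gne, G0]⟩
  rw [Multiset.mem_toFinset] at hu0
  have hmax : ∀ x ∈ G.roots + V.roots, ‖x‖ ≤ ‖u0‖ := fun x hx =>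
    hu0max x (Multiset.mem_toFinset.2 hx)
  have hGinv : ∀ z, z ≠ 0 → g.eval z = 0 → ‖z⁻¹‖ ≤ ‖u0‖ := by
    intro z hz hgz
    apply hmax
    apply Multiset.mem_add.2 (Or.inl ((mem_roots Gne).2 _))
    change G.eval _ = 0
    rw [hG, cv_reflect_eval g d hdg _ (inv_ne_zero hz), inv_inv, hgz, mul_zero]
  have hVinv : ∀ z, z ≠ 0 → (derivative f * g - f * derivative g).eval z = 0 →
      ‖z⁻¹‖ ≤ ‖u0‖ := by
    intro z hz hgz
    apply hmax
    apply Multiset.mem_add.2 (Or.inr ((mem_roots V0).2 _))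
    change V.eval _ = 0
    rw [hV, hF, hG, cv_reflect_wron f g d hdf hdg _ (inv_ne_zero hz), inv_inv, hgz]
  have hg0e : g.eval 0 ≠ 0 := by rwa [← coeff_zero_eq_eval_zero]
  have hW0 : (derivative f * g - f * derivative g).eval 0 ≠ 0 := by
    rw [← coeff_zero_eq_eval_zero]
    simp [mul_coeff_zero, coeff_derivative, hf0, hf1, hg0]
  have hkey : 1 ≤ gam K d * r * ‖u0‖ := by
    obtain ⟨z, hz, hzr⟩ := hat
    have hz0 : z ≠ 0 := by rintro rfl; simp at hzr; linarith
    rcases hz with hz | ⟨_, hz⟩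
    · have h := hGinv z hz0 hz
      rw [norm_inv, hzr, inv_le_iff_one_le_mul₀ hr] at h
      nlinarith
    · by_contra hc
      push Not at hc
      have hρ0 : 0 ≤ ‖u0‖ := norm_nonneg _
      obtain ⟨σ, hσ1, hσ2⟩ : ∃ σ, gam K d * r < σ ∧ σ * ‖u0‖ ≤ 1 := by
        rcases hρ0.eq_or_lt with h | h
        · exact ⟨gam K d * r + 1, by linarith, by rw [← h]; simp⟩
        · exact ⟨‖u0‖⁻¹, by rw [← one_div, lt_div_iff₀ h]; exact hc, by rw [inv_mul_cancel₀ h.ne']⟩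
      have hγr : 0 < gam K d * r := by nlinarith
      have hσ0 : 0 < σ := hγr.trans hσ1
      have hto : ∀ z : K, z ≠ 0 → ‖z⁻¹‖ ≤ ‖u0‖ → σ ≤ ‖z‖ := by
        intro z hz hzu
        have hzp := norm_pos_iff.2 hz
        rw [norm_inv] at hzu
        have : σ * ‖z‖⁻¹ ≤ 1 := (mul_le_mul_of_nonneg_left hzu hσ0.le).trans hσ2
        rwa [mul_inv_le_iff₀ hzp, one_mul] at this
      obtain ⟨n, hn2, hnd, hn⟩ := cv_rolle f g σ r hr (by nlinarith) hf0 hf1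
        (fun z hz => by
          have hz0 : z ≠ 0 := by rintro rfl; exact hg0e hz
          exact hto z hz0 (hGinv z hz0 hz))
        (fun z hz => by
          have hz0 : z ≠ 0 := by rintro rfl; exact hW0 hz
          exact hto z hz0 (hVinv z hz0 hz))
        (fun z hz0 hz => hmin z (Or.inr ⟨hz0, hz⟩)) z hz hzr
      have h1 := hγ n (by omega) (by omega)
      have hnp : 0 < ‖(n : K)‖ := lt_of_lt_of_le hlam (cv_lam_le d n (by omega) (by omega))
      have h2 : (gam K d * r) ^ (n - 1) < σ ^ (n - 1) :=
        pow_lt_pow_left₀ hσ1 hγr.le (by omega)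
      rw [mul_pow] at h2
      have h3 := mul_lt_mul_of_pos_left h2 hnp
      have h4 : r ^ (n - 1) ≤ (‖(n : K)‖ * gam K d ^ (n - 1)) * r ^ (n - 1) :=
        le_mul_of_one_le_left (by positivity) h1
      linarith
  have hγp : 0 < gam K d := by linarith
  have hρ : 0 < ‖u0‖ := by
    rcases (norm_nonneg u0).eq_or_lt with h | h
    · rw [← h] at hkey; simp at hkey; linarith
    · exact h
  obtain ⟨c, hcV, hcG, hc⟩ := cv_inverted F.roots G.roots V.roots d (-1) (by simp)
    (by omega) (by omega) (by omega) hWr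
    (by
      intro x hx
      have hGx : G.eval x = 0 := (mem_roots Gne).1 hx
      intro hax
      have hFx : F.eval x = 0 := by rw [eF, eval_mul, hax, mul_zero]
      rcases eq_or_ne x 0 with rfl | hx0
      · exact F0 hFx
      · rw [hG, cv_reflect_eval g d hdg x hx0] at hGx
        rw [hF, cv_reflect_eval f d hdf x hx0] at hFx
        have hxd := pow_ne_zero d hx0
        exact hcop _ ((mul_eq_zero.1 hGx).resolve_left hxd) ((mul_eq_zero.1 hFx).resolve_left hxd))
    ‖u0‖ hρ (fun x hx => hmax x (Multiset.mem_add.2 (Or.inl hx)))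
    (fun x hx => hmax x (Multiset.mem_add.2 (Or.inr hx))) h0G u0 hu0 rfl (lam K d) hlam
    (fun m h1 h2 => cv_lam_le d m h1 h2)
  have hc0 : c ≠ 0 := by rintro rfl; exact hcG h0G
  have hcd := pow_ne_zero d hc0
  have hGc : G.eval c ≠ 0 := fun h => hcG ((mem_roots Gne).2 h)
  have hVc0 : V.eval c = 0 := (mem_roots V0).1 hcV
  have rG := cv_reflect_eval g d hdg c hc0
  have rF := cv_reflect_eval f d hdf c hc0
  rw [← hG] at rG
  rw [← hF] at rF
  have hgc : g.eval c⁻¹ ≠ 0 := by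
    intro h; rw [h, mul_zero] at rG; exact hGc rG
  refine ⟨c⁻¹, hgc, (cv_reflect_wron f g d hdf hdg c hc0).1 hVc0, ?_⟩
  have e1 : f.eval c⁻¹ / g.eval c⁻¹ = F.eval c / G.eval c := by
    rw [rF, rG, mul_div_mul_left _ _ hcd]
  have hGce : G.eval c = g.coeff 0 * (cvP G.roots).eval c := by
    conv_lhs => rw [eG, eval_mul, eval_C]
  have hFce : F.eval c = f.coeff 1 * (cvP F.roots).eval c := by
    conv_lhs => rw [eF, eval_mul, eval_C]
  have hPG : (cvP G.roots).eval c ≠ 0 := by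
    intro h; rw [h, mul_zero] at hGce; exact hGc hGce
  rw [e1, hFce, hGce, norm_div, norm_mul, norm_mul]
  have hPG' := norm_pos_iff.2 hPG
  have hg0' := norm_pos_iff.2 hg0
  have h5 : ‖(cvP F.roots).eval c‖ / ‖(cvP G.roots).eval c‖ ≤ gam K d * (lam K d)⁻¹ * r := by
    rw [div_le_iff₀ hPG']
    have h6 : ‖(cvP F.roots).eval c‖ ≤ gam K d * r * ‖u0‖ * ‖(cvP F.roots).eval c‖ :=
      le_mul_of_one_le_left (norm_nonneg _) hkey
    have h7 : gam K d * r * (lam K d)⁻¹ * (lam K d * ‖(cvP F.roots).eval c‖ * ‖u0‖) ≤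
        gam K d * r * (lam K d)⁻¹ * ‖(cvP G.roots).eval c‖ := by
      gcongr
    have h8 : gam K d * r * (lam K d)⁻¹ * (lam K d * ‖(cvP F.roots).eval c‖ * ‖u0‖) =
      gam K d * r * ‖u0‖ * ‖(cvP F.roots).eval c‖ := by
      field_simp
    linarith
  calc ‖f.coeff 1‖ * ‖(cvP F.roots).eval c‖ / (‖g.coeff 0‖ * ‖(cvP G.roots).eval c‖)
      = (‖f.coeff 1‖ / ‖g.coeff 0‖) * (‖(cvP F.roots).eval c‖ / ‖(cvP G.roots).eval c‖) := by
        rw [mul_div_mul_comm]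
    _ ≤ (‖f.coeff 1‖ / ‖g.coeff 0‖) * (gam K d * (lam K d)⁻¹ * r) := by gcongr
    _ = _ := by ring

theorem critical_value_location_prepole
    {K : Type*} [NontriviallyNormedField K] [IsAlgClosed K]
    [CompleteSpace K] [IsUltrametricDist K]
    (d : ℕ) (hd : 2 ≤ d) (hlam : 0 < lam K d)
    (f g : Polynomial K) (hcop : IsCoprime f g)
    (hdegf : f.natDegree = d) (hdegfg : g.natDegree < f.natDegree)
    (z0 : K) (hz0 : g.eval z0 ≠ 0)
    (rb : ℝ)
    (hrb : IsLeast {t : ℝ | ∃ w : K,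
      (g.eval w = 0 ∨
        (g.eval w ≠ 0 ∧ f.eval w / g.eval w = f.eval z0 / g.eval z0 ∧ w ≠ z0)) ∧
      t = ‖w - z0‖} rb) :
    ∃ c : K, g.eval c ≠ 0 ∧ (f.derivative * g - f * g.derivative).eval c = 0 ∧
      ‖f.eval c / g.eval c - f.eval z0 / g.eval z0‖ ≤
        gam K d * (lam K d)⁻¹ *
          (‖(f.derivative * g - f * g.derivative).eval z0‖ / ‖g.eval z0‖ ^ 2) * rb := by
  set q0 := f.eval z0 / g.eval z0 with hq0
  obtain ⟨hγ1, -⟩ := cv_gam (K := K) d hd hlam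
  have hγ0 : 0 ≤ gam K d := by linarith
  obtain ⟨⟨w, hw, hwr⟩, hleast⟩ := hrb
  have hrb0 : 0 ≤ rb := by rw [hwr]; exact norm_nonneg _
  by_cases hW : (f.derivative * g - f * g.derivative).eval z0 = 0
  · refine ⟨z0, hz0, hW, ?_⟩
    rw [← hq0, sub_self, norm_zero]
    positivity
  have hwz : w ≠ z0 := by
    rintro rfl
    rcases hw with h | h
    · exact hz0 h
    · exact h.2.2 rfl
  have hr : 0 < rb := by
    rw [hwr]; exact norm_pos_iff.2 (sub_ne_zero.2 hwz)
  set f0 := f - C q0 * g with hf0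
  have hq : f.eval z0 = q0 * g.eval z0 := by rw [hq0, div_mul_cancel₀ _ hz0]
  have hcg : ∀ x, g.eval x = 0 → f.eval x ≠ 0 := by
    intro x h1 h2
    obtain ⟨a, b, hab⟩ := hcop
    have := congrArg (eval x) hab
    simp [h1, h2] at this
  have hf0e : ∀ x, f0.eval x = f.eval x - q0 * g.eval x := by
    intro x; rw [hf0]; simp
  have hf0d : f0.natDegree = d := by
    rw [hf0, natDegree_sub_eq_left_of_natDegree_lt, hdegf]
    exact lt_of_le_of_lt (natDegree_C_mul_le _ _) hdegfg
  have hWW : derivative f0 * g - f0 * derivative g =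
      derivative f * g - f * derivative g := by
    rw [hf0, derivative_sub, derivative_C_mul]; ring
  clear_value f0
  have hWt : derivative (taylor z0 f0) * taylor z0 g - taylor z0 f0 * derivative (taylor z0 g) =
      taylor z0 (derivative f * g - f * derivative g) := by
    rw [← hWW, cv_deriv_taylor, cv_deriv_taylor, (taylor z0).map_sub, taylor_mul, taylor_mul]
  have hc0 : (taylor z0 f0).coeff 0 = 0 := by
    rw [taylor_coeff_zero, hf0e, hq, sub_self]
  have hg0 : (taylor z0 g).coeff 0 = g.eval z0 := taylor_coeff_zero _ _
  have hW0 : (f.derivative * g - f * g.derivative).eval z0 =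
      (taylor z0 f0).coeff 1 * g.eval z0 := by
    rw [← taylor_coeff_zero, ← hWt, ← hg0]
    simp only [coeff_sub, mul_coeff_zero, coeff_derivative, hc0]
    simp
  have hset : ∀ z : K, ((taylor z0 g).eval z = 0 ∨ (z ≠ 0 ∧ (taylor z0 f0).eval z = 0)) →
      rb ≤ ‖z‖ := by
    intro z hz
    apply hleast
    refine ⟨z + z0, ?_, by simp⟩
    rw [taylor_eval, taylor_eval, hf0e] at hz
    by_cases hgz : g.eval (z + z0) = 0
    · exact Or.inl hgz
    · right
      obtain ⟨h1, h2⟩ := hz.resolve_left hgz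
      refine ⟨hgz, ?_, by simpa using h1⟩
      rw [div_eq_iff hgz]
      exact sub_eq_zero.1 h2
  obtain ⟨c, h1, h2, h3⟩ := cv_main0 (taylor z0 f0) (taylor z0 g) d hd hlam
    (by rw [natDegree_taylor, hf0d]) (by rw [natDegree_taylor, ← hdegf]; exact hdegfg)
    (by
      intro x hx
      rw [taylor_eval] at hx ⊢
      rw [hf0e, hx, mul_zero, sub_zero]
      exact hcg _ hx)
    hc0 (by intro h; rw [h, zero_mul] at hW0; exact hW hW0) (by rw [hg0]; exact hz0) rb hr hset
    (by
      refine ⟨w - z0, ?_, hwr.symm⟩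
      rw [taylor_eval, taylor_eval, sub_add_cancel, hf0e]
      rcases hw with h | ⟨h, h', _⟩
      · exact Or.inl h
      · right
        refine ⟨sub_ne_zero.2 hwz, ?_⟩
        rw [sub_eq_zero]
        exact (div_eq_iff h).1 h')
  rw [taylor_eval] at h1
  rw [hWt, taylor_eval] at h2
  refine ⟨c + z0, h1, h2, ?_⟩
  rw [taylor_eval, taylor_eval, hf0e, hg0] at h3
  have e1 : f.eval (c + z0) / g.eval (c + z0) - q0 =
      (f.eval (c + z0) - q0 * g.eval (c + z0)) / g.eval (c + z0) := by
    rw [sub_div, mul_div_cancel_right₀ _ h1]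
  have e2 : ‖(f.derivative * g - f * g.derivative).eval z0‖ / ‖g.eval z0‖ ^ 2 =
      ‖(taylor z0 f0).coeff 1‖ / ‖g.eval z0‖ := by
    have := norm_pos_iff.2 hz0
    rw [hW0, norm_mul]
    field_simp
  rw [e1, e2]
  exact h3
end

section
/- (Theorem D) Let d ≥ 2 be an integer with λ(d) > 0, and let Q = f/g be a rational map over K of degree d that is not a polynomial (deg g ≥ 1) and satisfies Q(∞) = ∞ (deg f > deg g). Let z0 ∈ K with g(z0) ≠ 0 and Q'(z0) ≠ 0, and let r := min{|π − z0| : π ∈ K, g(π) = 0}. Then Q has a finite critical value v, i.e. v = Q(c) for some c ∈ K with g(c) ≠ 0 and (f′g − fg′)(c) = 0, satisfying 0 < |v − Q(z0)| ≤ λ(d)^{−(d−1)}·|Q'(z0)|·r. -/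
/-!
STATEMENT 6 (Theorem D): Let `d ≥ 2` with `lam K d > 0` and let `Q = f/g` be a rational
map over `K` of degree `d`, not a polynomial (`deg g ≥ 1`), with `Q(∞) = ∞`
(`deg f = d > deg g`).  Let `z0 ∈ K` with `g(z0) ≠ 0` and `Q'(z0) ≠ 0`, and let `r` be
the shortest distance from `z0` to a pole of `Q`.  Then `Q` has a finite critical value
`v = Q(c)` with `0 < ‖v − Q(z0)‖ ≤ lam K d ^ (−(d−1)) · ‖Q'(z0)‖ · r`.
-/

open Polynomial Filter

set_option linter.unusedSectionVars false
set_option linter.unusedVariables false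

section core
variable {K : Type*} [NontriviallyNormedField K] [IsUltrametricDist K]

noncomputable def gn (T : Finset K) (u : K → ℤ) (x : K) (s : ℝ) : ℝ :=
  ∏ y ∈ T, (max s ‖y - x‖) ^ (u y)

lemma gn_pos (T : Finset K) (u : K → ℤ) (x : K) {s : ℝ} (hs : 0 < s) : 0 < gn T u x s :=
  Finset.prod_pos fun y _ => zpow_pos (lt_max_of_lt_left hs) _

lemma gn_shrink (T : Finset K) (u : K → ℤ) (x : K) {s s' : ℝ} (hs' : 0 < s') (hss : s' ≤ s)
    (h : ∀ y ∈ T, ‖y - x‖ < s → ‖y - x‖ ≤ s') :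
    gn T u x s' = gn T u x s * (s' / s) ^ (∑ y ∈ T with ‖y - x‖ < s, u y) := by
  classical
  have hs : 0 < s := hs'.trans_le hss
  have hr : s' / s ≠ 0 := (div_pos hs' hs).ne'
  have e : (s' / s) ^ (∑ y ∈ T with ‖y - x‖ < s, u y)
      = ∏ y ∈ T, if ‖y - x‖ < s then (s' / s) ^ (u y) else 1 := by
    rw [← Finset.prod_filter]
    induction (T.filter fun y => ‖y - x‖ < s) using Finset.induction_on with
    | empty => simp
    | insert a t ha ih => rw [Finset.sum_insert ha, Finset.prod_insert ha, zpow_add₀ hr, ih]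
  rw [e, gn, gn, ← Finset.prod_mul_distrib]
  refine Finset.prod_congr rfl fun y hy => ?_
  split_ifs with hlt
  · rw [max_eq_left (h y hy hlt), max_eq_left hlt.le, ← mul_zpow, mul_div_cancel₀ _ hs.ne']
  · push Not at hlt
    rw [max_eq_right hlt, max_eq_right (hss.trans hlt), mul_one]

lemma nsub (a b c : K) : ‖a - c‖ ≤ max ‖a - b‖ ‖b - c‖ := by
  have := IsUltrametricDist.norm_add_le_max (a - b) (b - c)
  simpa using this

lemma gn_center (T : Finset K) (u : K → ℤ) {x x' : K} {s : ℝ} (h : ‖x - x'‖ ≤ s) :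
    gn T u x s = gn T u x' s := by
  refine Finset.prod_congr rfl fun y _ => ?_
  congr 1
  have h' : ‖x' - x‖ ≤ s := by rwa [norm_sub_rev]
  apply le_antisymm
  · refine max_le (le_max_left _ _) ((nsub y x' x).trans (max_le (le_max_right _ _) (h'.trans (le_max_left _ _))))
  · refine max_le (le_max_left _ _) ((nsub y x x').trans (max_le (le_max_right _ _) (h.trans (le_max_left _ _))))

lemma crit_le (T : Finset K) (v : K → ℤ) (c : K) {s : ℝ} (hs : 0 < s) (hc : v c = 0)
    (h : ∀ y ∈ T, v y < 0 → s ≤ ‖y - c‖) :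
    ∏ y ∈ T, ‖c - y‖ ^ (v y) ≤ gn T v c s := by
  refine Finset.prod_le_prod (fun y _ => zpow_nonneg (norm_nonneg _) _) fun y hy => ?_
  rw [norm_sub_rev]
  rcases lt_trichotomy (v y) 0 with h0 | h0 | h0
  · rw [max_eq_right (h y hy h0)]
  · simp [h0]
  · exact zpow_le_zpow_left₀ h0.le (norm_nonneg _) (le_max_right _ _)

/-- sum over the directions at a closed disc -/
lemma dir_sum (T : Finset K) (v w : K → ℤ) (A R0 : ℝ) (hA : 0 < A)
    (hv0 : ∀ y ∈ T, v y ≠ 0 → w y = -1)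
    (hcrit : ∀ c ∈ T, v c = 0 → R0 < A * ∏ y ∈ T, ‖c - y‖ ^ (v y))
    (x : K) (s : ℝ) (hs : 0 < s) (hq : A * gn T v x s ≤ R0)
    (hdir : ∀ p ∈ T, ‖p - x‖ ≤ s → v p < 0 → ∑ y ∈ T with ‖y - p‖ < s, w y ≤ -1)
    (J : Finset K) (hJ : ∀ p ∈ J, p ∈ T ∧ ‖p - x‖ ≤ s ∧ v p < 0)
    (hJ2 : ∀ p ∈ J, ∀ p' ∈ J, ‖p - p'‖ < s → p = p') :
    ∑ y ∈ T with ‖y - x‖ ≤ s, w y ≤ -(J.card : ℤ) := by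
  classical
  set C := T.filter fun y => ‖y - x‖ ≤ s with hC
  set b : K → Set K := fun y => Metric.ball y s with hb
  have hbeq : ∀ y y' : K, b y = b y' ↔ ‖y - y'‖ < s := by
    intro y y'
    constructor
    · intro h
      have : y ∈ b y' := h ▸ Metric.mem_ball_self hs
      simpa [hb, dist_eq_norm] using this
    · intro h
      exact IsUltrametricDist.ball_eq_of_mem (by simpa [dist_eq_norm, norm_sub_rev] using h)
  have hfib : ∀ p ∈ C, (C.filter fun y => b y = b p) = T.filter fun y => ‖y - p‖ < s := by
    intro p hp
    ext y
    simp only [hC, Finset.mem_filter, hbeq] at hp ⊢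
    constructor
    · rintro ⟨⟨h1, _⟩, h2⟩; exact ⟨h1, h2⟩
    · rintro ⟨h1, h2⟩
      exact ⟨⟨h1, (nsub y p x).trans (max_le h2.le hp.2)⟩, h2⟩
  have hle : ∀ p ∈ C, ∑ y ∈ C with b y = b p, w y ≤ 0 := by
    intro p hp
    rw [hfib p hp]
    simp only [hC, Finset.mem_filter] at hp
    by_cases hpole : ∃ p' ∈ T, ‖p' - p‖ < s ∧ v p' < 0
    · obtain ⟨p', h1, h2, h3⟩ := hpole
      have := hdir p' h1 ((nsub p' p x).trans (max_le h2.le hp.2)) h3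
      rw [← hfib p (by simp [hC, hp]), ← (hbeq p' p).2 h2, hfib p' (by
        simp only [hC, Finset.mem_filter]
        exact ⟨h1, (nsub p' p x).trans (max_le h2.le hp.2)⟩)]
      omega
    · push Not at hpole
      apply Finset.sum_nonpos
      intro y hy
      simp only [Finset.mem_filter] at hy
      by_cases hy0 : v y = 0
      · exfalso
        have hyx : ‖y - x‖ ≤ s := (nsub y p x).trans (max_le hy.2.le hp.2)
        have h1 := crit_le T v y hs hy0 (by
          intro z hz hvz
          by_contra hlt
          push Not at hlt
          have := hpole z hz (((nsub z y p)).trans_lt (max_lt hlt hy.2))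
          omega)
        rw [gn_center T v hyx] at h1
        have h2 := hcrit y hy.1 hy0
        have := mul_le_mul_of_nonneg_left h1 hA.le
        linarith
      · rw [hv0 y hy.1 hy0]; norm_num
  rw [← Finset.sum_fiberwise_of_maps_to (g := b) (t := C.image b)
    (fun y hy => Finset.mem_image_of_mem b hy)]
  have hJC : J ⊆ C := fun p hp => by
    obtain ⟨h1, h2, h3⟩ := hJ p hp
    simp [hC, h1, h2]
  have hsub : J.image b ⊆ C.image b := Finset.image_subset_image hJC
  have hcard : (J.image b).card = J.card := by
    apply Finset.card_image_of_injOn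
    intro p hp p' hp' h
    exact hJ2 p hp p' hp' ((hbeq _ _).1 h)
  calc ∑ B ∈ C.image b, ∑ y ∈ C with b y = B, w y
      ≤ ∑ B ∈ J.image b, ∑ y ∈ C with b y = B, w y := by
        rw [← Finset.sum_sdiff hsub]
        have : ∑ B ∈ C.image b \ J.image b, ∑ y ∈ C with b y = B, w y ≤ 0 := by
          apply Finset.sum_nonpos
          intro B hB
          rw [Finset.mem_sdiff, Finset.mem_image] at hB
          obtain ⟨⟨p, hp, rfl⟩, _⟩ := hB
          exact hle p hp
        omega
    _ ≤ ∑ B ∈ J.image b, (-1) := by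
        apply Finset.sum_le_sum
        intro B hB
        rw [Finset.mem_image] at hB
        obtain ⟨p, hp, rfl⟩ := hB
        rw [hfib p (hJC hp)]
        obtain ⟨h1, h2, h3⟩ := hJ p hp
        exact hdir p h1 h2 h3
    _ = _ := by rw [Finset.sum_const, hcard]; simp

lemma q_bound {q δ B l : ℝ} {n : ℕ} (hl : 0 < l) (hlδ : l ≤ δ) (hB : q * δ ^ n ≤ B) (hq : 0 < q) :
    q ≤ B / l ^ n := by
  rw [le_div_iff₀ (by positivity)]
  exact (mul_le_mul_of_nonneg_left (pow_le_pow_left₀ hl.le hlδ n) hq.le).trans hB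

lemma inward (T : Finset K) (v w : K → ℤ) (A B l : ℝ) (d : ℕ) (hd : 1 ≤ d) (hA : 0 < A) (hl : 0 < l)
    (hv0 : ∀ y ∈ T, v y ≠ 0 → w y = -1)
    (hneg : ∀ U ⊆ T, -(d : ℤ) ≤ ∑ y ∈ U, v y)
    (hlam : ∀ U ⊆ T, (∑ y ∈ U, v y) ≠ 0 → l ≤ ‖((∑ y ∈ U, v y : ℤ) : K)‖)
    (hδ : ∀ (x : K) (s : ℝ), 0 < s → ‖((∑ y ∈ T with ‖y - x‖ ≤ s, v y : ℤ) : K)‖ ≤ s * gn T w x s)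
    (hcrit : ∀ c ∈ T, v c = 0 → B / l ^ (d - 1) < A * ∏ y ∈ T, ‖c - y‖ ^ (v y)) (n : ℕ) :
    ∀ (x : K) (s : ℝ), x ∈ T → v x < 0 → 0 < s → (T.filter fun y => ‖y - x‖ < s).card ≤ n →
      0 ≤ ∑ y ∈ T with ‖y - x‖ < s, w y → (∃ p ∈ T, v p < 0 ∧ s ≤ ‖p - x‖) →
      A * gn T v x s ≤ B / l ^ (d - 1) →
      A * gn T v x s * (s * gn T w x s) ^ (d - 1) ≤ B → False := by
  classical
  induction n with
  | zero =>
    intro x s hx _ hs hc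
    exfalso
    have : x ∈ T.filter fun y => ‖y - x‖ < s := by simp [hx, hs]
    have := Finset.card_pos.2 ⟨x, this⟩
    omega
  | succ n ih =>
    intro x s hx hvx hs hcard hw hmiss hq hG
    set D := T.filter fun y => ‖y - x‖ < s with hD
    have hxD : x ∈ D := by simp [hD, hx, hs]
    obtain ⟨m, hmD, hmax⟩ := D.exists_max_image (fun y => ‖y - x‖) ⟨x, hxD⟩
    have hm := hmD
    simp only [hD, Finset.mem_filter] at hm
    by_cases hm0 : ‖m - x‖ = 0
    · have : D = {x} := by
        ext y
        simp only [Finset.mem_singleton]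
        constructor
        · intro hy
          have := hmax y hy
          rw [hm0] at this
          have := norm_le_zero_iff.1 this
          exact sub_eq_zero.1 this
        · rintro rfl; exact hxD
      rw [this, Finset.sum_singleton, hv0 x hx hvx.ne] at hw
      omega
    set s' := ‖m - x‖ with hs'
    have hs'0 : 0 < s' := lt_of_le_of_ne (norm_nonneg _) (Ne.symm hm0)
    have hss : s' ≤ s := hm.2.le
    have hmx : ∀ y ∈ T, ‖y - x‖ < s → ‖y - x‖ ≤ s' := fun y hy h => hmax y (by simp [hD, hy, h])
    have hclosed : (T.filter fun y => ‖y - x‖ ≤ s') = D := by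
      ext y
      simp only [hD, Finset.mem_filter]
      exact ⟨fun h => ⟨h.1, h.2.trans_lt hm.2⟩, fun h => ⟨h.1, hmx y h.1 h.2⟩⟩
    have hgv := gn_shrink T v x hs'0 hss hmx
    have hgw := gn_shrink T w x hs'0 hss hmx
    rw [← hD] at hgv hgw
    have hDT : D ⊆ T := Finset.filter_subset _ _
    set N := ∑ y ∈ D, v y with hN
    set W := ∑ y ∈ D, w y with hW
    have hNge : -((d - 1 : ℕ) : ℤ) ≤ N := by
      obtain ⟨p, hp, hvp, hps⟩ := hmiss
      have hpD : p ∉ D := by simp [hD, hps]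
      have := hneg (insert p D) (Finset.insert_subset hp hDT)
      rw [Finset.sum_insert hpD] at this
      omega
    have hρ0 : 0 < s' / s := div_pos hs'0 hs
    have hρ1 : s' / s ≤ 1 := (div_le_one hs).2 hss
    have hδ' : s' * gn T w x s' = (s * gn T w x s) * (s' / s) ^ (1 + W) := by
      rw [hgw, zpow_add₀ hρ0.ne', zpow_one]; field_simp
    have hG' : A * gn T v x s' * (s' * gn T w x s') ^ (d - 1) ≤ B := by
      rw [hδ', hgv, mul_pow, ← zpow_natCast ((s' / s) ^ (1 + W)), ← zpow_mul]
      have : (s' / s) ^ N * (s' / s) ^ ((1 + W) * ((d - 1 : ℕ) : ℤ)) ≤ 1 := by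
        rw [← zpow_add₀ hρ0.ne']
        have hE : 0 ≤ N + (1 + W) * ((d - 1 : ℕ) : ℤ) := by
          nlinarith [mul_nonneg hw (Int.natCast_nonneg (d - 1))]
        obtain ⟨e, he⟩ := Int.eq_ofNat_of_zero_le hE
        rw [he, zpow_natCast]
        exact pow_le_one₀ hρ0.le hρ1
      have hpos : 0 < A * gn T v x s * (s * gn T w x s) ^ (d - 1) := by
        have := gn_pos T v x hs; have := gn_pos T w x hs; positivity
      calc _ = A * gn T v x s * (s * gn T w x s) ^ (d - 1) *
            ((s' / s) ^ N * (s' / s) ^ ((1 + W) * ((d - 1 : ℕ) : ℤ))) := by ring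
        _ ≤ A * gn T v x s * (s * gn T w x s) ^ (d - 1) * 1 := by gcongr
        _ ≤ B := by linarith
    have hq' : A * gn T v x s' ≤ B / l ^ (d - 1) := by
      by_cases hN0 : N = 0
      · rw [hgv, hN0, zpow_zero, mul_one]; exact hq
      · have h1 := hδ x s' hs'0
        rw [hclosed] at h1
        exact q_bound hl ((hlam D hDT hN0).trans h1) hG' (mul_pos hA (gn_pos T v x hs'0))
    have key : ∃ p ∈ T, ‖p - x‖ ≤ s' ∧ v p < 0 ∧ 0 ≤ ∑ y ∈ T with ‖y - p‖ < s', w y := by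
      by_contra hcon
      push Not at hcon
      have := dir_sum T v w A _ hA hv0 hcrit x s' hs'0 hq'
        (fun p hp h1 h2 => by have := hcon p hp h1 h2; omega) {x} (by
          intro p hp; rw [Finset.mem_singleton] at hp; subst hp
          exact ⟨hx, by simp [hs'0.le], hvx⟩) (by
          intro p hp p' hp' _
          rw [Finset.mem_singleton] at hp hp'; rw [hp, hp'])
      rw [hclosed] at this
      simp only [Finset.card_singleton] at this
      omega
    obtain ⟨p, hpT, hpx, hvp, hwp⟩ := key
    have hpx' : ‖x - p‖ ≤ s' := by rwa [norm_sub_rev]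
    refine ih p s' hpT hvp hs'0 ?_ hwp ?_ ?_ ?_
    · have : (T.filter fun y => ‖y - p‖ < s') ⊂ D := by
        rw [Finset.ssubset_iff_of_subset]
        · by_cases hpm : ‖x - p‖ < s'
          · refine ⟨m, hmD, ?_⟩
            simp only [Finset.mem_filter, not_and, not_lt]
            intro _
            by_contra hlt
            push Not at hlt
            have h1 := nsub m p x
            rw [norm_sub_rev p x] at h1
            exact absurd (h1.trans_lt (max_lt hlt hpm)) (lt_irrefl _)
          · exact ⟨x, hxD, by simp [not_lt.1 hpm]⟩
        · intro y hy
          rw [← hclosed]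
          simp only [Finset.mem_filter] at hy ⊢
          exact ⟨hy.1, (nsub y p x).trans (max_le hy.2.le hpx)⟩
      have := Finset.card_lt_card this
      omega
    · obtain ⟨p', hp', hvp', hps⟩ := hmiss
      refine ⟨p', hp', hvp', ?_⟩
      by_contra hlt
      push Not at hlt
      have := (nsub p' p x).trans_lt (max_lt (hlt.trans_le hss) (hpx.trans_lt hm.2))
      linarith
    · rw [← gn_center T v hpx']; exact hq'
    · rw [← gn_center T v hpx', ← gn_center T w hpx']; exact hG'

lemma prod_zpow_sum (T : Finset K) (u : K → ℤ) {s : ℝ} (hs : s ≠ 0) :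
    ∏ y ∈ T, s ^ (u y) = s ^ (∑ y ∈ T, u y) := by
  classical
  induction T using Finset.induction_on with
  | empty => simp
  | insert a t ha ih => rw [Finset.sum_insert ha, Finset.prod_insert ha, zpow_add₀ hs, ih]

lemma core (T : Finset K) (v w : K → ℤ) (A l ρ : ℝ) (d : ℕ) (hd : 1 ≤ d) (hA : 0 < A) (hl : 0 < l)
    (hρ : 0 < ρ)
    (hv0 : ∀ y ∈ T, v y ≠ 0 → w y = -1)
    (hvs : ∑ y ∈ T, v y = -1) (hws : ∑ y ∈ T, w y = -1)
    (hneg : ∀ U ⊆ T, -(d : ℤ) ≤ ∑ y ∈ U, v y)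
    (hpos : ∀ y ∈ T, v y ≤ ((d - 1 : ℕ) : ℤ))
    (hlam : ∀ U ⊆ T, (∑ y ∈ U, v y) ≠ 0 → l ≤ ‖((∑ y ∈ U, v y : ℤ) : K)‖)
    (hδ : ∀ (x : K) (s : ℝ), 0 < s → ‖((∑ y ∈ T with ‖y - x‖ ≤ s, v y : ℤ) : K)‖ ≤ s * gn T w x s)
    (h0 : (0 : K) ∈ T) (hv00 : v 0 < 0) (p : K) (hpT : p ∈ T) (hvp : v p < 0) (hpρ : ‖p‖ = ρ)
    (hpole : ∀ y ∈ T, v y < 0 → ‖y‖ ≤ ρ) :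
    ∃ c ∈ T, v c = 0 ∧ A * ∏ y ∈ T, ‖c - y‖ ^ (v y) ≤ (A / ρ) / l ^ (d - 1) := by
  classical
  by_contra hcrit
  push Not at hcrit
  have top : ∀ s : ℝ, ρ ≤ s → (∀ c ∈ T, v c = 0 → ‖c‖ ≤ s) →
      A * gn T v 0 s * (s * gn T w 0 s) ^ (d - 1) ≤ A / s ∧
      A * gn T v 0 s ≤ (A / s) / l ^ (d - 1) := by
    intro s hρs hcs
    have hs : 0 < s := hρ.trans_le hρs
    have e : ∀ u : K → ℤ, ∑ y ∈ T, u y = -1 →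
        s * gn T u 0 s = ∏ y ∈ T, (max s ‖y‖ / s) ^ (u y) := by
      intro u hu
      simp only [div_zpow, Finset.prod_div_distrib, prod_zpow_sum T u hs.ne', hu, gn, sub_zero]
      rw [zpow_neg_one, div_inv_eq_mul, mul_comm]
    have h1 : A * gn T v 0 s * (s * gn T w 0 s) ^ (d - 1) ≤ A / s := by
      have : (s * gn T v 0 s) * (s * gn T w 0 s) ^ (d - 1) ≤ 1 := by
        rw [e v hvs, e w hws, ← Finset.prod_pow, ← Finset.prod_mul_distrib]
        apply Finset.prod_le_one
        · intro y _; positivity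
        · intro y hy
          by_cases hys : ‖y‖ ≤ s
          · rw [max_eq_left hys, div_self hs.ne']; simp
          · have hvy : 0 < v y := by
              by_contra hh
              rcases lt_or_eq_of_le (not_lt.1 hh) with h | h
              · exact hys ((hpole y hy h).trans hρs)
              · exact hys (hcs y hy h)
            have hM : 1 ≤ max s ‖y‖ / s := (one_le_div hs).2 (le_max_left _ _)
            rw [hv0 y hy hvy.ne', ← zpow_natCast, ← zpow_mul, ← zpow_add₀ (by positivity)]
            apply zpow_le_one_of_nonpos₀ hM
            have := hpos y hy
            omega
      rw [le_div_iff₀ hs]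
      calc _ = A * ((s * gn T v 0 s) * (s * gn T w 0 s) ^ (d - 1)) := by ring
        _ ≤ A * 1 := by gcongr
        _ = A := mul_one A
    refine ⟨h1, ?_⟩
    have h2 := hδ 0 s hs
    refine q_bound hl ((hlam _ (Finset.filter_subset _ _) ?_).trans h2) h1 (mul_pos hA (gn_pos T v 0 hs))
    have h3 := Finset.sum_filter_add_sum_filter_not T (fun y => ‖y - 0‖ ≤ s) v
    have h4 : 0 ≤ ∑ y ∈ T with ¬ ‖y - 0‖ ≤ s, v y := by
      apply Finset.sum_nonneg
      intro y hy
      simp only [Finset.mem_filter, sub_zero] at hy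
      by_contra hh
      exact hy.2 ((hpole y hy.1 (not_le.1 hh)).trans hρs)
    omega
  by_cases hall : ∀ c ∈ T, v c = 0 → ‖c‖ ≤ ρ
  · obtain ⟨hG, hq⟩ := top ρ le_rfl hall
    have key : ∃ p ∈ T, ‖p - 0‖ ≤ ρ ∧ v p < 0 ∧ 0 ≤ ∑ y ∈ T with ‖y - p‖ < ρ, w y := by
      by_contra hcon
      push Not at hcon
      have hp0 : (0 : K) ≠ p := by rintro rfl; simp at hpρ; linarith
      have := dir_sum T v w A _ hA hv0 hcrit 0 ρ hρ hq
        (fun p hp h1 h2 => by have := hcon p hp h1 h2; omega) {0, p} (by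
          intro y hy; rw [Finset.mem_insert, Finset.mem_singleton] at hy
          rcases hy with rfl | rfl
          · exact ⟨h0, by simp [hρ.le], hv00⟩
          · exact ⟨hpT, by simp [hpρ], hvp⟩) (by
          intro y hy y' hy' hlt
          rw [Finset.mem_insert, Finset.mem_singleton] at hy hy'
          rcases hy with rfl | rfl <;> rcases hy' with rfl | rfl <;> simp [hpρ] at hlt ⊢)
      rw [Finset.card_pair hp0] at this
      have h3 := Finset.sum_filter_add_sum_filter_not T (fun y => ‖y - 0‖ ≤ ρ) w
      have h4 : ∑ y ∈ T with ¬ ‖y - 0‖ ≤ ρ, w y ≤ 0 := by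
        apply Finset.sum_nonpos
        intro y hy
        simp only [Finset.mem_filter, sub_zero] at hy
        by_cases hvy : v y = 0
        · exact absurd (hall y hy.1 hvy) hy.2
        · rw [hv0 y hy.1 hvy]; norm_num
      push_cast at this
      omega
    obtain ⟨p1, hp1, hp1ρ, hvp1, hw1⟩ := key
    have hc : ‖(0 : K) - p1‖ ≤ ρ := by rwa [norm_sub_rev]
    refine inward T v w A (A / ρ) l d hd hA hl hv0 hneg hlam hδ hcrit _ p1 ρ hp1 hvp1 hρ le_rfl hw1
      ?_ ?_ ?_
    · by_contra hcon
      push Not at hcon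
      have h1 := hcon 0 h0 hv00
      have h2 := hcon p hpT hvp
      have h3 := nsub p p1 0
      rw [norm_sub_rev p1 0, sub_zero, hpρ] at h3
      exact absurd (h3.trans_lt (max_lt h2 h1)) (lt_irrefl _)
    · rw [← gn_center T v hc]; exact hq
    · rw [← gn_center T v hc, ← gn_center T w hc]; exact hG
  · push Not at hall
    obtain ⟨c0, hc0, hvc0, hc0ρ⟩ := hall
    obtain ⟨c, hc, hmax⟩ := (T.filter fun c => v c = 0).exists_max_image (fun c => ‖c‖)
      ⟨c0, by simp [hc0, hvc0]⟩
    simp only [Finset.mem_filter] at hc hmax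
    have hcρ : ρ < ‖c‖ := hc0ρ.trans_le (hmax c0 ⟨hc0, hvc0⟩)
    obtain ⟨-, hq⟩ := top ‖c‖ hcρ.le (fun y hy h => hmax y ⟨hy, h⟩)
    have h1 := crit_le T v c (hρ.trans hcρ) hc.2 (by
      intro y hy hvy
      by_contra hlt
      push Not at hlt
      have h := nsub c y 0
      rw [norm_sub_rev c y, sub_zero, sub_zero] at h
      exact absurd (h.trans_lt (max_lt hlt ((hpole y hy hvy).trans_lt hcρ))) (lt_irrefl _))
    rw [gn_center T v (x := c) (x' := 0) (by simp)] at h1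
    have h2 := hcrit c hc.1 hc.2
    have h3 := mul_le_mul_of_nonneg_left h1 hA.le
    have h4 : A / ‖c‖ / l ^ (d - 1) ≤ A / ρ / l ^ (d - 1) := by gcongr
    linarith

end core

section delta
variable {K : Type*} [NontriviallyNormedField K] [IsUltrametricDist K] [IsAlgClosed K]

lemma exists_norm_between {s t : ℝ} (hs : 0 < s) (hst : s < t) : ∃ z : K, s < ‖z‖ ∧ ‖z‖ < t := by
  obtain ⟨c, hc⟩ := NormedField.exists_one_lt_norm K
  have h1 : 1 < t / s := (one_lt_div hs).2 hst
  obtain ⟨n, hn⟩ := pow_unbounded_of_one_lt ‖c‖ h1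
  have hn0 : n ≠ 0 := by rintro rfl; simp at hn; linarith
  obtain ⟨a, ha⟩ := IsAlgClosed.exists_pow_nat_eq c (Nat.pos_of_ne_zero hn0)
  have hna : ‖a‖ ^ n = ‖c‖ := by rw [← norm_pow, ha]
  have ha1 : 1 < ‖a‖ := by
    by_contra h
    have := pow_le_one₀ (norm_nonneg a) (not_lt.1 h) (n := n)
    linarith
  have hat : ‖a‖ < t / s := by
    apply lt_of_pow_lt_pow_left₀ n (by positivity)
    rw [hna]; exact hn
  obtain ⟨k, hk1, hk2⟩ := exists_mem_Ico_zpow hs ha1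
  refine ⟨a ^ (k + 1), by rwa [norm_zpow], ?_⟩
  rw [norm_zpow, zpow_add₀ (by positivity), zpow_one]
  calc ‖a‖ ^ k * ‖a‖ ≤ s * ‖a‖ := by gcongr
    _ < s * (t / s) := by gcongr
    _ = t := by field_simp

lemma exists_unit_nat : ∃ l : ℕ, 2 ≤ l ∧ ‖(l : K)‖ = 1 := by
  have h2 : ‖(2 : K)‖ ≤ 1 := by
    have := IsUltrametricDist.norm_natCast_le_one K 2
    simpa using this
  rcases h2.lt_or_eq with h | h
  · refine ⟨3, by norm_num, ?_⟩
    have : ‖(2 : K) + 1‖ = max ‖(2 : K)‖ ‖(1 : K)‖ :=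
      IsUltrametricDist.norm_add_eq_max_of_norm_ne_norm (by rw [norm_one]; exact h.ne)
    rw [norm_one, max_eq_right h2] at this
    rw [← this]; congr 1; norm_num
  · exact ⟨2, le_rfl, by simpa using h⟩

lemma msum_le (m : Multiset K) (f : K → K) (b : ℝ) (hb : 0 ≤ b) (h : ∀ z ∈ m, ‖f z‖ ≤ b) :
    ‖(m.map f).sum‖ ≤ b := by
  induction m using Multiset.induction_on with
  | empty => simpa using hb
  | cons a m ih =>
    rw [Multiset.map_cons, Multiset.sum_cons]
    refine (IsUltrametricDist.norm_add_le_max _ _).trans (max_le (h a (by simp)) (ih ?_))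
    intro z hz
    exact h z (by simp [hz])

/-- sum over the `N`-th roots of `z ^ N` -/
lemma root_sum (z y : K) (N : ℕ) (hN : 0 < N) (hz : z ≠ 0) (hyz : y ^ N ≠ z ^ N) :
    ((X ^ N - C (z ^ N) : K[X]).roots.map (fun ζ => ζ / (ζ - y))).sum
      = N * (1 / (1 - (y / z) ^ N)) := by
  set P : K[X] := X ^ N - C (z ^ N) with hP
  have hPs : P.Splits := IsAlgClosed.splits P
  have hdeg : P.natDegree = N := natDegree_X_pow_sub_C
  have hcard : P.roots.card = N := by rw [← hPs.natDegree_eq_card_roots, hdeg]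
  have hev : P.eval y ≠ 0 := by simp [hP, sub_eq_zero, hyz]
  have h1 := hPs.eval_derivative_div_eval_of_ne_zero hev
  have hmem : ∀ ζ ∈ P.roots, ζ ^ N = z ^ N := by
    intro ζ hζ
    have := (Polynomial.mem_roots'.1 hζ).2
    simpa [hP, sub_eq_zero] using this
  have h2 : (P.roots.map (fun ζ => ζ / (ζ - y))) = P.roots.map (fun ζ => 1 - y * (1 / (y - ζ))) := by
    apply Multiset.map_congr rfl
    intro ζ hζ
    have hne : ζ - y ≠ 0 := by
      intro h; rw [sub_eq_zero] at h; exact hyz (h ▸ hmem ζ hζ)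
    have hne' : y - ζ ≠ 0 := by rw [← neg_sub]; exact neg_ne_zero.2 hne
    field_simp
    ring
  rw [h2, Multiset.sum_map_sub, Multiset.sum_map_mul_left, ← h1]
  simp only [Multiset.map_const', Multiset.sum_replicate, hcard]
  have hd : derivative P = C (N : K) * X ^ (N - 1) := by
    rw [hP, derivative_sub, derivative_C, sub_zero, derivative_X_pow]
  rw [hd]
  have e : P.eval y = y ^ N - z ^ N := by simp [hP]
  rw [e]
  simp only [eval_mul, eval_C, eval_pow, eval_X]
  have hyz' : y ^ N - z ^ N ≠ 0 := sub_ne_zero.2 hyz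
  have hyz'' : z ^ N - y ^ N ≠ 0 := sub_ne_zero.2 hyz.symm
  have hzN : z ^ N ≠ 0 := pow_ne_zero _ hz
  have e2 : (1 : K) / (1 - (y / z) ^ N) = z ^ N / (z ^ N - y ^ N) := by
    rw [div_pow]
    have : (1 : K) - y ^ N / z ^ N = (z ^ N - y ^ N) / z ^ N := by field_simp
    rw [this, one_div_div]
  have e3 : y * (N * y ^ (N - 1) / (y ^ N - z ^ N)) = N * (y ^ N / (y ^ N - z ^ N)) := by
    have : y ^ N = y * y ^ (N - 1) := by rw [← pow_succ', Nat.sub_add_cancel hN]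
    rw [mul_div_assoc, mul_left_comm, ← mul_div_assoc y, ← this]
  rw [e3, e2, nsmul_one, ← mul_one_sub]
  congr 1
  rw [← neg_sub (z ^ N) (y ^ N), div_neg]
  field_simp
  ring

lemma delta_circle (T : Finset K) (v w : K → ℤ)
    (hF : ∀ z ∉ T, ‖∑ y ∈ T, (v y : K) / (z - y)‖ = ∏ y ∈ T, ‖z - y‖ ^ (w y))
    (x z : K) (hz : z ≠ 0) (hne : ∀ y ∈ T, ‖y - x‖ ≠ ‖z‖) :
    ‖((∑ y ∈ T with ‖y - x‖ < ‖z‖, v y : ℤ) : K)‖ ≤ ‖z‖ * gn T w x ‖z‖ := by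
  obtain ⟨l, hl2, hl⟩ := exists_unit_nat (K := K)
  have hz0 : 0 < ‖z‖ := norm_pos_iff.2 hz
  have bound : ∀ j : ℕ, ‖∑ y ∈ T, (v y : K) * (1 / (1 - ((y - x) / z) ^ (l ^ j)))‖
      ≤ ‖z‖ * gn T w x ‖z‖ := by
    intro j
    have hN : 0 < l ^ j := by positivity
    set N := l ^ j with hNdef
    set P : K[X] := X ^ N - C (z ^ N) with hP
    have hmem : ∀ ζ ∈ P.roots, ‖ζ‖ = ‖z‖ := by
      intro ζ hζ
      have := (Polynomial.mem_roots'.1 hζ).2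
      have h : ζ ^ N = z ^ N := by simpa [hP, sub_eq_zero] using this
      have h2 : ‖ζ‖ ^ N = ‖z‖ ^ N := by rw [← norm_pow, h, norm_pow]
      exact (pow_left_inj₀ (norm_nonneg _) (norm_nonneg _) hN.ne').1 h2
    have h1 := msum_le P.roots (fun ζ => ζ * ∑ y ∈ T, (v y : K) / (x + ζ - y))
      (‖z‖ * gn T w x ‖z‖) (mul_nonneg hz0.le (gn_pos T w x hz0).le) (by
        intro ζ hζ
        have hζn := hmem ζ hζ
        have hdist : ∀ y ∈ T, ‖x + ζ - y‖ = max ‖z‖ ‖y - x‖ := by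
          intro y hy
          have : x + ζ - y = ζ + (x - y) := by ring
          rw [this, IsUltrametricDist.norm_add_eq_max_of_norm_ne_norm, hζn, norm_sub_rev x y]
          rw [hζn, norm_sub_rev x y]; exact (hne y hy).symm
        have hnT : x + ζ ∉ T := by
          intro hmem'
          have := hdist _ hmem'
          simp only [sub_self, norm_zero] at this
          have h3 := le_max_left ‖z‖ ‖x + ζ - x‖
          linarith
        rw [norm_mul, hζn, hF _ hnT, gn]
        apply le_of_eq
        congr 1
        exact Finset.prod_congr rfl fun y hy => by rw [hdist y hy])
    have h2 : (P.roots.map (fun ζ => ζ * ∑ y ∈ T, (v y : K) / (x + ζ - y))).sum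
        = (N : K) * ∑ y ∈ T, (v y : K) * (1 / (1 - ((y - x) / z) ^ N)) := by
      have : ∀ ζ : K, ζ * ∑ y ∈ T, (v y : K) / (x + ζ - y)
          = ∑ y ∈ T, (v y : K) * (ζ / (ζ - (y - x))) := by
        intro ζ
        rw [Finset.mul_sum]
        refine Finset.sum_congr rfl fun y _ => ?_
        have : x + ζ - y = ζ - (y - x) := by ring
        rw [this]; ring
      simp only [this]
      rw [Multiset.sum_map_sum]
      rw [Finset.mul_sum]
      refine Finset.sum_congr rfl fun y hy => ?_
      rw [Multiset.sum_map_mul_left, root_sum z (y - x) N hN hz]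
      · ring
      · intro h
        have h2 : ‖y - x‖ ^ N = ‖z‖ ^ N := by rw [← norm_pow, h, norm_pow]
        exact hne y hy ((pow_left_inj₀ (norm_nonneg _) (norm_nonneg _) hN.ne').1 h2)
    rw [h2, norm_mul] at h1
    have h3 : ‖(N : K)‖ = 1 := by rw [hNdef, Nat.cast_pow, norm_pow, hl, one_pow]
    rwa [h3, one_mul] at h1
  have hl' : Tendsto (fun j : ℕ => l ^ j) atTop atTop := tendsto_pow_atTop_atTop_of_one_lt hl2
  have lim : Tendsto (fun j : ℕ => ∑ y ∈ T, (v y : K) * (1 / (1 - ((y - x) / z) ^ (l ^ j)))) atTop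
      (nhds (∑ y ∈ T, (v y : K) * (if ‖y - x‖ < ‖z‖ then 1 else 0))) := by
    apply tendsto_finsetSum
    intro y hy
    apply Tendsto.const_mul
    have hu : ‖(y - x) / z‖ = ‖y - x‖ / ‖z‖ := norm_div _ _
    split_ifs with hlt
    · have : ‖(y - x) / z‖ < 1 := by rw [hu, div_lt_one hz0]; exact hlt
      have h1 := (tendsto_pow_atTop_nhds_zero_of_norm_lt_one this).comp hl'
      have h2 := (h1.const_sub 1).inv₀ (by simp)
      simpa using h2
    · have : 1 < ‖(y - x) / z‖ := by
        rw [hu, one_lt_div hz0]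
        exact lt_of_le_of_ne (not_lt.1 hlt) (hne y hy).symm
      have h1 : Tendsto (fun j : ℕ => ‖((y - x) / z) ^ (l ^ j)‖ - 1) atTop atTop := by
        simp only [norm_pow]
        exact tendsto_atTop_add_const_right _ (-1) ((tendsto_pow_atTop_atTop_of_one_lt this).comp hl')
      have h2 : Tendsto (fun j : ℕ => ‖1 - ((y - x) / z) ^ (l ^ j)‖) atTop atTop := by
        refine tendsto_atTop_mono (fun j => ?_) h1
        have := norm_sub_norm_le (((y - x) / z) ^ (l ^ j)) 1
        rw [norm_one, norm_sub_rev] at this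
        exact this
      have h3 := tendsto_inv₀_cobounded.comp (tendsto_norm_atTop_iff_cobounded.1 h2)
      simpa [Function.comp_def] using h3
  have := le_of_tendsto lim.norm (Eventually.of_forall bound)
  have e : ((∑ y ∈ T with ‖y - x‖ < ‖z‖, v y : ℤ) : K)
      = ∑ y ∈ T, (v y : K) * (if ‖y - x‖ < ‖z‖ then 1 else 0) := by
    rw [Finset.sum_filter]
    push_cast
    exact Finset.sum_congr rfl fun y _ => by split_ifs <;> simp
  rw [e]
  exact this

lemma delta_lower (T : Finset K) (v w : K → ℤ)
    (hF : ∀ z ∉ T, ‖∑ y ∈ T, (v y : K) / (z - y)‖ = ∏ y ∈ T, ‖z - y‖ ^ (w y))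
    (x : K) (s : ℝ) (hs : 0 < s) :
    ‖((∑ y ∈ T with ‖y - x‖ ≤ s, v y : ℤ) : K)‖ ≤ s * gn T w x s := by
  by_contra hcon
  push Not at hcon
  have hcont : ContinuousAt (fun t : ℝ => t * gn T w x t) s := by
    unfold gn
    refine continuousAt_id.mul (tendsto_finsetProd _ fun y _ => ?_)
    refine ContinuousAt.zpow₀ (by fun_prop) _ (Or.inl ?_)
    exact (lt_max_of_lt_left hs).ne'
  have h1 := hcont.eventually (gt_mem_nhds hcon)
  have h2 : ∀ᶠ t in nhds s, ∀ y ∈ T, ‖y - x‖ ≤ s ∨ t < ‖y - x‖ := by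
    rw [Filter.eventually_all_finset]
    intro y _
    by_cases h : ‖y - x‖ ≤ s
    · exact Eventually.of_forall fun _ => Or.inl h
    · filter_upwards [gt_mem_nhds (not_le.1 h)] with t ht
      exact Or.inr ht
  obtain ⟨ε, hε, hball⟩ := Metric.eventually_nhds_iff.1 (h1.and h2)
  obtain ⟨z, hz1, hz2⟩ := exists_norm_between (K := K) hs (lt_add_of_pos_right s hε)
  have hd : dist ‖z‖ s < ε := by rw [Real.dist_eq, abs_of_pos (by linarith)]; linarith
  obtain ⟨h3, h4⟩ := hball hd
  have hz : z ≠ 0 := norm_pos_iff.1 (hs.trans hz1)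
  have h5 := delta_circle T v w hF x z hz (by
    intro y hy
    rcases h4 y hy with h | h
    · exact (h.trans_lt hz1).ne
    · exact h.ne')
  have h6 : (T.filter fun y => ‖y - x‖ < ‖z‖) = T.filter fun y => ‖y - x‖ ≤ s := by
    apply Finset.filter_congr
    intro y hy
    constructor
    · intro h
      rcases h4 y hy with h' | h'
      · exact h'
      · linarith
    · intro h; exact h.trans_lt hz1
  rw [h6] at h5
  linarith

end delta

section ratl
variable {K : Type*} [NontriviallyNormedField K] [IsUltrametricDist K] [IsAlgClosed K]

lemma partial_frac (S : Finset K) (v : K → ℤ) (hv : ∀ y ∈ S, (v y : K) ≠ 0)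
    (hsum : ∑ y ∈ S, v y = -1) :
    ∃ M : Multiset K, (M.card : ℤ) = S.card - 1 ∧ (∀ c ∈ M, c ∉ S) ∧
      (∀ c ∈ M, ∑ y ∈ S, (v y : K) / (c - y) = 0) ∧
      ∀ z ∉ S, ‖∑ y ∈ S, (v y : K) / (z - y)‖
        = (M.map fun c => ‖z - c‖).prod / ∏ y ∈ S, ‖z - y‖ := by
  classical
  set P : K[X] := ∑ y ∈ S, C (v y : K) * ∏ y' ∈ S.erase y, (X - C y') with hP
  have hS : 1 ≤ S.card := by
    rw [Nat.one_le_iff_ne_zero, Finset.card_ne_zero, Finset.nonempty_iff_ne_empty]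
    rintro rfl; simp at hsum
  have hdeg1 : ∀ y ∈ S, (∏ y' ∈ S.erase y, (X - C y') : K[X]).natDegree = S.card - 1 := by
    intro y hy
    rw [natDegree_finsetProd_X_sub_C_eq_card, Finset.card_erase_of_mem hy]
  have hcoeff : P.coeff (S.card - 1) = -1 := by
    rw [hP, finsetSum_coeff]
    have : ∀ y ∈ S, (C (v y : K) * ∏ y' ∈ S.erase y, (X - C y')).coeff (S.card - 1) = (v y : K) := by
      intro y hy
      rw [coeff_C_mul, ← hdeg1 y hy, Monic.coeff_natDegree (monic_prod_of_monic _ _ fun i _ => monic_X_sub_C i), mul_one]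
    rw [Finset.sum_congr rfl this, ← Int.cast_sum, hsum]; simp
  have hle : P.natDegree ≤ S.card - 1 := by
    apply natDegree_sum_le_of_forall_le
    intro y hy
    exact (natDegree_C_mul_le _ _).trans (hdeg1 y hy).le
  have hdeg : P.natDegree = S.card - 1 := by
    apply le_antisymm hle
    apply le_natDegree_of_ne_zero
    rw [hcoeff]; simp
  have hlc : P.leadingCoeff = -1 := by rw [leadingCoeff, hdeg, hcoeff]
  have hsp : P.Splits := IsAlgClosed.splits P
  have hev : ∀ z ∉ S, ∑ y ∈ S, (v y : K) / (z - y) = P.eval z / ∏ y ∈ S, (z - y) := by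
    intro z hz
    rw [hP, eval_finsetSum, Finset.sum_div]
    refine Finset.sum_congr rfl fun y hy => ?_
    rw [eval_mul, eval_C, eval_prod, ← Finset.mul_prod_erase S (fun y => z - y) hy]
    simp only [eval_sub, eval_X, eval_C]
    have h1 : ∏ y' ∈ S.erase y, (z - y') ≠ 0 := by
      rw [Finset.prod_ne_zero_iff]
      intro a ha h
      rw [sub_eq_zero] at h
      exact hz (h ▸ Finset.mem_of_mem_erase ha)
    rw [mul_div_mul_right _ _ h1]
  have hroot : ∀ c ∈ P.roots, c ∉ S := by
    intro c hc hcS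
    have h0 : P.eval c = 0 := (Polynomial.mem_roots'.1 hc).2
    rw [hP, eval_finsetSum, Finset.sum_eq_single c] at h0
    · rw [eval_mul, eval_C, eval_prod, mul_eq_zero, Finset.prod_eq_zero_iff] at h0
      rcases h0 with h0 | ⟨a, ha, h0⟩
      · exact hv c hcS h0
      · simp only [eval_sub, eval_X, eval_C, sub_eq_zero] at h0
        exact (Finset.ne_of_mem_erase ha) h0.symm
    · intro b hb hbc
      rw [eval_mul, eval_prod, Finset.prod_eq_zero (i := c)]
      · simp
      · exact Finset.mem_erase.2 ⟨hbc.symm, hcS⟩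
      · simp
    · intro h; exact absurd hcS h
  refine ⟨P.roots, ?_, hroot, ?_, ?_⟩
  · rw [← hsp.natDegree_eq_card_roots, hdeg]; omega
  · intro c hc
    rw [hev c (hroot c hc), show P.eval c = 0 from (Polynomial.mem_roots'.1 hc).2, zero_div]
  · intro z hz
    rw [hev z hz, norm_div, norm_prod, hsp.eval_eq_prod_roots, hlc, norm_mul, norm_neg, norm_one, one_mul]
    congr 1
    have := map_multiset_prod (normHom : K →*₀ ℝ) (P.roots.map fun c => z - c)
    rw [Multiset.map_map] at this
    exact this

lemma sum_count_le {α : Type*} [DecidableEq α] (U : Finset α) (m : Multiset α) :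
    ∑ y ∈ U, m.count y ≤ m.card := by
  rw [← Multiset.sum_count_eq_card (s := U ∪ m.toFinset) (m := m) (by intro a ha; simp [ha])]
  exact Finset.sum_le_sum_of_subset Finset.subset_union_left

lemma norm_eval_prod [DecidableEq K] (f : K[X]) (T : Finset K) (hT : f.roots.toFinset ⊆ T) (c : K) :
    ‖f.eval c‖ = ‖f.leadingCoeff‖ * ∏ y ∈ T, ‖c - y‖ ^ (f.roots.count y) := by
  rw [(IsAlgClosed.splits f).eval_eq_prod_roots, norm_mul, Finset.prod_multiset_map_count, norm_prod,
    ← Finset.prod_subset hT (f := fun y => ‖c - y‖ ^ (f.roots.count y))]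
  · simp only [norm_pow]
  · intro y _ hy
    rw [Multiset.mem_toFinset] at hy
    rw [Multiset.count_eq_zero_of_notMem hy, pow_zero]

lemma logder_sum [DecidableEq K] (f : K[X]) (T : Finset K) (hT : f.roots.toFinset ⊆ T) (c : K)
    (hc : f.eval c ≠ 0) :
    f.derivative.eval c / f.eval c = ∑ y ∈ T, (f.roots.count y : K) / (c - y) := by
  rw [(IsAlgClosed.splits f).eval_derivative_div_eval_of_ne_zero hc, Finset.sum_multiset_map_count,
    ← Finset.sum_subset hT (f := fun y => (f.roots.count y : K) / (c - y))]
  · refine Finset.sum_congr rfl fun y _ => ?_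
    rw [nsmul_eq_mul, mul_one_div]
  · intro y _ hy
    rw [Multiset.mem_toFinset] at hy
    simp [Multiset.count_eq_zero_of_notMem hy]

lemma ratl (f g : K[X]) (d : ℕ) (hd : 1 ≤ d) (hg : g.natDegree = d) (hf : f.natDegree + 1 = d)
    (hf0 : f ≠ 0) (hcop : ∀ z, f.eval z = 0 → g.eval z ≠ 0) (l ρ : ℝ) (hl : 0 < l) (hρ : 0 < ρ)
    (hlam : ∀ m : ℕ, 1 ≤ m → m ≤ d → l ≤ ‖(m : K)‖)
    (hg0 : g.eval 0 = 0) (p : K) (hp : g.eval p = 0) (hpρ : ‖p‖ = ρ)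
    (hpole : ∀ y, g.eval y = 0 → ‖y‖ ≤ ρ) :
    ∃ c, f.eval c ≠ 0 ∧ g.eval c ≠ 0 ∧ (f.derivative * g - f * g.derivative).eval c = 0 ∧
      ‖f.eval c / g.eval c‖ ≤ (‖f.leadingCoeff‖ / ‖g.leadingCoeff‖) / ρ / l ^ (d - 1) := by
  classical
  have hgne : g ≠ 0 := by rintro rfl; simp at hg; omega
  have cardf : f.roots.card = d - 1 := by
    rw [← (IsAlgClosed.splits f).natDegree_eq_card_roots]; omega
  have cardg : g.roots.card = d := by
    rw [← (IsAlgClosed.splits g).natDegree_eq_card_roots]; omega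
  have memf : ∀ y, y ∈ f.roots ↔ f.eval y = 0 := fun y => by rw [mem_roots hf0, IsRoot.def]
  have memg : ∀ y, y ∈ g.roots ↔ g.eval y = 0 := fun y => by rw [mem_roots hgne, IsRoot.def]
  set v : K → ℤ := fun y => (f.roots.count y : ℤ) - g.roots.count y with hv
  set S : Finset K := f.roots.toFinset ∪ g.roots.toFinset with hS
  have hSf : f.roots.toFinset ⊆ S := Finset.subset_union_left
  have hSg : g.roots.toFinset ⊆ S := Finset.subset_union_right
  have vpole : ∀ y, v y < 0 ↔ g.eval y = 0 := by
    intro y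
    by_cases hy : g.eval y = 0
    · have h1 : y ∉ f.roots := fun h => hcop y ((memf y).1 h) hy
      have h2 : 0 < g.roots.count y := Multiset.count_pos.2 ((memg y).2 hy)
      simp only [hv, Multiset.count_eq_zero_of_notMem h1, hy, iff_true]; omega
    · have h1 : y ∉ g.roots := fun h => hy ((memg y).1 h)
      simp only [hv, Multiset.count_eq_zero_of_notMem h1, hy, iff_false]; omega
  have vS : ∀ y, y ∈ S ↔ v y ≠ 0 := by
    intro y
    by_cases hy : g.eval y = 0
    · have : v y ≠ 0 := ((vpole y).2 hy).ne
      simp [this, hS, hgne, hy]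
    · have h1 : y ∉ g.roots := fun h => hy ((memg y).1 h)
      simp only [hS, Finset.mem_union, Multiset.mem_toFinset, h1, or_false, hv,
        Multiset.count_eq_zero_of_notMem h1]
      rw [← Multiset.count_pos]; omega
  have hsumeq : ∀ T, S ⊆ T → ∑ y ∈ T, v y = -1 := by
    intro T hT
    have h1 := Multiset.sum_count_eq_card (s := T) (m := f.roots) (fun a ha => hT (hSf (by simpa using ha)))
    have h2 := Multiset.sum_count_eq_card (s := T) (m := g.roots) (fun a ha => hT (hSg (by simpa using ha)))
    simp only [hv, Finset.sum_sub_distrib, ← Nat.cast_sum, h1, h2, cardf, cardg]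
    omega
  have hneg : ∀ U : Finset K, -(d : ℤ) ≤ ∑ y ∈ U, v y := by
    intro U
    have h2 := sum_count_le U g.roots
    simp only [hv, Finset.sum_sub_distrib, ← Nat.cast_sum]
    omega
  have hpos : ∀ U : Finset K, ∑ y ∈ U, v y ≤ ((d - 1 : ℕ) : ℤ) := by
    intro U
    have h2 := sum_count_le U f.roots
    simp only [hv, Finset.sum_sub_distrib, ← Nat.cast_sum]
    omega
  have hlam' : ∀ U : Finset K, (∑ y ∈ U, v y) ≠ 0 → l ≤ ‖((∑ y ∈ U, v y : ℤ) : K)‖ := by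
    intro U hU
    have h1 := hneg U
    have h2 := hpos U
    have h3 := hlam (∑ y ∈ U, v y).natAbs (by omega) (by omega)
    rcases Int.natAbs_eq (∑ y ∈ U, v y) with h | h <;> rw [h] <;> simpa using h3
  obtain ⟨M, hMcard, hMS, hMz, hMF⟩ := partial_frac S v (by
    intro y hy h
    have := hlam' {y} (by simpa using (vS y).1 hy)
    rw [Finset.sum_singleton, h, norm_zero] at this
    linarith) (hsumeq S subset_rfl)
  set T := S ∪ M.toFinset with hT
  have hST : S ⊆ T := Finset.subset_union_left
  set w : K → ℤ := fun y => (M.count y : ℤ) - if y ∈ S then 1 else 0 with hw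
  have hwS : ∀ y ∈ S, w y = -1 := by
    intro y hy
    have : y ∉ M := fun h => hMS y h hy
    simp [hw, hy, Multiset.count_eq_zero_of_notMem this]
  have hsubT : T.filter (fun y => y ∈ S) = S := by
    ext y; simp only [Finset.mem_filter]; exact ⟨fun h => h.2, fun h => ⟨hST h, h⟩⟩
  have hF : ∀ z ∉ T, ‖∑ y ∈ T, (v y : K) / (z - y)‖ = ∏ y ∈ T, ‖z - y‖ ^ (w y) := by
    intro z hz
    have hzS : z ∉ S := fun h => hz (hST h)
    rw [← Finset.sum_subset hST (f := fun y => (v y : K) / (z - y)), hMF z hzS]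
    · rw [Finset.prod_multiset_map_count, Finset.prod_subset (Finset.subset_union_right : M.toFinset ⊆ T)]
      · nth_rewrite 2 [← hsubT]
        rw [Finset.prod_filter, ← Finset.prod_div_distrib]
        refine Finset.prod_congr rfl fun y hy => ?_
        have hzy : ‖z - y‖ ≠ 0 := by
          rw [norm_ne_zero_iff, sub_ne_zero]; rintro rfl; exact hz hy
        simp only [hw]
        rw [zpow_sub₀ hzy, zpow_natCast]
        split_ifs <;> simp
      · intro y _ hy
        rw [Multiset.mem_toFinset] at hy
        rw [Multiset.count_eq_zero_of_notMem hy, pow_zero]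
    · intro y _ hy
      have : v y = 0 := by by_contra h; exact hy ((vS y).2 h)
      simp [this]
  have hws : ∑ y ∈ T, w y = -1 := by
    have h1 := Multiset.sum_count_eq_card (s := T) (m := M) (fun a ha => by simp [hT, ha])
    simp only [hw, Finset.sum_sub_distrib, ← Nat.cast_sum, h1]
    rw [← Finset.sum_filter, hsubT, hMcard]
    simp
  have hAf : 0 < ‖f.leadingCoeff‖ := norm_pos_iff.2 (leadingCoeff_ne_zero.2 hf0)
  have hAg : 0 < ‖g.leadingCoeff‖ := norm_pos_iff.2 (leadingCoeff_ne_zero.2 hgne)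
  have inT : ∀ y, g.eval y = 0 → y ∈ T := fun y hy => hST ((vS y).2 ((vpole y).2 hy).ne)
  obtain ⟨c, hcT, hvc, hc⟩ := core T v w (‖f.leadingCoeff‖ / ‖g.leadingCoeff‖) l ρ d hd
    (div_pos hAf hAg) hl hρ (fun y _ h => hwS y ((vS y).2 h)) (hsumeq T hST) hws
    (fun U _ => hneg U) (fun y _ => by simpa using hpos {y}) (fun U _ => hlam' U)
    (delta_lower T v w hF) (inT 0 hg0) ((vpole 0).2 hg0) p (inT p hp) ((vpole p).2 hp) hpρ
    (fun y _ h => hpole y ((vpole y).1 h))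
  have hcS : c ∉ S := fun h => (vS c).1 h hvc
  have hcM : c ∈ M := by
    rw [hT, Finset.mem_union, Multiset.mem_toFinset] at hcT; tauto
  have hfc : f.eval c ≠ 0 := fun h => hcS (hSf (by simpa [hf0] using h))
  have hgc : g.eval c ≠ 0 := fun h => hcS (hSg (by simpa [hgne] using h))
  refine ⟨c, hfc, hgc, ?_, ?_⟩
  · have h1 := hMz c hcM
    have h2 := logder_sum f S hSf c hfc
    have h3 := logder_sum g S hSg c hgc
    simp only [hv, Int.cast_sub, Int.cast_natCast, sub_div, Finset.sum_sub_distrib] at h1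
    rw [← h2, ← h3, div_sub_div _ _ hfc hgc, div_eq_zero_iff] at h1
    rcases h1 with h1 | h1
    · simpa using h1
    · exact absurd h1 (mul_ne_zero hfc hgc)
  · convert hc using 1
    rw [norm_div, norm_eval_prod f T (hSf.trans hST) c, norm_eval_prod g T (hSg.trans hST) c,
      mul_div_mul_comm, ← Finset.prod_div_distrib]
    congr 1
    refine Finset.prod_congr rfl fun y hy => ?_
    by_cases hcy : c = y
    · subst hcy
      have h1 : c ∉ f.roots := fun h => hcS (hSf (by simpa using h))
      have h2 : c ∉ g.roots := fun h => hcS (hSg (by simpa using h))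
      simp [hvc, Multiset.count_eq_zero_of_notMem h1, Multiset.count_eq_zero_of_notMem h2]
    · have : ‖c - y‖ ≠ 0 := by rwa [norm_ne_zero_iff, sub_ne_zero]
      simp only [hv]
      rw [zpow_sub₀ this, zpow_natCast, zpow_natCast]

end ratl

lemma eval_reverse_inv {K : Type*} [Field K] (p : K[X]) (z : K) (hz : z ≠ 0) :
    p.eval z = z ^ p.natDegree * p.reverse.eval z⁻¹ := by
  letI : Invertible z := invertibleOfNonzero hz
  have := Polynomial.eval₂_reverse_mul_pow (RingHom.id K) z p
  rw [invOf_eq_inv] at this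
  simp only [Polynomial.eval₂_id] at this
  rw [← this, mul_comm]

lemma reverse_natDegree_of {K : Type*} [Field K] (p : K[X]) (h : p.eval 0 ≠ 0) :
    p.reverse.natDegree = p.natDegree ∧ p.reverse.leadingCoeff = p.eval 0 := by
  have h0 : p.coeff 0 ≠ 0 := by rwa [coeff_zero_eq_eval_zero]
  have ht : p.natTrailingDegree = 0 := natTrailingDegree_eq_zero.2 (Or.inr h0)
  refine ⟨by rw [reverse_natDegree, ht, Nat.sub_zero], ?_⟩
  rw [reverse_leadingCoeff, trailingCoeff, ht, coeff_zero_eq_eval_zero]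

lemma deriv_inv_form {K : Type*} [NontriviallyNormedField K] (F G : K[X]) (z0 c : K) (hc : c ≠ 0)
    (d : ℕ) (h : ∀ z : K, z ≠ 0 → F.eval (z0 + z) = z ^ d * G.eval z⁻¹) :
    F.derivative.eval (z0 + c⁻¹) = d * (c⁻¹) ^ (d - 1) * G.eval c
      + (c⁻¹) ^ d * (G.derivative.eval c * -(c ^ 2)) := by
  have hci : c⁻¹ ≠ 0 := inv_ne_zero hc
  have h1 : HasDerivAt (fun z => F.eval (z0 + z)) (F.derivative.eval (z0 + c⁻¹)) c⁻¹ :=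
    HasDerivAt.comp_const_add z0 c⁻¹ (F.hasDerivAt _)
  have hG : HasDerivAt (fun z : K => G.eval z⁻¹) (G.derivative.eval c * -(c ^ 2)) c⁻¹ := by
    have ha := hasDerivAt_inv hci
    have hb : HasDerivAt (fun w : K => G.eval w) (G.derivative.eval (c⁻¹)⁻¹) (c⁻¹)⁻¹ := G.hasDerivAt _
    have hh := hb.comp c⁻¹ ha
    have e : -((c⁻¹ : K) ^ 2)⁻¹ = -(c ^ 2) := by simp
    rw [e, inv_inv] at hh
    exact hh
  have h2 := (hasDerivAt_pow d (c⁻¹ : K)).mul hG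
  have h3 : (fun z => F.eval (z0 + z)) =ᶠ[nhds c⁻¹] fun z => z ^ d * G.eval z⁻¹ := by
    filter_upwards [isOpen_ne.mem_nhds hci] with z hz
    exact h z hz
  have h4 := h1.unique (h2.congr_of_eventuallyEq h3)
  rw [h4, inv_inv]

theorem nonzero_critical_value_location
    {K : Type*} [NontriviallyNormedField K] [IsAlgClosed K]
    [CompleteSpace K] [IsUltrametricDist K]
    (d : ℕ) (hd : 2 ≤ d) (hlam : 0 < lam K d)
    (f g : Polynomial K) (hcop : IsCoprime f g)
    (hdegf : f.natDegree = d) (hdegfg : g.natDegree < f.natDegree)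
    (hdegg : 1 ≤ g.natDegree)
    (z0 : K) (hz0 : g.eval z0 ≠ 0)
    (hz0' : (f.derivative * g - f * g.derivative).eval z0 ≠ 0)
    (r : ℝ) (hr : IsLeast {t : ℝ | ∃ π : K, g.eval π = 0 ∧ t = ‖π - z0‖} r) :
    ∃ c : K, g.eval c ≠ 0 ∧ (f.derivative * g - f * g.derivative).eval c = 0 ∧
      0 < ‖f.eval c / g.eval c - f.eval z0 / g.eval z0‖ ∧
      ‖f.eval c / g.eval c - f.eval z0 / g.eval z0‖ ≤
        lam K d ^ (-((d : ℤ) - 1)) *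
          (‖(f.derivative * g - f * g.derivative).eval z0‖ / ‖g.eval z0‖ ^ 2) * r := by
  classical
  obtain ⟨⟨π, hπ, hrπ⟩, hrmin⟩ := hr
  have hπz : π - z0 ≠ 0 := by
    intro h; rw [sub_eq_zero] at h; exact hz0 (h ▸ hπ)
  have hr0 : 0 < r := hrπ ▸ norm_pos_iff.2 hπz
  have hlam' : ∀ m : ℕ, 1 ≤ m → m ≤ d → lam K d ≤ ‖(m : K)‖ := by
    intro m h1 h2
    exact ciInf_le (f := fun m : Finset.Icc 1 d => ‖((m : ℕ) : K)‖)
      (Set.finite_range _).bddBelow ⟨m, Finset.mem_Icc.2 ⟨h1, h2⟩⟩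
  set q0 : K := f.eval z0 / g.eval z0 with hq0
  set k : K[X] := f - C q0 * g with hk
  have hkdeg : k.natDegree = d := by
    rw [hk, natDegree_sub_eq_left_of_natDegree_lt, hdegf]
    exact (natDegree_C_mul_le _ _).trans_lt hdegfg
  set f1 : K[X] := k.comp (X + C z0) with hf1
  set g1 : K[X] := g.comp (X + C z0) with hg1
  have hf1deg : f1.natDegree = d := by rw [hf1, natDegree_comp, natDegree_X_add_C, mul_one, hkdeg]
  have hg1deg : g1.natDegree = g.natDegree := by rw [hg1, natDegree_comp, natDegree_X_add_C, mul_one]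
  have hf1e : ∀ z, f1.eval z = k.eval (z0 + z) := fun z => by simp [hf1, add_comm]
  have hg1e : ∀ z, g1.eval z = g.eval (z0 + z) := fun z => by simp [hg1, add_comm]
  have hke : ∀ z, k.eval z = f.eval z - q0 * g.eval z := fun z => by simp [hk]
  have hf10 : f1.eval 0 = 0 := by
    rw [hf1e, add_zero, hke, hq0, div_mul_cancel₀ _ hz0, sub_self]
  obtain ⟨h, hh⟩ : X ∣ f1 := by rw [X_dvd_iff, coeff_zero_eq_eval_zero, hf10]
  have hh0 : h ≠ 0 := by
    rintro rfl; rw [mul_zero] at hh; rw [hh] at hf1deg; simp at hf1deg; omega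
  have hhdeg : h.natDegree + 1 = d := by
    rw [← hf1deg, hh, natDegree_X_mul hh0]
  have hg10 : g1.eval 0 ≠ 0 := by rw [hg1e, add_zero]; exact hz0
  have hhe : h.eval 0 = (f.derivative * g - f * g.derivative).eval z0 / g.eval z0 := by
    have h1 : f1.derivative.eval 0 = h.eval 0 := by rw [hh]; simp
    have h2 : f1.derivative.eval 0 = k.derivative.eval z0 := by
      rw [hf1, derivative_comp]; simp
    rw [← h1, h2, hk]
    simp only [derivative_sub, derivative_C_mul, eval_sub, eval_mul, eval_C, hq0]
    field_simp
  have hh00 : h.eval 0 ≠ 0 := by rw [hhe]; exact div_ne_zero hz0' hz0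
  obtain ⟨hhr1, hhr2⟩ := reverse_natDegree_of h hh00
  obtain ⟨hgr1, hgr2⟩ := reverse_natDegree_of g1 hg10
  have hg1r0 : g1.reverse ≠ 0 := by
    rw [Ne, reverse_eq_zero]; rintro h0; rw [h0] at hg10; simp at hg10
  set ft : K[X] := h.reverse with hft
  set gt : K[X] := X ^ (d - g.natDegree) * g1.reverse with hgt
  have hft0 : ft ≠ 0 := by rw [hft, Ne, reverse_eq_zero]; exact hh0
  have hgtdeg : gt.natDegree = d := by
    rw [hgt, natDegree_mul (pow_ne_zero _ X_ne_zero) hg1r0, natDegree_X_pow, hgr1, hg1deg]; omega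
  have hgtlc : gt.leadingCoeff = g.eval z0 := by
    rw [hgt, leadingCoeff_mul, leadingCoeff_X_pow, one_mul, hgr2, hg1e, add_zero]
  have fF : ∀ z : K, z ≠ 0 → k.eval (z0 + z) = z ^ d * ft.eval z⁻¹ := by
    intro z hz
    rw [← hf1e, hh, eval_mul, eval_X, eval_reverse_inv h z hz, ← hhdeg, pow_succ', mul_assoc]
  have gF : ∀ z : K, z ≠ 0 → g.eval (z0 + z) = z ^ d * gt.eval z⁻¹ := by
    intro z hz
    rw [← hg1e, eval_reverse_inv g1 z hz, hgt, eval_mul, eval_pow, eval_X, hg1deg, ← mul_assoc]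
    congr 1
    have e : z ^ d = z ^ (g.natDegree + (d - g.natDegree)) := by congr 1; omega
    rw [e, pow_add, mul_assoc, ← mul_pow, mul_inv_cancel₀ hz, one_pow, mul_one]
  have hgt0 : gt.eval 0 = 0 := by
    have : d - g.natDegree ≠ 0 := by omega
    simp [hgt, this]
  have hrootg : ∀ w : K, w ≠ 0 → (gt.eval w = 0 ↔ g.eval (z0 + w⁻¹) = 0) := by
    intro w hw
    rw [gF _ (inv_ne_zero hw), inv_inv]
    simp [hw]
  have hrootf : ∀ w : K, w ≠ 0 → (ft.eval w = 0 ↔ k.eval (z0 + w⁻¹) = 0) := by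
    intro w hw
    rw [fF _ (inv_ne_zero hw), inv_inv]
    simp [hw]
  obtain ⟨c, hfc, hgc, hW, hb⟩ := ratl ft gt d (by omega) hgtdeg (by rw [hhr1]; exact hhdeg) hft0
    (by
      intro w hw hgw
      by_cases hw0 : w = 0
      · subst hw0
        rw [hft, ← coeff_zero_eq_eval_zero, coeff_zero_reverse] at hw
        exact hh0 (leadingCoeff_eq_zero.1 hw)
      · rw [hrootf w hw0, hke] at hw
        rw [hrootg w hw0] at hgw
        rw [hgw, mul_zero, sub_zero] at hw
        obtain ⟨a, b, hab⟩ := hcop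
        have := congrArg (eval (z0 + w⁻¹)) hab
        simp [hw, hgw] at this)
    (lam K d) r⁻¹ hlam (inv_pos.2 hr0) hlam' hgt0 (π - z0)⁻¹
    (by rw [hrootg _ (inv_ne_zero hπz), inv_inv]; simpa using hπ)
    (by rw [norm_inv, hrπ])
    (by
      intro y hy
      by_cases hy0 : y = 0
      · subst hy0; simp [hr0.le]
      · rw [hrootg y hy0] at hy
        have := hrmin ⟨_, hy, rfl⟩
        rw [add_sub_cancel_left, norm_inv] at this
        rwa [le_inv_comm₀ hr0 (norm_pos_iff.2 hy0)] at this)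
  have hc0 : c ≠ 0 := by rintro rfl; exact hgc hgt0
  have hci : c⁻¹ ≠ 0 := inv_ne_zero hc0
  have hgC : g.eval (z0 + c⁻¹) ≠ 0 := fun h0 => hgc ((hrootg c hc0).2 h0)
  have hval : f.eval (z0 + c⁻¹) / g.eval (z0 + c⁻¹) - q0 = ft.eval c / gt.eval c := by
    have h1 : f.eval (z0 + c⁻¹) / g.eval (z0 + c⁻¹) - q0 = k.eval (z0 + c⁻¹) / g.eval (z0 + c⁻¹) := by
      rw [hke, sub_div, mul_div_cancel_right₀ _ hgC]
    rw [h1, fF _ hci, gF _ hci, inv_inv, mul_div_mul_left _ _ (pow_ne_zero _ hci)]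
  refine ⟨z0 + c⁻¹, hgC, ?_, ?_, ?_⟩
  · have hWk : (f.derivative * g - f * g.derivative).eval (z0 + c⁻¹)
        = k.derivative.eval (z0 + c⁻¹) * g.eval (z0 + c⁻¹)
          - k.eval (z0 + c⁻¹) * g.derivative.eval (z0 + c⁻¹) := by
      simp only [hk, derivative_sub, derivative_C_mul, eval_sub, eval_mul, eval_C]; ring
    rw [hWk, deriv_inv_form k ft z0 c hc0 d fF, deriv_inv_form g gt z0 c hc0 d gF, fF _ hci, gF _ hci,
      inv_inv]
    simp only [eval_sub, eval_mul] at hW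
    linear_combination (-((c⁻¹) ^ d * (c⁻¹) ^ d * c ^ 2)) * hW
  · rw [hval, norm_pos_iff]
    exact div_ne_zero hfc hgc
  · rw [hval]
    refine hb.trans (le_of_eq ?_)
    rw [hhr2, hhe, hgtlc, norm_div]
    have e : -((d : ℤ) - 1) = -((d - 1 : ℕ) : ℤ) := by omega
    rw [e, zpow_neg, zpow_natCast]
    have : ‖g.eval z0‖ ≠ 0 := norm_ne_zero_iff.2 hz0
    field_simp
end
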